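/- arXiv:1807.04810 — 3 statements merged into one kernel-verified Lean document; each statement's English description precedes it below -/
import Mathlib

section
/- For every natural number M there exist a finite connected 6-regular simple graph Γ with |V(Γ)| ≥ M and a subgroup G ≤ Aut(Γ) acting transitively on the arcs of Γ, such that for every vertex v the local action G_v^{Γ(v)} is permutation isomorphic to A_4(6) and the vertex-stabiliser satisfies |G_v|^{144} ≥ 2^{|V(Γ)|}. (In particular, the permutation group A_4(6) is of exponential type.) -/
/-- A permutation `g` of the vertex set is an automorphism of the graph `Γ`. -/
def IsGraphAut {V : Type*} (Γ : SimpleGraph V) (g : Equiv.Perm V) : Prop :=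
  ∀ u v : V, Γ.Adj (g u) (g v) ↔ Γ.Adj u v

/-- The subgroup `G` acts transitively on the arcs of `Γ`. -/
def ArcTransitiveOn {V : Type*} (Γ : SimpleGraph V) (G : Subgroup (Equiv.Perm V)) : Prop :=
  ∀ u v u' v' : V, Γ.Adj u v → Γ.Adj u' v' → ∃ g ∈ G, g u = u' ∧ g v = v'

/-- The local action of `G` at `v`: the set of permutations of the neighbourhood of `v`
induced by elements of the vertex-stabiliser of `v` in `G`. -/
def localActionSet {V : Type*} (Γ : SimpleGraph V) (G : Subgroup (Equiv.Perm V)) (v : V) :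
    Set (Equiv.Perm (Γ.neighborSet v)) :=
  {p | ∃ g ∈ G, g v = v ∧ ∀ u : Γ.neighborSet v, (p u : V) = g (u : V)}

/-- Permutation isomorphism between a set of permutations of `Ω` and a set of
permutations of `Δ`: a bijection `e : Ω ≃ Δ` conjugating the first set onto the second. -/
def PermIsomorphic {Ω Δ : Type*} (P : Set (Equiv.Perm Ω)) (Q : Set (Equiv.Perm Δ)) : Prop :=
  ∃ e : Ω ≃ Δ, ∀ q : Equiv.Perm Δ, q ∈ Q ↔ ∃ p ∈ P, ∀ ω : Ω, e (p ω) = q (e ω)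

/-- The double transposition `(1 2)(3 4)` (0-indexed: `(0 1)(2 3)`). -/
def doubleTransposition : Equiv.Perm (Fin 4) := Equiv.swap 0 1 * Equiv.swap 2 3

/-- The subgroup `⟨(1 2)(3 4)⟩` of `Alt(4)`. -/
def Halt : Subgroup (alternatingGroup (Fin 4)) :=
  Subgroup.zpowers ⟨doubleTransposition, by rw [Equiv.Perm.mem_alternatingGroup]; decide⟩

/-- `A₄(6)`: the image of `Alt(4)` in the symmetric group on the 6 left cosets of
`⟨(1 2)(3 4)⟩`, under the left multiplication action. -/
def A46 : Subgroup (Equiv.Perm (alternatingGroup (Fin 4) ⧸ Halt)) :=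
  (MulAction.toPermHom (alternatingGroup (Fin 4)) (alternatingGroup (Fin 4) ⧸ Halt)).range


namespace Expo

section Layer

variable {B W V : Type} [Group B] [MulAction B W]

/-- powers of `a` indexed by `ZMod 3` -/
def cpow (a : B) (i : ZMod 3) : B := a ^ i.val

lemma cpow_add {a : B} (ha : a ^ 3 = 1) (i j : ZMod 3) : cpow a (i + j) = cpow a i * cpow a j := by
  unfold cpow
  rw [← pow_add, ZMod.val_add, ← Nat.mod_add_div (i.val + j.val) 3, pow_add, pow_mul, ha]
  simp

lemma cpow_zero (a : B) : cpow a 0 = 1 := by simp [cpow]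

lemma cpow_one (a : B) : cpow a 1 = a := by
  have : (1 : ZMod 3).val = 1 := rfl
  simp [cpow, this]

lemma cpow_two (a : B) : cpow a 2 = a ^ 2 := by
  have : (2 : ZMod 3).val = 2 := rfl
  simp [cpow, this]

lemma cpow_neg {a : B} (ha : a ^ 3 = 1) (i : ZMod 3) : cpow a (-i) = (cpow a i)⁻¹ := by
  rw [eq_inv_iff_mul_eq_one, ← cpow_add ha, neg_add_cancel, cpow_zero]

/-- the code: functions summing to zero on each neighbourhood -/
def code (a b : B) (o : W) : Submodule (ZMod 2) (W → ZMod 2) where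
  carrier := {f | ∀ g : B, ∑ i : ZMod 3, f ((g * cpow a i * b) • o) = 0}
  add_mem' := by
    intro f f' hf hf' g
    simp only [Pi.add_apply, Finset.sum_add_distrib, hf g, hf' g, add_zero]
  zero_mem' := by intro g; simp
  smul_mem' := by
    intro c f hf g
    simp only [Pi.smul_apply, smul_eq_mul, ← Finset.mul_sum, hf g, mul_zero]

lemma code_smul {a b : B} {o : W} {f : W → ZMod 2} (hf : f ∈ code a b o) (h : B) :
    (fun w => f (h • w)) ∈ code a b o := by
  intro g
  have := hf (h * g)
  simpa [mul_smul] using this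

/-- The hypotheses on the action. -/
structure Good (a b : B) (o : W) (F : W → ZMod 2) : Prop where
  ha : a ^ 3 = 1
  hb : b * b = 1
  gen : Subgroup.closure {a, b} = ⊤
  trans : ∀ w : W, ∃ g : B, g • o = w
  stab : ∀ g : B, g • o = o → ∃ i, g = cpow a i
  fix : a • o = o
  hbo : b • o ≠ o
  inj : ∀ i, (cpow a i * b) • o = b • o → i = 0
  hF : F ∈ code a b o
  F0 : F o = 0
  F1 : F (b • o) = 1
  F2 : F ((a * b) • o) = 1
  F3 : F ((a ^ 2 * b) • o) = 0

variable {a b : B} {o : W} {F : W → ZMod 2}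

lemma Good.cfix (h : Good a b o F) (i : ZMod 3) : cpow a i • o = o := by
  unfold cpow
  generalize i.val = n
  induction n with
  | zero => simp
  | succ n ih => rw [pow_succ, mul_smul, h.fix, ih]

/-- The twisted permutations. -/
def tw (e : V ≃ W × ZMod 2) (g : B) (f : W → ZMod 2) : Equiv.Perm V where
  toFun v := e.symm (g • (e v).1, (e v).2 + f (e v).1)
  invFun v := e.symm (g⁻¹ • (e v).1, (e v).2 - f (g⁻¹ • (e v).1))
  left_inv v := by simp
  right_inv v := by simp

lemma tw_apply (e : V ≃ W × ZMod 2) (g : B) (f : W → ZMod 2) (v : V) :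
    e (tw e g f v) = (g • (e v).1, (e v).2 + f (e v).1) := by
  simp [tw]

/-- The graph. -/
def gr (h : Good a b o F) (e : V ≃ W × ZMod 2) : SimpleGraph V where
  Adj u v := ∃ g : B, (e u).1 = g • o ∧ (e v).1 = (g * b) • o
  symm := ⟨by
    rintro u v ⟨g, h1, h2⟩
    refine ⟨g * b, h2, ?_⟩
    rw [mul_assoc, h.hb, mul_one, h1]⟩
  loopless := ⟨by
    rintro u ⟨g, h1, h2⟩
    rw [h1, mul_smul] at h2
    exact h.hbo ((smul_left_cancel g h2).symm)⟩

/-- The group. -/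
def grp (a b : B) (o : W) (e : V ≃ W × ZMod 2) : Subgroup (Equiv.Perm V) where
  carrier := {σ | ∃ g : B, ∃ f ∈ code a b o, ∀ v, e (σ v) = (g • (e v).1, (e v).2 + f (e v).1)}
  mul_mem' := by
    rintro σ τ ⟨g, f, hf, h1⟩ ⟨g', f', hf', h2⟩
    refine ⟨g * g', f' + (fun w => f (g' • w)), Submodule.add_mem _ hf' (code_smul hf g'), ?_⟩
    intro v
    simp [Equiv.Perm.mul_apply, h1, h2, mul_smul, add_assoc]
  one_mem' := ⟨1, 0, Submodule.zero_mem _, by intro v; simp⟩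
  inv_mem' := by
    rintro σ ⟨g, f, hf, h1⟩
    refine ⟨g⁻¹, -(fun w => f (g⁻¹ • w)), Submodule.neg_mem _ (code_smul hf g⁻¹), ?_⟩
    intro v
    obtain ⟨u, rfl⟩ := σ.surjective v
    have h0 : σ⁻¹ (σ u) = u := σ.symm_apply_apply u
    rw [h0, h1]
    ext
    · simp
    · simp only [Pi.neg_apply, inv_smul_smul]; ring

lemma tw_mem (e : V ≃ W × ZMod 2) (g : B) {f : W → ZMod 2} (hf : f ∈ code a b o) :
    tw e g f ∈ grp a b o e := ⟨g, f, hf, tw_apply e g f⟩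

lemma grp_aut (h : Good a b o F) (e : V ≃ W × ZMod 2) : ∀ σ ∈ grp a b o e,
    IsGraphAut (gr h e) σ := by
  rintro σ ⟨k, f, hf, h1⟩ u v
  constructor
  · rintro ⟨g, h2, h3⟩
    rw [h1] at h2 h3
    refine ⟨k⁻¹ * g, ?_, ?_⟩
    · rw [mul_smul, ← h2]; simp
    · rw [mul_assoc, mul_smul, ← h3]; simp
  · rintro ⟨g, h2, h3⟩
    refine ⟨k * g, ?_, ?_⟩
    · rw [h1, mul_smul, ← h2]
    · rw [h1, mul_assoc, mul_smul, ← h3]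

lemma grp_arc (h : Good a b o F) (e : V ≃ W × ZMod 2) :
    ArcTransitiveOn (gr h e) (grp a b o e) := by
  rintro u v u' v' ⟨g, h1, h2⟩ ⟨g', h1', h2'⟩
  let f : W → ZMod 2 := ((e u').2 - (e u).2) • (fun w => F ((b * g⁻¹) • w)) +
    ((e v').2 - (e v).2) • (fun w => F (g⁻¹ • w))
  have hf : f ∈ code a b o := Submodule.add_mem _ (Submodule.smul_mem _ _ (code_smul h.hF _))
    (Submodule.smul_mem _ _ (code_smul h.hF _))
  refine ⟨tw e (g' * g⁻¹) f, tw_mem e _ hf, ?_, ?_⟩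
  · apply e.injective
    rw [tw_apply]
    ext
    · simp [h1, h1', ← mul_smul]
    · simp [f, h1, ← mul_smul, h.F0, h.F1]
  · apply e.injective
    rw [tw_apply]
    ext
    · simp [h2, h2', ← mul_smul, mul_assoc]
    · simp [f, h2, ← mul_smul, h.F0, h.F1, mul_assoc, h.hb]

lemma gr_conn (h : Good a b o F) (e : V ≃ W × ZMod 2) : (gr h e).Connected := by
  let v0 : V := e.symm (o, 0)
  have key : ∀ g : B, ∀ v, (e v).1 = g • o → (gr h e).Reachable v0 v := by
    intro g
    have hg : g ∈ Subgroup.closure {a, b} := by rw [h.gen]; trivial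
    induction hg using Subgroup.closure_induction_right with
    | one =>
      intro v hv
      have A1 : (gr h e).Adj v0 (e.symm (b • o, 0)) := ⟨1, by simp [v0], by simp⟩
      have A2 : (gr h e).Adj v (e.symm (b • o, 0)) := ⟨1, by simp [hv], by simp⟩
      exact A1.reachable.trans A2.symm.reachable
    | mul_right x hx y hy ih =>
      intro v hv
      rcases hy with rfl | rfl
      · apply ih; rw [hv, mul_smul, h.fix]
      · have A1 : (gr h e).Adj (e.symm (x • o, 0)) v := ⟨x, by simp, hv⟩
        exact (ih (e.symm (x • o, 0)) (by simp)).trans A1.reachable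
    | mul_inv_cancel x hx y hy ih =>
      intro v hv
      rcases hy with rfl | rfl
      · apply ih; rw [hv, mul_smul]; congr 1
        rw [inv_smul_eq_iff, h.fix]
      · have A1 : (gr h e).Adj (e.symm (x • o, 0)) v := ⟨x, by simp, by
          rw [hv]; congr 2; rw [inv_eq_iff_mul_eq_one, h.hb]⟩
        exact (ih (e.symm (x • o, 0)) (by simp)).trans A1.reachable
  have hr : ∀ v, (gr h e).Reachable v0 v := by
    intro v
    obtain ⟨g, hg⟩ := h.trans (e v).1
    exact key g v hg.symm
  exact { preconnected := fun u v => (hr u).symm.trans (hr v), nonempty := ⟨v0⟩ }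

/-- Parametrisation of neighbours. -/
lemma nb_exists (h : Good a b o F) (e : V ≃ W × ZMod 2) (v : V) (g : B) (hg : (e v).1 = g • o) :
    ∃ nb : (ZMod 3 × ZMod 2) ≃ (gr h e).neighborSet v,
      ∀ x, e (nb x : V) = ((g * cpow a x.1 * b) • o, x.2) := by
  have hadj : ∀ x : ZMod 3 × ZMod 2,
      (gr h e).Adj v (e.symm ((g * cpow a x.1 * b) • o, x.2)) := by
    intro x
    refine ⟨g * cpow a x.1, ?_, by simp⟩
    rw [hg, mul_smul, h.cfix]
  refine ⟨Equiv.ofBijective (fun x => ⟨e.symm ((g * cpow a x.1 * b) • o, x.2), hadj x⟩) ⟨?_, ?_⟩, ?_⟩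
  · rintro ⟨i, δ⟩ ⟨i', δ'⟩ hx
    have h1 := congrArg Subtype.val hx
    have h2 := e.symm.injective h1
    simp only [Prod.mk.injEq] at h2
    obtain ⟨h3, rfl⟩ := h2
    have h4 : (cpow a (i - i') * b) • o = b • o := by
      rw [sub_eq_neg_add, cpow_add h.ha, cpow_neg h.ha]
      simp only [mul_smul] at h3 ⊢
      rw [smul_left_cancel g h3]; simp
    have := h.inj _ h4
    rw [sub_eq_zero.1 this]
  · rintro ⟨u, k, h1, h2⟩
    rw [hg] at h1
    have h3 : (g⁻¹ * k) • o = o := by rw [mul_smul, ← h1]; simp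
    obtain ⟨i, hi⟩ := h.stab _ h3
    refine ⟨(i, (e u).2), ?_⟩
    apply Subtype.ext
    apply e.injective
    simp only [Equiv.apply_symm_apply]
    ext
    · simp [h2, ← hi]
    · rfl
  · intro x; exact e.apply_symm_apply _

lemma local_iff (h : Good a b o F) (e : V ≃ W × ZMod 2) (v : V) (g : B) (hg : (e v).1 = g • o)
    (nb : (ZMod 3 × ZMod 2) ≃ (gr h e).neighborSet v)
    (hnb : ∀ x, e (nb x : V) = ((g * cpow a x.1 * b) • o, x.2))
    (p : Equiv.Perm ((gr h e).neighborSet v)) :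
    p ∈ localActionSet (gr h e) (grp a b o e) v ↔ ∃ (j : ZMod 3) (E : ZMod 3 → ZMod 2),
      ∑ i, E i = 0 ∧ ∀ x, p (nb x) = nb (x.1 + j, x.2 + E x.1) := by
  constructor
  · rintro ⟨σ, ⟨k, f, hf, h1⟩, h2, h3⟩
    have h4 := h1 v
    rw [h2, hg] at h4
    have h5 : (g⁻¹ * (k * g)) • o = o := by
      have := congrArg Prod.fst h4
      simp only [hg] at this
      rw [mul_smul, mul_smul, ← this]; simp
    obtain ⟨j, hj⟩ := h.stab _ h5
    have hj' : k * g = g * cpow a j := by rw [← hj]; simp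
    refine ⟨j, fun i => f ((g * cpow a i * b) • o), hf g, ?_⟩
    intro x
    apply Subtype.ext
    rw [h3]
    apply e.injective
    rw [h1, hnb, hnb]
    ext
    · simp only [← mul_smul]
      rw [add_comm, cpow_add h.ha]
      simp only [← mul_assoc]
      rw [hj']
    · rfl
  · rintro ⟨j, E, hE, hp⟩
    let f : W → ZMod 2 := E 1 • (fun w => F (g⁻¹ • w)) + E 2 • (fun w => F ((a * g⁻¹) • w))
    have hf : f ∈ code a b o := Submodule.add_mem _ (Submodule.smul_mem _ _ (code_smul h.hF _))
      (Submodule.smul_mem _ _ (code_smul h.hF _))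
    have hE' : E 0 = E 1 + E 2 := by
      have : E 0 + E 1 + E 2 = 0 := by rw [← hE]; exact (Fin.sum_univ_three E).symm
      generalize E 0 = x at *
      generalize E 1 = y at *
      generalize E 2 = z at *
      revert x y z; decide
    have hf1 : f (g • o) = 0 := by
      simp [f, ← mul_smul, h.fix, h.F0]
    have ha3 : a * (a ^ 2 * b) = b := by
      rw [← mul_assoc, ← pow_succ', h.ha, one_mul]
    have hf2 : ∀ i, f ((g * cpow a i * b) • o) = E i := by
      intro i
      have hc : i = 0 ∨ i = 1 ∨ i = 2 := by revert i; decide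
      rcases hc with rfl | rfl | rfl
      · simp [f, cpow_zero, ← mul_smul, mul_assoc, h.F1, h.F2, hE']
      · have : a * (a * b) = a ^ 2 * b := by rw [pow_two, mul_assoc]
        simp [f, cpow_one, ← mul_smul, mul_assoc, h.F2, h.F3, this]
      · simp [f, cpow_two, ← mul_smul, mul_assoc, h.F1, h.F3, ha3]
    refine ⟨tw e (g * cpow a j * g⁻¹) f, tw_mem e _ hf, ?_, ?_⟩
    · apply e.injective
      rw [tw_apply]
      ext
      · simp only [hg, ← mul_smul]
        simp [mul_smul, h.cfix]
      · simp [hg, hf1]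
    · intro u
      obtain ⟨x, rfl⟩ := nb.surjective u
      rw [hp]
      apply e.injective
      rw [tw_apply, hnb, hnb]
      ext
      · simp only [← mul_smul]
        rw [add_comm, cpow_add h.ha]
        simp [mul_assoc]
      · simp [hf2]

end Layer

section Model

/-- a double transposition different from `doubleTransposition` -/
def dt2 : Equiv.Perm (Fin 4) := Equiv.swap 0 2 * Equiv.swap 1 3

/-- a three-cycle -/
def tc : Equiv.Perm (Fin 4) := Equiv.swap 0 1 * Equiv.swap 1 2

/-- coset representatives -/
def rep (x : ZMod 3 × ZMod 2) : Equiv.Perm (Fin 4) := tc ^ x.1.val * dt2 ^ x.2.val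

lemma rep_mem : ∀ x, rep x ∈ alternatingGroup (Fin 4) := by
  have : ∀ x, Equiv.Perm.sign (rep x) = 1 := by decide
  exact this

/-- coset representatives -/
def repA (x : ZMod 3 × ZMod 2) : alternatingGroup (Fin 4) := ⟨rep x, rep_mem x⟩

lemma mem_Halt (s : alternatingGroup (Fin 4)) :
    s ∈ Halt ↔ (s : Equiv.Perm (Fin 4)) = 1 ∨ (s : Equiv.Perm (Fin 4)) = doubleTransposition := by
  unfold Halt
  constructor
  · intro hs
    rw [Subgroup.mem_zpowers_iff] at hs
    obtain ⟨k, rfl⟩ := hs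
    have h2 : doubleTransposition ^ (2 : ℤ) = 1 := by decide
    push_cast
    rcases Int.even_or_odd' k with ⟨c, rfl | rfl⟩
    · left; rw [zpow_mul, h2, one_zpow]
    · right; rw [zpow_add, zpow_mul, h2, one_zpow, one_mul, zpow_one]
  · rintro (hs | hs)
    · have : s = 1 := Subtype.ext hs
      rw [this]; exact Subgroup.one_mem _
    · rw [Subgroup.mem_zpowers_iff]
      exact ⟨1, by rw [zpow_one]; exact Subtype.ext hs.symm⟩

lemma mk_eq (s t : alternatingGroup (Fin 4)) :
    (QuotientGroup.mk s : alternatingGroup (Fin 4) ⧸ Halt) = QuotientGroup.mk t ↔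
      ((t : Equiv.Perm (Fin 4)) = s ∨ (t : Equiv.Perm (Fin 4)) = s * doubleTransposition) := by
  rw [QuotientGroup.eq, mem_Halt]
  push_cast
  rw [inv_mul_eq_iff_eq_mul, inv_mul_eq_iff_eq_mul, mul_one]

lemma dec_inj : ∀ x y, (rep y = rep x ∨ rep y = rep x * doubleTransposition) → x = y := by
  decide

lemma dec_surj : ∀ s : Equiv.Perm (Fin 4), Equiv.Perm.sign s = 1 →
    ∃ x, s = rep x ∨ s = rep x * doubleTransposition := by
  decide

/-- the model of a zero-sum triple -/
def tri (p q : ZMod 2) (i : ZMod 3) : ZMod 2 := if i = 0 then p + q else if i = 1 then p else q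

set_option maxRecDepth 10000 in
lemma dec_fwd : ∀ s : Equiv.Perm (Fin 4), Equiv.Perm.sign s = 1 →
    ∃ (j : ZMod 3) (p q : ZMod 2), ∀ x : ZMod 3 × ZMod 2,
      (rep (x.1 + j, x.2 + tri p q x.1) = s * rep x ∨
        rep (x.1 + j, x.2 + tri p q x.1) = s * rep x * doubleTransposition) := by
  decide

set_option maxRecDepth 10000 in
lemma dec_bwd : ∀ (j : ZMod 3) (p q : ZMod 2), 
    ∃ y : ZMod 3 × ZMod 2, ∃ t : Fin 2, ∀ x : ZMod 3 × ZMod 2,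
      (rep (x.1 + j, x.2 + tri p q x.1) = rep y * doubleTransposition ^ t.val * rep x ∨
        rep (x.1 + j, x.2 + tri p q x.1) =
          rep y * doubleTransposition ^ t.val * rep x * doubleTransposition) := by
  decide

lemma tri_sum : ∀ p q, ∑ i, tri p q i = 0 := by decide

lemma eq_tri (E : ZMod 3 → ZMod 2) (hE : ∑ i, E i = 0) : E = tri (E 1) (E 2) := by
  have hE' : E 0 = E 1 + E 2 := by
    have : E 0 + E 1 + E 2 = 0 := by rw [← hE]; exact (Fin.sum_univ_three E).symm
    generalize E 0 = x at *
    generalize E 1 = y at *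
    generalize E 2 = z at *
    revert x y z; decide
  funext i
  have hc : i = 0 ∨ i = 1 ∨ i = 2 := by revert i; decide
  rcases hc with rfl | rfl | rfl
  · simp [tri, hE']
  · simp [tri]
  · have h1 : (2 : ZMod 3) ≠ 0 := by decide
    have h2 : (2 : ZMod 3) ≠ 1 := by decide
    simp [tri, h1, h2]

lemma model : ∃ m : (ZMod 3 × ZMod 2) ≃ (alternatingGroup (Fin 4) ⧸ Halt),
    ∀ q : Equiv.Perm (alternatingGroup (Fin 4) ⧸ Halt), q ∈ A46 ↔
      ∃ (j : ZMod 3) (E : ZMod 3 → ZMod 2),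
        ∑ i, E i = 0 ∧ ∀ x, q (m x) = m (x.1 + j, x.2 + E x.1) := by
  let m0 : (ZMod 3 × ZMod 2) → (alternatingGroup (Fin 4) ⧸ Halt) := fun x => QuotientGroup.mk (repA x)
  have hinj : Function.Injective m0 := by
    intro x y hxy
    exact dec_inj x y ((mk_eq _ _).1 hxy)
  have hsurj : Function.Surjective m0 := by
    intro z
    induction z using QuotientGroup.induction_on with
    | H s =>
      obtain ⟨x, hx⟩ := dec_surj s.1 s.2
      exact ⟨x, (mk_eq _ _).2 hx⟩
  refine ⟨Equiv.ofBijective m0 ⟨hinj, hsurj⟩, ?_⟩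
  intro q
  change q ∈ A46 ↔ ∃ (j : ZMod 3) (E : ZMod 3 → ZMod 2),
        ∑ i, E i = 0 ∧ ∀ x, q (m0 x) = m0 (x.1 + j, x.2 + E x.1)
  constructor
  · rintro ⟨s, rfl⟩
    obtain ⟨j, p, r, hx⟩ := dec_fwd s.1 s.2
    refine ⟨j, tri p r, tri_sum p r, ?_⟩
    intro x
    exact (mk_eq (s * repA x) (repA _)).2 (hx x)
  · rintro ⟨j, E, hE, hq⟩
    rw [eq_tri E hE] at hq
    obtain ⟨y, t, hx⟩ := dec_bwd j (E 1) (E 2)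
    have hd : doubleTransposition ∈ alternatingGroup (Fin 4) := by
      rw [Equiv.Perm.mem_alternatingGroup]; decide
    let s : alternatingGroup (Fin 4) := repA y * ⟨doubleTransposition, hd⟩ ^ t.val
    refine ⟨s, ?_⟩
    ext z
    obtain ⟨x, rfl⟩ := hsurj z
    rw [hq]
    exact (mk_eq (s * repA x) (repA _)).2 (by simpa [s, repA] using hx x)

end Model

section Local

variable {B W V : Type} [Group B] [MulAction B W] {a b : B} {o : W} {F : W → ZMod 2}

lemma local_iso (h : Good a b o F) (e : V ≃ W × ZMod 2) (v : V) :
    PermIsomorphic (localActionSet (gr h e) (grp a b o e) v)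
      ((A46 : Subgroup _) : Set (Equiv.Perm (alternatingGroup (Fin 4) ⧸ Halt))) := by
  obtain ⟨g, hg⟩ := h.trans (e v).1
  obtain ⟨nb, hnb⟩ := nb_exists h e v g hg.symm
  obtain ⟨m, hm⟩ := model
  refine ⟨nb.symm.trans m, ?_⟩
  intro q
  rw [SetLike.mem_coe, hm]
  constructor
  · rintro ⟨j, E, hE, hq⟩
    refine ⟨(nb.symm.trans m).trans (q.trans (nb.symm.trans m).symm), ?_, ?_⟩
    · rw [local_iff h e v g hg.symm nb hnb]
      refine ⟨j, E, hE, ?_⟩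
      intro x
      simp [hq]
    · intro w; simp
  · rintro ⟨p, hp, hpq⟩
    rw [local_iff h e v g hg.symm nb hnb] at hp
    obtain ⟨j, E, hE, hp⟩ := hp
    refine ⟨j, E, hE, ?_⟩
    intro x
    have := hpq (nb x)
    rw [hp] at this
    simpa using this.symm

lemma local_card (h : Good a b o F) (e : V ≃ W × ZMod 2) (v : V) :
    Nat.card ((gr h e).neighborSet v) = 6 := by
  obtain ⟨g, hg⟩ := h.trans (e v).1
  obtain ⟨nb, -⟩ := nb_exists h e v g hg.symm
  rw [← Nat.card_congr nb]
  simp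

/-- Lower bound for the size of the code. -/
lemma code_card [Finite W] (h : Good a b o F) (s : ℕ) (hs : (Function.support F).ncard ≤ s) :
    ∃ D : ℕ, 2 ^ D ≤ Nat.card (code a b o) ∧ Nat.card W ≤ s * D := by
  classical
  have := Fintype.ofFinite W
  let T : Set (W → ZMod 2) := Set.range (fun g : B => fun w => F (g • w))
  obtain ⟨S, hST, hspan, hli⟩ := exists_linearIndependent (ZMod 2) T
  have hTc : T ⊆ code a b o := by
    rintro f ⟨g, rfl⟩; exact code_smul h.hF g
  have hSfin : S.Finite := Set.toFinite S
  have : Fintype S := hSfin.fintype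
  refine ⟨Fintype.card S, ?_, ?_⟩
  · have hle : Submodule.span (ZMod 2) S ≤ code a b o := Submodule.span_le.2 (hST.trans hTc)
    have h1 : Module.finrank (ZMod 2) (Submodule.span (ZMod 2) S) = Fintype.card S := by
      have := finrank_span_eq_card hli
      rwa [Subtype.range_coe] at this
    have h2 := Submodule.finrank_mono hle
    have h3 : Nat.card (code a b o) = 2 ^ Module.finrank (ZMod 2) (code a b o) := by
      have := Module.natCard_eq_pow_finrank (K := ZMod 2) (V := code a b o)
      simpa using this
    rw [h3]
    exact Nat.pow_le_pow_right (by norm_num) (h1 ▸ h2)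
  · have hcov : ∀ w : W, ∃ f ∈ S, f w ≠ 0 := by
      intro w
      by_contra! hcon
      have : Submodule.span (ZMod 2) S ≤ LinearMap.ker (LinearMap.proj w : (W → ZMod 2) →ₗ[ZMod 2] ZMod 2) := by
        rw [Submodule.span_le]
        intro f hf
        simpa using hcon f hf
      rw [hspan] at this
      obtain ⟨g, rfl⟩ := h.trans w
      have hm : (fun w => F ((b * g⁻¹) • w)) ∈ Submodule.span (ZMod 2) T :=
        Submodule.subset_span ⟨b * g⁻¹, rfl⟩
      have h5 := this hm
      simp [← mul_smul, h.F1] at h5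
    have hsup : ∀ f ∈ S, (Finset.univ.filter (fun w => f w ≠ 0)).card ≤ s := by
      intro f hf
      obtain ⟨g, rfl⟩ := hST hf
      refine le_trans (le_of_eq ?_) hs
      rw [← Set.ncard_coe_finset]
      have : ((Finset.univ.filter (fun w => F (g • w) ≠ 0) : Finset W) : Set W) =
          (fun w => g⁻¹ • w) '' (Function.support F) := by
        ext w
        simp only [Finset.coe_filter, Finset.mem_univ, true_and, Set.mem_ofPred_eq, Set.mem_image,
          Function.mem_support]
        constructor
        · intro hw; exact ⟨g • w, hw, by simp⟩
        · rintro ⟨w', hw, rfl⟩; simpa using hw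
      rw [this, Set.ncard_image_of_injective _ (MulAction.injective g⁻¹)]
    have hU : (Finset.univ : Finset W) ⊆
        hSfin.toFinset.biUnion (fun f => Finset.univ.filter (fun w => f w ≠ 0)) := by
      intro w _
      obtain ⟨f, hf, hfw⟩ := hcov w
      simp only [Finset.mem_biUnion]
      exact ⟨f, by simpa using hf, by simpa using hfw⟩
    have := (Finset.card_le_card hU).trans (Finset.card_biUnion_le_card_mul _ _ s (by
      intro f hf; exact hsup f (by simpa using hf)))
    rw [Finset.card_univ] at this
    rw [Nat.card_eq_fintype_card, mul_comm]
    have hcard : hSfin.toFinset.card = Fintype.card S := by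
      rw [← Set.toFinset_card]; congr 1; ext; simp
    rwa [hcard] at this

lemma stab_card [Finite W] [Finite V] (h : Good a b o F) (e : V ≃ W × ZMod 2) (v : V) :
    Nat.card (code a b o) ≤
      Nat.card ↥(grp a b o e ⊓ MulAction.stabilizer (Equiv.Perm V) v) * 2 := by
  obtain ⟨g, hg⟩ := h.trans (e v).1
  let F' : W → ZMod 2 := fun w => F ((b * g⁻¹) • w)
  have hF' : F' ∈ code a b o := code_smul h.hF _
  have hF1 : F' (e v).1 = 1 := by
    simp only [F', ← hg, ← mul_smul]
    simp [h.F1]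
  have hmem : ∀ f : code a b o, tw e (1 : B) (f.1 - f.1 (e v).1 • F') ∈
      grp a b o e ⊓ MulAction.stabilizer (Equiv.Perm V) v := by
    intro f
    refine ⟨tw_mem e _ (Submodule.sub_mem _ f.2 (Submodule.smul_mem _ _ hF')), ?_⟩
    change tw e (1 : B) (f.1 - f.1 (e v).1 • F') v = v
    apply e.injective
    rw [tw_apply]
    ext <;> simp [hF1]
  let φ : code a b o → ↥(grp a b o e ⊓ MulAction.stabilizer (Equiv.Perm V) v) × ZMod 2 :=
    fun f => (⟨_, hmem f⟩, f.1 (e v).1)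
  have hφ : Function.Injective φ := by
    intro f f' hff
    simp only [φ, Prod.mk.injEq, Subtype.mk.injEq] at hff
    obtain ⟨h1, h2⟩ := hff
    apply Subtype.ext
    funext w
    have h3 := congrArg (fun σ : Equiv.Perm V => (e (σ (e.symm (w, 0)))).2) h1
    simp only [tw_apply] at h3
    simpa [h2] using h3
  have := Nat.card_le_card_of_injective φ hφ
  rwa [Nat.card_prod, Nat.card_zmod] at this

theorem layer [Finite W] (h : Good a b o F) (hs : (Function.support F).ncard ≤ 64)
    (hW : 512 < Nat.card W) :
    ∃ (Γ : SimpleGraph (Fin (2 * Nat.card W))) (G : Subgroup (Equiv.Perm (Fin (2 * Nat.card W)))),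
      Γ.Connected ∧ (∀ v, Nat.card (Γ.neighborSet v) = 6) ∧
      (∀ g ∈ G, IsGraphAut Γ g) ∧ ArcTransitiveOn Γ G ∧
      (∀ v, PermIsomorphic (localActionSet Γ G v) ((A46 : Subgroup _) : Set (Equiv.Perm (alternatingGroup (Fin 4) ⧸ Halt)))) ∧
      (∀ v : Fin (2 * Nat.card W), 2 ^ (2 * Nat.card W) ≤
        Nat.card ↥(G ⊓ MulAction.stabilizer (Equiv.Perm (Fin (2 * Nat.card W))) v) ^ 144) := by
  have hc : Nat.card (W × ZMod 2) = 2 * Nat.card W := by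
    rw [Nat.card_prod, Nat.card_zmod, mul_comm]
  let e : Fin (2 * Nat.card W) ≃ W × ZMod 2 := (Finite.equivFinOfCardEq hc).symm
  refine ⟨gr h e, grp a b o e, gr_conn h e, local_card h e, grp_aut h e, grp_arc h e,
    local_iso h e, ?_⟩
  intro v
  obtain ⟨D, hD1, hD2⟩ := code_card h 64 hs
  have h1 := hD1.trans (stab_card h e v)
  obtain ⟨D', rfl⟩ : ∃ D', D = D' + 1 := ⟨D - 1, by omega⟩
  rw [pow_succ] at h1
  have h2 := Nat.le_of_mul_le_mul_right h1 (by norm_num)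
  refine le_trans ?_ (Nat.pow_le_pow_left h2 144)
  rw [← pow_mul]
  exact Nat.pow_le_pow_right (by norm_num) (by omega)

end Local

section Groups

variable {B : Type} [Group B]

lemma nf_aux {x y u v : B} (huv : u * v = v * u) (hxu : x * u = v * x)
    (hxv : x * v = u ^ 3 * v ^ 3 * x) (hx : x ^ 3 = 1) (hu : u ^ 4 = 1) (hy : y = x * x * u)
    (g : B) (hg : g ∈ Subgroup.closure {x, y}) : ∃ i j l : ℕ, g = u ^ i * v ^ j * x ^ l := by
  have hc : Commute u v := huv
  have s1 : SemiconjBy x u v := hxu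
  have s2 : SemiconjBy x v (u ^ 3 * v ^ 3) := hxv
  have U : ∀ g : B, (∃ i j l : ℕ, g = u ^ i * v ^ j * x ^ l) →
      ∃ i j l : ℕ, u * g = u ^ i * v ^ j * x ^ l := by
    rintro _ ⟨i, j, l, rfl⟩
    exact ⟨i + 1, j, l, by rw [pow_succ']; simp only [mul_assoc]⟩
  have X : ∀ g : B, (∃ i j l : ℕ, g = u ^ i * v ^ j * x ^ l) →
      ∃ i j l : ℕ, x * g = u ^ i * v ^ j * x ^ l := by
    rintro _ ⟨i, j, l, rfl⟩
    refine ⟨3 * j, 3 * j + i, l + 1, ?_⟩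
    have e1 := (s1.pow_right i).eq
    have e2 := (s2.pow_right j).eq
    rw [((hc.pow_left 3).pow_right 3).mul_pow, ← pow_mul, ← pow_mul] at e2
    have e3 : v ^ i * u ^ (3 * j) = u ^ (3 * j) * v ^ i := (hc.symm.pow_left i).pow_right (3 * j)
    calc x * (u ^ i * v ^ j * x ^ l) = (x * u ^ i) * v ^ j * x ^ l := by simp only [mul_assoc]
      _ = v ^ i * (x * v ^ j) * x ^ l := by rw [e1]; simp only [mul_assoc]
      _ = (v ^ i * u ^ (3 * j)) * v ^ (3 * j) * (x * x ^ l) := by rw [e2]; simp only [mul_assoc]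
      _ = u ^ (3 * j) * v ^ (3 * j + i) * x ^ (l + 1) := by
        rw [e3, ← pow_succ', add_comm (3 * j) i, pow_add v]; simp only [mul_assoc]
  have hxi : x⁻¹ = x * x := by
    rw [inv_eq_iff_mul_eq_one, ← mul_assoc, ← hx]; simp [pow_succ]
  have hyi : y⁻¹ = u * u * u * x := by
    rw [inv_eq_iff_mul_eq_one, hy]
    calc x * x * u * (u * u * u * x) = x * x * (u ^ 4) * x := by simp only [pow_succ, pow_zero, one_mul, mul_assoc]
      _ = x ^ 3 := by rw [hu]; simp [pow_succ]
      _ = 1 := hx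
  induction hg using Subgroup.closure_induction_left with
  | one => exact ⟨0, 0, 0, by simp⟩
  | mul_left z hz g hg ih =>
    rcases hz with rfl | rfl
    · exact X _ ih
    · rw [hy, mul_assoc, mul_assoc]; exact X _ (X _ (U _ ih))
  | inv_mul_cancel z hz g hg ih =>
    rcases hz with rfl | rfl
    · rw [hxi, mul_assoc]; exact X _ (X _ ih)
    · rw [hyi, mul_assoc, mul_assoc, mul_assoc]; exact U _ (U _ (U _ (X _ ih)))

lemma nf {x y u v : B} (huv : u * v = v * u) (hxu : x * u = v * x)
    (hxv : x * v = u ^ 3 * v ^ 3 * x) (hx : x ^ 3 = 1) (hu : u ^ 4 = 1) (hv : v ^ 4 = 1)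
    (hy : y = x * x * u)
    (g : B) (hg : g ∈ Subgroup.closure {x, y}) :
    ∃ (i j : Fin 4) (l : Fin 3), g = u ^ i.val * v ^ j.val * x ^ l.val := by
  obtain ⟨i, j, l, rfl⟩ := nf_aux huv hxu hxv hx hu hy g hg
  refine ⟨⟨i % 4, Nat.mod_lt _ (by norm_num)⟩, ⟨j % 4, Nat.mod_lt _ (by norm_num)⟩,
    ⟨l % 3, Nat.mod_lt _ (by norm_num)⟩, ?_⟩
  simp only
  rw [← pow_eq_pow_mod i hu, ← pow_eq_pow_mod j hv, ← pow_eq_pow_mod l hx]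

open Classical in
/-- The function with small support. -/
noncomputable def bigF (A : Subgroup B) (a b : B) (w : B ⧸ Subgroup.zpowers a) : ZMod 2 :=
  (if ∃ α ∈ A, w = QuotientGroup.mk (α * b) then 1 else 0) +
  (if ∃ α ∈ A, w = QuotientGroup.mk (α * (a * b)) then 1 else 0)

lemma mem_zpow [Finite B] {a : B} (ha : a ^ 3 = 1) (g : B) (hg : g ∈ Subgroup.zpowers a) :
    ∃ i, g = cpow a i := by
  rw [← mem_powers_iff_mem_zpowers] at hg
  obtain ⟨n, rfl⟩ := hg
  refine ⟨(n : ZMod 3), ?_⟩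
  simp only [cpow, ZMod.val_natCast]
  exact pow_eq_pow_mod n ha

lemma cpow_mem (a : B) (i : ZMod 3) : cpow a i ∈ Subgroup.zpowers a :=
  Subgroup.pow_mem _ (Subgroup.mem_zpowers a) _

lemma cpow_conj (a c : B) (i : ZMod 3) : c * cpow a i * c⁻¹ = (c * a * c⁻¹) ^ i.val := by
  rw [conj_pow]; rfl

open Classical in
lemma bigF_mk [Finite B] {A : Subgroup B} {a b : B} (ha : a ^ 3 = 1) (hb : b * b = 1)
    (hx : b * a * b ∈ A) (hy : a * b * a * b * a⁻¹ ∈ A) (g : B) :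
    bigF A a b (QuotientGroup.mk g) =
      (if g * b ∈ A then 1 else 0) + (if g * b * a⁻¹ ∈ A then 1 else 0) := by
  have hbi : b⁻¹ = b := by rw [inv_eq_iff_mul_eq_one, hb]
  have h1 : (∃ α ∈ A, (QuotientGroup.mk g : B ⧸ Subgroup.zpowers a) = QuotientGroup.mk (α * b)) ↔
      g * b ∈ A := by
    constructor
    · rintro ⟨α, hα, h⟩
      rw [eq_comm, QuotientGroup.eq] at h
      obtain ⟨i, hi⟩ := mem_zpow ha _ h
      have h2 : b * cpow a i * b ∈ A := by
        have := cpow_conj a b i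
        rw [hbi] at this
        rw [this]; exact Subgroup.pow_mem _ hx _
      have : g * b = α * (b * cpow a i * b) := by rw [← hi]; group
      rw [this]; exact Subgroup.mul_mem _ hα h2
    · intro h
      exact ⟨g * b, h, by rw [mul_assoc, hb, mul_one]⟩
  have h2 : (∃ α ∈ A, (QuotientGroup.mk g : B ⧸ Subgroup.zpowers a) = QuotientGroup.mk (α * (a * b))) ↔
      g * b * a⁻¹ ∈ A := by
    constructor
    · rintro ⟨α, hα, h⟩
      rw [eq_comm, QuotientGroup.eq] at h
      obtain ⟨i, hi⟩ := mem_zpow ha _ h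
      have h2 : (a * b) * cpow a i * (a * b)⁻¹ ∈ A := by
        rw [cpow_conj a (a * b) i]; refine Subgroup.pow_mem _ ?_ _
        rw [mul_inv_rev, hbi]; simpa only [mul_assoc] using hy
      have : g * b * a⁻¹ = α * ((a * b) * cpow a i * (a * b)⁻¹) := by
        rw [← hi]; nth_rewrite 1 [← hbi]; group
      rw [this]; exact Subgroup.mul_mem _ hα h2
    · intro h
      refine ⟨g * b * a⁻¹, h, ?_⟩
      rw [show g * b * a⁻¹ * (a * b) = g * (b * b) by group, hb, mul_one]
  simp only [bigF, h1, h2]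

lemma good [Finite B] {A : Subgroup B} {a b : B} (ha : a ^ 3 = 1) (hb : b * b = 1)
    (gen : Subgroup.closure {a, b} = ⊤)
    (hx : b * a * b ∈ A) (hy : a * b * a * b * a⁻¹ ∈ A)
    (n1 : a ∉ A) (n2 : b ∉ A) (n3 : b * a⁻¹ ∉ A)
    (d1 : ∀ i, b ≠ cpow a i) (d2 : ∀ i j, b * cpow a i * b = cpow a j → i = 0) :
    Good a b (QuotientGroup.mk 1 : B ⧸ Subgroup.zpowers a) (bigF A a b) := by
  classical
  have hbi : b⁻¹ = b := by rw [inv_eq_iff_mul_eq_one, hb]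
  have hsm : ∀ g : B, g • (QuotientGroup.mk 1 : B ⧸ Subgroup.zpowers a) = QuotientGroup.mk g := by
    intro g
    rw [MulAction.Quotient.smul_mk, smul_eq_mul, mul_one]
  have n1' : a⁻¹ ∉ A := by rwa [Subgroup.inv_mem_iff]
  have ha2 : a ^ 2 = a⁻¹ := by rw [eq_inv_iff_mul_eq_one, ← pow_succ, ha]
  refine { ha := ha, hb := hb, gen := gen, trans := ?_, stab := ?_, fix := ?_, hbo := ?_, inj := ?_,
           hF := ?_, F0 := ?_, F1 := ?_, F2 := ?_, F3 := ?_ }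
  · intro w
    induction w using QuotientGroup.induction_on with
    | H g => exact ⟨g, hsm g⟩
  · intro g hg
    rw [hsm, eq_comm, QuotientGroup.eq, inv_one, one_mul] at hg
    exact mem_zpow ha g hg
  · rw [hsm, eq_comm, QuotientGroup.eq, inv_one, one_mul]
    exact Subgroup.mem_zpowers a
  · intro hg
    rw [hsm, eq_comm, QuotientGroup.eq, inv_one, one_mul] at hg
    obtain ⟨i, hi⟩ := mem_zpow ha _ hg
    exact d1 i hi
  · intro i hi
    rw [hsm, hsm, eq_comm, QuotientGroup.eq, hbi, ← mul_assoc] at hi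
    obtain ⟨j, hj⟩ := mem_zpow ha _ hi
    exact d2 i j hj
  · intro g
    simp only [hsm, bigF_mk ha hb hx hy]
    have e1 : ∀ i, g * cpow a i * b * b = g * cpow a i := by
      intro i; rw [mul_assoc, hb, mul_one]
    have e2 : ∀ i, g * cpow a i * a⁻¹ = g * cpow a (i + 2) := by
      intro i; rw [cpow_add ha, cpow_two, ha2, mul_assoc]
    simp only [e1, e2, Finset.sum_add_distrib]
    have e3 := Equiv.sum_comp (Equiv.addRight (2 : ZMod 3)) (fun i => if g * cpow a i ∈ A then (1 : ZMod 2) else 0)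
    simp only [Equiv.coe_addRight] at e3
    convert CharTwo.add_self_eq_zero (∑ i, if g * cpow a i ∈ A then (1 : ZMod 2) else 0) using 2
    refine (Finset.sum_congr rfl fun i _ => ?_).trans e3
    by_cases hi : g * cpow a (i + 2) ∈ A <;> simp [hi]
  · rw [bigF_mk ha hb hx hy]; simp [n2, n3]
  · rw [hsm, bigF_mk ha hb hx hy]; simp [hb, n1]
  · rw [hsm, bigF_mk ha hb hx hy]; simp [mul_assoc, hb, n1]
  · rw [hsm, bigF_mk ha hb hx hy]; simp [mul_assoc, hb, ha2, n1']
    rw [← mul_inv_rev, ← pow_two, ha2, inv_inv]; exact n1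

lemma bigF_supp [Finite B] {a b x y u v : B} (hb : b * b = 1) (hxd : x = b * a * b)
    (huv : u * v = v * u) (hxu : x * u = v * x)
    (hxv : x * v = u ^ 3 * v ^ 3 * x) (hx : x ^ 3 = 1) (hu : u ^ 4 = 1) (hv : v ^ 4 = 1)
    (hy : y = x * x * u) :
    (Function.support (bigF (Subgroup.closure {x, y}) a b)).ncard ≤ 64 := by
  let φ : Fin 4 × Fin 4 → B ⧸ Subgroup.zpowers a :=
    fun t => QuotientGroup.mk (u ^ t.1.val * v ^ t.2.val * b)
  let ψ : Fin 4 × Fin 4 × Fin 3 → B ⧸ Subgroup.zpowers a :=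
    fun t => QuotientGroup.mk (u ^ t.1.val * v ^ t.2.1.val * x ^ t.2.2.val * (a * b))
  have hsub : Function.support (bigF (Subgroup.closure {x, y}) a b) ⊆
      Set.range φ ∪ Set.range ψ := by
    intro w hw
    by_contra hn
    apply hw
    have h1 : ¬ ∃ α ∈ Subgroup.closure {x, y},
        w = (QuotientGroup.mk (α * b) : B ⧸ Subgroup.zpowers a) := by
      rintro ⟨α, hα, rfl⟩
      apply hn; left
      obtain ⟨i, j, l, rfl⟩ := nf huv hxu hxv hx hu hv hy α hα
      refine ⟨(i, j), ?_⟩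
      simp only [φ]
      rw [QuotientGroup.eq]
      have hbi : b⁻¹ = b := by rw [inv_eq_iff_mul_eq_one, hb]
      have h3 : b * x ^ l.val * b = a ^ l.val := by
        have h4 : a = b * x * b⁻¹ := by
          rw [hxd, hbi]; simp only [mul_assoc, hb, mul_one]; rw [← mul_assoc, hb, one_mul]
        conv_rhs => rw [h4, conj_pow, hbi]
      have : (u ^ i.val * v ^ j.val * b)⁻¹ * (u ^ i.val * v ^ j.val * x ^ l.val * b) =
          a ^ l.val := by
        rw [← h3]; simp [mul_assoc, hbi]
      rw [this]
      exact Subgroup.pow_mem _ (Subgroup.mem_zpowers a) _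
    have h2 : ¬ ∃ α ∈ Subgroup.closure {x, y},
        w = (QuotientGroup.mk (α * (a * b)) : B ⧸ Subgroup.zpowers a) := by
      rintro ⟨α, hα, rfl⟩
      apply hn; right
      obtain ⟨i, j, l, rfl⟩ := nf huv hxu hxv hx hu hv hy α hα
      exact ⟨(i, j, l), rfl⟩
    simp only [bigF, h1, h2, if_false, add_zero]
  have c1 : (Set.range φ).ncard ≤ 16 := by
    rw [← Set.image_univ]
    refine (Set.ncard_image_le (Set.toFinite _)).trans ?_
    simp [Set.ncard_univ]
  have c2 : (Set.range ψ).ncard ≤ 48 := by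
    rw [← Set.image_univ]
    refine (Set.ncard_image_le (Set.toFinite _)).trans ?_
    simp [Set.ncard_univ]
  have := Set.ncard_le_ncard hsub (Set.toFinite _)
  have := Set.ncard_union_le (Set.range φ) (Set.range ψ)
  omega

lemma quot_card [Finite B] {a : B} (ha : a ^ 3 = 1) :
    Nat.card B ≤ 3 * Nat.card (B ⧸ Subgroup.zpowers a) := by
  rw [Subgroup.card_eq_card_quotient_mul_card_subgroup (Subgroup.zpowers a), mul_comm,
    Nat.card_zpowers]
  exact Nat.mul_le_mul_right _ (orderOf_le_of_pow_eq_one (by norm_num) ha)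

end Groups

section Concrete

/-- The permutation underlying `a` -/
def pa : Fin 20 → Fin 20 := ![0, 2, 3, 1, 6, 8, 7, 4, 9, 5, 12, 14, 13, 10, 15, 11, 17, 18, 16, 19]

/-- The permutation underlying `b` -/
def pb : Fin 20 → Fin 20 := ![1, 0, 4, 5, 2, 3, 8, 10, 6, 11, 7, 9, 14, 16, 12, 17, 13, 15, 19, 18]

/-- The translation part of `b` -/
def tb : Fin 20 → ℤ := ![0, 0, 0, -1, 0, 1, 0, 0, 0, 0, 0, 0, 0, 0, 0, -1, 0, 1, 0, 0]

/-- `a` as a permutation -/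
def ga (k : ℕ) : Equiv.Perm (Fin 20 × ZMod k) where
  toFun p := (pa p.1, p.2)
  invFun p := (pa (pa p.1), p.2)
  left_inv p := by
    have : ∀ i, pa (pa (pa i)) = i := by decide
    simp [this]
  right_inv p := by
    have : ∀ i, pa (pa (pa i)) = i := by decide
    simp [this]

/-- `b` as a permutation -/
def gb (k : ℕ) : Equiv.Perm (Fin 20 × ZMod k) :=
  have h1 : ∀ i, pb (pb i) = i := by decide
  have h2 : ∀ i, tb (pb i) = - tb i := by decide
  { toFun := fun p => (pb p.1, p.2 + (tb p.1 : ZMod k))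
    invFun := fun p => (pb p.1, p.2 + (tb p.1 : ZMod k))
    left_inv := fun p => by simp [h1, h2]
    right_inv := fun p => by simp [h1, h2] }

/-- evaluate a word -/
def run : List Bool → Fin 20 → Fin 20 × ℤ
  | [], i => (i, 0)
  | true :: w, i => (pa (run w i).1, (run w i).2)
  | false :: w, i => (pb (run w i).1, (run w i).2 + tb (run w i).1)

/-- evaluate a word in a group -/
def evg {G : Type} [Group G] (a b : G) (w : List Bool) : G :=
  (w.map (fun c => if c then a else b)).prod

lemma evg_append {G : Type} [Group G] (a b : G) (w w' : List Bool) :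
    evg a b (w ++ w') = evg a b w * evg a b w' := by
  simp [evg]

lemma evg_rep {G : Type} [Group G] (a b : G) (n : ℕ) :
    evg a b (List.replicate n true) = a ^ n := by
  simp [evg]

lemma evg_run (k : ℕ) (w : List Bool) (p : Fin 20 × ZMod k) :
    evg (ga k) (gb k) w p = ((run w p.1).1, p.2 + ((run w p.1).2 : ZMod k)) := by
  induction w with
  | nil => simp [evg, run]
  | cons c w ih =>
    have : evg (ga k) (gb k) (c :: w) = (if c then ga k else gb k) * evg (ga k) (gb k) w := by
      simp [evg]
    rw [this, Equiv.Perm.mul_apply, ih]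
    cases c
    · simp [gb, run, add_assoc]
    · simp [ga, run]

/-- the group -/
abbrev GB (k : ℕ) : Subgroup (Equiv.Perm (Fin 20 × ZMod k)) := Subgroup.closure {ga k, gb k}

/-- generator `a` -/
def ea (k : ℕ) : GB k := ⟨ga k, Subgroup.subset_closure (by simp)⟩

/-- generator `b` -/
def eb (k : ℕ) : GB k := ⟨gb k, Subgroup.subset_closure (by simp)⟩

lemma ev_coe (k : ℕ) (w : List Bool) :
    ((evg (ea k) (eb k) w : GB k) : Equiv.Perm (Fin 20 × ZMod k)) = evg (ga k) (gb k) w := by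
  induction w with
  | nil => simp [evg]
  | cons c w ih =>
    have : evg (ea k) (eb k) (c :: w) = (if c then ea k else eb k) * evg (ea k) (eb k) w := by
      simp [evg]
    rw [this, Subgroup.coe_mul, ih]
    cases c <;> simp [evg, ea, eb]

lemma ev_eq (k : ℕ) (w w' : List Bool) (h : ∀ i, run w i = run w' i) :
    evg (ea k) (eb k) w = evg (ea k) (eb k) w' := by
  apply Subtype.ext
  rw [ev_coe, ev_coe]
  ext p : 1
  rw [evg_run, evg_run, h]

lemma ev_fst (k : ℕ) (w : List Bool) (p : Fin 20 × ZMod k) :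
    (((evg (ea k) (eb k) w : GB k) : Equiv.Perm (Fin 20 × ZMod k)) p).1 = (run w p.1).1 := by
  rw [ev_coe, evg_run]

/-- words -/
def wx : List Bool := [false, true, false]
/-- words -/
def wy : List Bool := [true, false, true, false, true, true]
/-- words -/
def wu : List Bool := wx ++ wy
/-- words -/
def wv : List Bool := wx ++ wu ++ wx ++ wx

/-- invariant set -/
def inv4 (i : Fin 20) : Bool := i == 1 || i == 7 || i == 14 || i == 16

lemma A_inv (k : ℕ) (g : GB k)
    (hg : g ∈ Subgroup.closure {evg (ea k) (eb k) wx, evg (ea k) (eb k) wy}) :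
    ∀ p, inv4 ((g : Equiv.Perm (Fin 20 × ZMod k)) p).1 = inv4 p.1 := by
  induction hg using Subgroup.closure_induction with
  | mem z hz =>
    intro p
    have h1 : ∀ i, inv4 (run wx i).1 = inv4 i := by decide
    have h2 : ∀ i, inv4 (run wy i).1 = inv4 i := by decide
    rcases hz with rfl | rfl
    · rw [ev_fst, h1]
    · rw [ev_fst, h2]
  | one => intro p; simp
  | mul x y _ _ hx hy => intro p; rw [Subgroup.coe_mul, Equiv.Perm.mul_apply, hx, hy]
  | inv x _ hx =>
    intro p
    obtain ⟨q, rfl⟩ := (x : Equiv.Perm (Fin 20 × ZMod k)).surjective p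
    rw [hx]; simp

lemma gb_card (k : ℕ) [NeZero k] : k ≤ Nat.card (GB k) := by
  let w : List Bool := [true, false, true, false, true, true, false]
  have hr : run w 8 = (8, -1) := by decide
  have h1 : ∀ n : ℕ, (((evg (ea k) (eb k) w : GB k) : Equiv.Perm (Fin 20 × ZMod k)) ^ n)
      ((8 : Fin 20), (0 : ZMod k)) = (8, -(n : ZMod k)) := by
    intro n
    induction n with
    | zero => simp
    | succ n ih =>
      rw [pow_succ', Equiv.Perm.mul_apply, ih, ev_coe, evg_run, hr]
      ext
      · rfl
      · push_cast; ring
  let φ : ZMod k → GB k := fun z => evg (ea k) (eb k) w ^ z.val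
  have hφ : Function.Injective φ := by
    intro z z' hz
    have h2 := congrArg (fun g : GB k => (g : Equiv.Perm (Fin 20 × ZMod k)) ((8 : Fin 20), (0 : ZMod k))) hz
    simp only [φ, Subgroup.coe_pow, h1] at h2
    simpa using h2
  have := Nat.card_le_card_of_injective φ hφ
  rwa [Nat.card_zmod] at this

end Concrete

set_option maxRecDepth 100000 in
theorem final (k : ℕ) [NeZero k] : ∃ (W : Type) (_ : Finite W),
    k ≤ 3 * Nat.card W ∧ ∃ (B : Type) (_ : Group B) (_ : MulAction B W) (a b : B) (o : W)
      (F : W → ZMod 2), Good a b o F ∧ (Function.support F).ncard ≤ 64 := by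
  let a := ea k
  let b := eb k
  have E := ev_eq k
  have hnil : evg a b [] = 1 := rfl
  have ha : a ^ 3 = 1 := by
    have := E [true, true, true] [] (by decide)
    simpa [evg, pow_succ, mul_assoc] using this
  have hb : b * b = 1 := by
    have := E [false, false] [] (by decide)
    simpa [evg] using this
  have hai : a⁻¹ = a * a := by
    rw [inv_eq_iff_mul_eq_one, ← mul_assoc, ← ha]; simp [pow_succ]
  have hxd : evg a b wx = b * a * b := by simp [evg, wx, mul_assoc]
  have hyd : evg a b wy = a * b * a * b * a⁻¹ := by simp [evg, wy, mul_assoc, hai]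
  have hgen : Subgroup.closure {a, b} = ⊤ := by
    have := Subgroup.closure_closure_coe_preimage (k := ({ga k, gb k} : Set (Equiv.Perm (Fin 20 × ZMod k))))
    rw [← this]
    congr 1
    ext z
    simp only [Set.mem_insert_iff, Set.mem_singleton_iff, Set.mem_preimage]
    rw [Subtype.ext_iff, Subtype.ext_iff]; rfl
  let A : Subgroup (GB k) := Subgroup.closure {evg a b wx, evg a b wy}
  have hxA : b * a * b ∈ A := by rw [← hxd]; exact Subgroup.subset_closure (by simp)
  have hyA : a * b * a * b * a⁻¹ ∈ A := by rw [← hyd]; exact Subgroup.subset_closure (by simp)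
  have hn : ∀ w : List Bool, inv4 (run w 1).1 = false → evg a b w ∉ A := by
    intro w hw hA
    have := A_inv k _ hA (1, 0)
    rw [ev_fst, hw] at this
    have h1 : inv4 1 = true := by decide
    change false = inv4 1 at this
    rw [h1] at this
    exact absurd this (by decide)
  have n1 : a ∉ A := by
    have := hn [true] (by decide)
    simpa [evg] using this
  have n2 : b ∉ A := by
    have := hn [false] (by decide)
    simpa [evg] using this
  have n3 : b * a⁻¹ ∉ A := by
    have := hn [false, true, true] (by decide)
    rw [hai]
    simpa [evg] using this
  have hdist : ∀ w w' : List Bool, evg a b w = evg a b w' → (run w 0).1 = (run w' 0).1 := by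
    intro w w' h
    have h1 := ev_fst k w (0, 0)
    have h2 := ev_fst k w' (0, 0)
    rw [← h1, ← h2]
    exact congrArg (fun g : GB k => ((g : Equiv.Perm (Fin 20 × ZMod k)) (0, 0)).1) h
  have d1 : ∀ i, b ≠ cpow a i := by
    intro i hi
    have h1 := hdist [false] (List.replicate i.val true) (by
      rw [evg_rep]; simpa [evg, cpow] using hi)
    revert h1; clear hi; revert i; decide
  have d2 : ∀ i j, b * cpow a i * b = cpow a j → i = 0 := by
    intro i j hi
    have h1 := hdist ([false] ++ List.replicate i.val true ++ [false]) (List.replicate j.val true) (by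
      rw [evg_append, evg_append, evg_rep, evg_rep]; simpa [evg, cpow] using hi)
    revert h1; clear hi; revert i j; decide
  have hg := good (A := A) ha hb hgen hxA hyA n1 n2 n3 d1 d2
  refine ⟨GB k ⧸ Subgroup.zpowers a, inferInstance, (gb_card k).trans (quot_card ha), GB k,
    inferInstance, inferInstance, a, b, _, _, hg, ?_⟩
  refine bigF_supp (u := evg a b wu) (v := evg a b wv) hb hxd ?_ ?_ ?_ ?_ ?_ ?_ ?_
  · have := E (wu ++ wv) (wv ++ wu) (by decide)
    simpa [evg_append] using this
  · have := E (wx ++ wu) (wv ++ wx) (by decide)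
    simpa [evg_append] using this
  · have := E (wx ++ wv) (wu ++ wu ++ wu ++ (wv ++ wv ++ wv) ++ wx) (by decide)
    simpa only [evg_append, pow_succ, pow_zero, one_mul] using this
  · have := E (wx ++ wx ++ wx) [] (by decide)
    simpa only [evg_append, pow_succ, pow_zero, one_mul] using this.trans hnil
  · have := E (wu ++ wu ++ wu ++ wu) [] (by decide)
    simpa only [evg_append, pow_succ, pow_zero, one_mul] using this.trans hnil
  · have := E (wv ++ wv ++ wv ++ wv) [] (by decide)
    simpa only [evg_append, pow_succ, pow_zero, one_mul] using this.trans hnil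
  · have := E wy (wx ++ wx ++ wu) (by decide)
    simpa only [evg_append] using this

end Expo

/-- `A₄(6)` is of exponential type: there are connected `6`-regular graphs `Γ` of
unboundedly large order together with arc-transitive groups of automorphisms `G` with local
action `A₄(6)` and with vertex-stabilisers of order at least `2^(|V(Γ)|/144)`. -/
theorem statement0 (M : ℕ) :
    ∃ (m : ℕ) (Γ : SimpleGraph (Fin m)) (G : Subgroup (Equiv.Perm (Fin m))),
      M ≤ m ∧ Γ.Connected ∧ (∀ v : Fin m, Nat.card (Γ.neighborSet v) = 6) ∧
      (∀ g ∈ G, IsGraphAut Γ g) ∧ ArcTransitiveOn Γ G ∧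
      (∀ v : Fin m, PermIsomorphic (localActionSet Γ G v) ((A46 : Subgroup _) : Set (Equiv.Perm (alternatingGroup (Fin 4) ⧸ Halt)))) ∧
      (∀ v : Fin m,
        2 ^ m ≤ Nat.card ↥(G ⊓ MulAction.stabilizer (Equiv.Perm (Fin m)) v) ^ 144) := by
  have : NeZero (3 * (M + 600)) := ⟨by omega⟩
  obtain ⟨W, hW, hk, B, i1, i2, a, b, o, F, hg, hs⟩ := Expo.final (3 * (M + 600))
  obtain ⟨Γ, G, h⟩ := Expo.layer hg hs (by omega)
  exact ⟨2 * Nat.card W, Γ, G, by omega, h⟩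
end

section
/- For every natural number M there exist a finite connected 6-regular simple graph Γ with |V(Γ)| ≥ M and a subgroup G ≤ Aut(Γ) acting transitively on the arcs of Γ, such that for every vertex v the local action G_v^{Γ(v)} is permutation isomorphic to S_4(6d) and the vertex-stabiliser satisfies |G_v|^{144} ≥ 2^{|V(Γ)|}. (In particular, the permutation group S_4(6d) is of exponential type.) -/
/-- The subgroup `⟨(1 2),(3 4)⟩` of `Sym(4)` (0-indexed: `⟨(0 1),(2 3)⟩`). -/
def Hd : Subgroup (Equiv.Perm (Fin 4)) :=
  Subgroup.closure {Equiv.swap 0 1, Equiv.swap 2 3}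

/-- `S₄(6d)`: the image of `Sym(4)` in the symmetric group on the 6 left cosets of
`⟨(1 2),(3 4)⟩`, under the left multiplication action. -/
def S46d : Subgroup (Equiv.Perm (Equiv.Perm (Fin 4) ⧸ Hd)) :=
  (MulAction.toPermHom (Equiv.Perm (Fin 4)) (Equiv.Perm (Fin 4) ⧸ Hd)).range
namespace S46

open Equiv

/-! ## Part A0: the coset action `S₄(6d)` as even signed permutations of three points -/

/-- code of a 2-subset `{x, y}` of `Fin 4` -/
def code (x y : Fin 4) : Fin 3 × ZMod 2 :=
  match x, y with
  | 0, 1 => (0, 0) | 1, 0 => (0, 0) | 2, 3 => (0, 1) | 3, 2 => (0, 1)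
  | 0, 2 => (1, 0) | 2, 0 => (1, 0) | 1, 3 => (1, 1) | 3, 1 => (1, 1)
  | 0, 3 => (2, 0) | 3, 0 => (2, 0) | 1, 2 => (2, 1) | 2, 1 => (2, 1)
  | _, _ => (0, 0)

def pcode (p : Perm (Fin 4)) : Fin 3 × ZMod 2 := code (p 0) (p 1)

theorem code_fix : ∀ p : Perm (Fin 4), pcode p = (0, 0) →
    p = 1 ∨ p = swap 0 1 ∨ p = swap 2 3 ∨ p = swap 0 1 * swap 2 3 := by
  decide +kernel

theorem code_act : ∀ t : Perm (Fin 4), ∃ s : Perm (Fin 3), ∃ ε : Fin 3 → ZMod 2,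
    ∑ j, ε j = 0 ∧ ∀ x y, x ≠ y →
      code (t x) (t y) = (s (code x y).1, (code x y).2 + ε (code x y).1) := by
  decide +kernel

theorem code_act' : ∀ s : Perm (Fin 3), ∀ ε : Fin 3 → ZMod 2, ∑ j, ε j = 0 →
    ∃ t : Perm (Fin 4), ∀ x y, x ≠ y →
      code (t x) (t y) = (s (code x y).1, (code x y).2 + ε (code x y).1) := by
  decide +kernel

theorem code_surj : ∀ z : Fin 3 × ZMod 2, ∃ p : Perm (Fin 4), pcode p = z := by
  decide +kernel

theorem mem_Hd (p : Perm (Fin 4)) : p ∈ Hd ↔ pcode p = (0, 0) := by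
  constructor
  · intro hp
    have h4 : ∀ q : Perm (Fin 4), (q = 1 ∨ q = swap 0 1 ∨ q = swap 2 3 ∨
        q = swap 0 1 * swap 2 3) → pcode q = (0, 0) := by decide +kernel
    have hm : ∀ x y : Perm (Fin 4), pcode x = (0, 0) → pcode y = (0, 0) →
        pcode (x * y) = (0, 0) := by
      intro x y hx hy
      have hx := code_fix x hx
      have hy := code_fix y hy
      revert x y
      decide +kernel
    have hi : ∀ x : Perm (Fin 4), pcode x = (0, 0) → pcode x⁻¹ = (0, 0) := by
      intro x hx
      have hx := code_fix x hx
      revert x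
      decide +kernel
    unfold Hd at hp
    induction hp using Subgroup.closure_induction with
    | mem x hx =>
      apply h4
      simp only [Set.mem_insert_iff, Set.mem_singleton_iff] at hx
      tauto
    | one => exact h4 1 (Or.inl rfl)
    | mul x y _ _ hx hy => exact hm x y hx hy
    | inv x _ hx => exact hi x hx
  · intro h
    have h1 : swap (0 : Fin 4) 1 ∈ Hd := Subgroup.subset_closure (by simp)
    have h2 : swap (2 : Fin 4) 3 ∈ Hd := Subgroup.subset_closure (by simp)
    rcases code_fix p h with h | h | h | h <;> subst h
    · exact one_mem _
    · exact h1
    · exact h2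
    · exact mul_mem h1 h2

theorem pcode_mul (t : Perm (Fin 4)) (s : Perm (Fin 3)) (ε : Fin 3 → ZMod 2)
    (h : ∀ x y, x ≠ y → code (t x) (t y) = (s (code x y).1, (code x y).2 + ε (code x y).1))
    (p : Perm (Fin 4)) : pcode (t * p) = (s (pcode p).1, (pcode p).2 + ε (pcode p).1) := by
  have : p 0 ≠ p 1 := fun h => by simpa using p.injective h
  simpa [pcode] using h _ _ this

theorem pcode_eq (p q : Perm (Fin 4)) : pcode p = pcode q ↔ p⁻¹ * q ∈ Hd := by
  obtain ⟨s, ε, -, h⟩ := code_act p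
  have key := pcode_mul p s ε h
  have h1 := key 1
  have h2 := key (p⁻¹ * q)
  rw [mul_one] at h1
  rw [mul_inv_cancel_left] at h2
  have h0 : pcode 1 = (0, 0) := rfl
  rw [mem_Hd]
  constructor
  · intro e
    rw [h1, h2, h0] at e
    rw [Prod.ext_iff] at e
    simp only [EmbeddingLike.apply_eq_iff_eq] at e
    obtain ⟨e1, e2⟩ := e
    rw [← e1] at e2
    exact Prod.ext e1.symm (add_right_cancel e2).symm
  · intro e
    rw [h1, h2, e, h0]

noncomputable def cosetCode : (Perm (Fin 4) ⧸ Hd) ≃ Fin 3 × ZMod 2 :=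
  Equiv.ofBijective
    (Quotient.lift pcode fun p q hpq => (pcode_eq p q).2 (QuotientGroup.leftRel_apply.1 hpq))
    (by
      constructor
      · intro x y
        induction x using QuotientGroup.induction_on with | _ p =>
        induction y using QuotientGroup.induction_on with | _ q =>
        intro h
        exact QuotientGroup.eq.2 ((pcode_eq p q).1 h)
      · intro z
        obtain ⟨p, hp⟩ := code_surj z
        exact ⟨(p : Perm (Fin 4) ⧸ Hd), hp⟩)

theorem cosetCode_mk (p : Perm (Fin 4)) :
    cosetCode (p : Perm (Fin 4) ⧸ Hd) = pcode p := rfl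

theorem mem_S46d (q : Perm (Perm (Fin 4) ⧸ Hd)) :
    q ∈ S46d ↔ ∃ (s : Perm (Fin 3)) (ε : Fin 3 → ZMod 2), ∑ j, ε j = 0 ∧
      ∀ x, cosetCode (q x) = (s (cosetCode x).1, (cosetCode x).2 + ε (cosetCode x).1) := by
  constructor
  · rintro ⟨t, rfl⟩
    obtain ⟨s, ε, hε, h⟩ := code_act t
    refine ⟨s, ε, hε, fun x => ?_⟩
    induction x using QuotientGroup.induction_on with | _ p =>
    exact pcode_mul t s ε h p
  · rintro ⟨s, ε, hε, h⟩
    obtain ⟨t, ht⟩ := code_act' s ε hε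
    refine ⟨t, ?_⟩
    ext x
    apply cosetCode.injective
    rw [h]
    induction x using QuotientGroup.induction_on with | _ p =>
    exact pcode_mul t s ε ht p

/-! ## Part A: from a cubic Cayley graph with a small kernel vector to the conclusion -/

section abstractPart

variable {T : Type} [Group T]

/-- automorphisms of the Cayley graph -/
def IsCA (a : Fin 3 → T) (A : Perm T) : Prop :=
  ∀ x, ∃ s : Perm (Fin 3), ∀ j, A (x * a j) = A x * a (s j)

/-- the kernel of adjacency plus identity over the field with two elements -/
def ker (a : Fin 3 → T) : Submodule (ZMod 2) (T → ZMod 2) where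
  carrier := {f | ∀ x, f x + ∑ j, f (x * a j) = 0}
  zero_mem' := by intro x; simp
  add_mem' := by
    intro f g hf hg x
    have := congrArg₂ (· + ·) (hf x) (hg x)
    simp only [add_zero] at this
    rw [← this]
    simp only [Pi.add_apply, Finset.sum_add_distrib]
    ring
  smul_mem' := by
    intro c f hf x
    have := congrArg (c * ·) (hf x)
    simp only [mul_zero] at this
    rw [← this]
    simp only [Pi.smul_apply, smul_eq_mul, ← Finset.mul_sum]
    ring

theorem mem_ker {a : Fin 3 → T} {f : T → ZMod 2} :
    f ∈ ker a ↔ ∀ x, f x + ∑ j, f (x * a j) = 0 := Iff.rfl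

theorem ker_comp {a : Fin 3 → T} {f : T → ZMod 2} (hf : f ∈ ker a) {A : Perm T}
    (hA : IsCA a A) : (fun x => f (A x)) ∈ ker a := by
  intro x
  obtain ⟨s, hs⟩ := hA x
  simp only [hs]
  rw [Equiv.sum_comp s (fun j => f (A x * a j))]
  exact hf (A x)

theorem IsCA.one (a : Fin 3 → T) : IsCA a 1 := fun _ => ⟨1, fun _ => rfl⟩

theorem IsCA.mul {a : Fin 3 → T} {A B : Perm T} (hA : IsCA a A) (hB : IsCA a B) :
    IsCA a (A * B) := by
  intro x
  obtain ⟨s, hs⟩ := hB x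
  obtain ⟨t, ht⟩ := hA (B x)
  exact ⟨t * s, fun j => by simp [hs, ht]⟩

theorem IsCA.inv {a : Fin 3 → T} {A : Perm T} (hA : IsCA a A) : IsCA a A⁻¹ := by
  intro x
  obtain ⟨s, hs⟩ := hA (A⁻¹ x)
  refine ⟨s⁻¹, fun j => ?_⟩
  rw [Perm.inv_eq_iff_eq, hs]
  simp

theorem IsCA.left (a : Fin 3 → T) (t : T) : IsCA a (Equiv.mulLeft t) :=
  fun x => ⟨1, fun j => by simp [mul_assoc]⟩

theorem IsCA.of_uniform {a : Fin 3 → T} {A : Perm T} {s : Perm (Fin 3)}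
    (h : ∀ x j, A (x * a j) = A x * a (s j)) : IsCA a A := fun x => ⟨s, h x⟩

variable {V : Type}

/-- the graph: lexicographic product of the Cayley graph with two isolated points -/
def gr (a : Fin 3 → T) (hinv : ∀ j, a j * a j = 1) (hne : ∀ j, a j ≠ 1)
    (e : V ≃ T × ZMod 2) : SimpleGraph V where
  Adj u v := ∃ j, (e v).1 = (e u).1 * a j
  symm := ⟨by
    rintro u v ⟨j, h⟩
    exact ⟨j, by rw [h, mul_assoc, hinv, mul_one]⟩⟩
  loopless := ⟨by
    rintro u ⟨j, h⟩
    exact hne j (by simpa using h)⟩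

/-- the group -/
def grp (a : Fin 3 → T) (e : V ≃ T × ZMod 2) : Subgroup (Perm V) where
  carrier := {g | ∃ A : Perm T, IsCA a A ∧ ∃ f ∈ ker a,
    ∀ v, e (g v) = (A (e v).1, (e v).2 + f (e v).1)}
  one_mem' := ⟨1, IsCA.one a, 0, Submodule.zero_mem _, fun v => by simp⟩
  mul_mem' := by
    rintro g g' ⟨A, hA, f, hf, h⟩ ⟨A', hA', f', hf', h'⟩
    refine ⟨A * A', hA.mul hA', f' + fun x => f (A' x),
      Submodule.add_mem _ hf' (ker_comp hf hA'), fun v => ?_⟩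
    simp [h, h', add_assoc]
  inv_mem' := by
    rintro g ⟨A, hA, f, hf, h⟩
    refine ⟨A⁻¹, hA.inv, -fun x => f (A⁻¹ x), Submodule.neg_mem _ (ker_comp hf hA.inv),
      fun v => ?_⟩
    have := h (g⁻¹ v)
    rw [show g (g⁻¹ v) = v from g.apply_symm_apply v] at this
    rw [this]
    simp [add_assoc, CharTwo.add_self_eq_zero]

theorem exists_elem {a : Fin 3 → T} (e : V ≃ T × ZMod 2) {A : Perm T} (hA : IsCA a A)
    {f : T → ZMod 2} (hf : f ∈ ker a) :
    ∃ g ∈ grp a e, ∀ v, e (g v) = (A (e v).1, (e v).2 + f (e v).1) := by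
  let P : Perm (T × ZMod 2) :=
    { toFun := fun z => (A z.1, z.2 + f z.1)
      invFun := fun z => (A⁻¹ z.1, z.2 - f (A⁻¹ z.1))
      left_inv := fun z => by simp
      right_inv := fun z => by simp }
  have : ∀ v, e ((e.symm.permCongr P) v) = (A (e v).1, (e v).2 + f (e v).1) := by
    intro v
    simp [Equiv.permCongr_apply, P]
  exact ⟨e.symm.permCongr P, ⟨A, hA, f, hf, this⟩, this⟩

theorem even_vec : ∀ ε δ : Fin 3 → ZMod 2, ∑ j, ε j = 0 → ∑ j, δ j = 0 → ε ≠ 0 → δ ≠ 0 →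
    ∃ s : Perm (Fin 3), ∀ j, ε (s j) = δ j := by
  decide +kernel

theorem zmod2_cases : ∀ z : ZMod 2, z = 0 ∨ z = 1 := by decide

/-- the induced even sign patterns -/
theorem ker_local {a : Fin 3 → T}
    (hgen : ∀ P : T → Prop, P 1 → (∀ x j, P x → P (x * a j)) → ∀ x, P x)
    (haut : ∀ s : Perm (Fin 3), ∃ φ : Perm T, φ 1 = 1 ∧ ∀ x j, φ (x * a j) = φ x * a (s j))
    {f0 : T → ZMod 2} (hf0 : f0 ∈ ker a) {y : T} (hy : f0 y ≠ 0) {z : T} (hz : f0 z = 0)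
    (x : T) (δ : Fin 3 → ZMod 2) (hδ : ∑ j, δ j = 0) :
    ∃ f ∈ ker a, f x = 0 ∧ ∀ j, f (x * a j) = δ j := by
  -- first at the identity
  suffices H : ∃ f ∈ ker a, f 1 = 0 ∧ ∀ j, f (a j) = δ j by
    obtain ⟨f, hf, h1, h2⟩ := H
    refine ⟨_, ker_comp hf (IsCA.left a x⁻¹), by simpa using h1, fun j => by simpa using h2 j⟩
  by_cases hd : δ = 0
  · exact ⟨0, Submodule.zero_mem _, rfl, fun j => by simp [hd]⟩
  have : ∃ w, f0 w = 0 ∧ ∃ j, f0 (w * a j) ≠ 0 := by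
    by_contra hcon
    push Not at hcon
    have := hgen (fun t => f0 (z * t) = 0) (by simpa using hz)
      (fun t j ht => by rw [← mul_assoc]; exact hcon _ ht j) (z⁻¹ * y)
    rw [mul_inv_cancel_left] at this
    exact hy this
  obtain ⟨w, hw, j, hj⟩ := this
  obtain ⟨s, hs⟩ := even_vec (fun j => f0 (w * a j)) δ (by simpa [hw] using hf0 w) hδ
    (fun h => hj (congrFun h j)) hd
  obtain ⟨φ, hφ1, hφ⟩ := haut s
  refine ⟨_, ker_comp hf0 ((IsCA.left a w).mul (IsCA.of_uniform hφ)), by simp [hφ1, hw], ?_⟩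
  intro j
  have := hφ 1 j
  rw [one_mul, hφ1, one_mul] at this
  simpa [this] using hs j

/-- the cardinality of the kernel -/
theorem card_ker [Finite T] {a : Fin 3 → T} {f0 : T → ZMod 2} (hf0 : f0 ∈ ker a)
    (h1 : f0 1 ≠ 0) {n : ℕ} (hsupp : {x | f0 x ≠ 0}.ncard ≤ n) :
    2 ^ Nat.card T ≤ Nat.card (ker a) ^ n := by
  classical
  have := Fintype.ofFinite T
  let tr : T → (T → ZMod 2) := fun g x => f0 (g * x)
  have htr : ∀ g, tr g ∈ ker a := fun g => ker_comp hf0 (IsCA.left a g)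
  obtain ⟨b, hb1, hb2, hb3⟩ := exists_linearIndependent (ZMod 2) (Set.range tr)
  have hbf : b.Finite := Set.toFinite b
  have hsub : Submodule.span (ZMod 2) b ≤ ker a := by
    rw [Submodule.span_le]
    intro f hf
    obtain ⟨g, rfl⟩ := hb1 hf
    exact htr g
  have := hbf.fintype
  have hrank : b.ncard ≤ Module.finrank (ZMod 2) (ker a) := by
    have h := finrank_span_set_eq_card hb3
    have h2 := Submodule.finrank_mono hsub
    rw [h] at h2
    rwa [Set.ncard_eq_toFinset_card']
  have hcov : (Set.univ : Set T) ⊆ ⋃ f ∈ hbf.toFinset, {x | f x ≠ 0} := by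
    intro y _
    by_contra hcon
    simp only [Set.mem_iUnion, Set.mem_ofPred_eq, not_exists, Set.Finite.mem_toFinset,
      not_not] at hcon
    have : ∀ f ∈ Submodule.span (ZMod 2) b, f y = 0 := by
      intro f hf
      induction hf using Submodule.span_induction with
      | mem f hf => exact hcon f hf
      | zero => rfl
      | add f g _ _ hf hg => simp [hf, hg]
      | smul c f _ hf => simp [hf]
    have h3 := this (tr y⁻¹) (by rw [hb2]; exact Submodule.subset_span ⟨_, rfl⟩)
    simp only [tr, inv_mul_cancel] at h3
    exact h1 h3
  have hc : Nat.card T ≤ b.ncard * n := by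
    rw [← Set.ncard_univ]
    refine (Set.ncard_le_ncard hcov (Set.toFinite _)).trans ?_
    refine (Finset.set_ncard_biUnion_le _ _).trans ?_
    rw [Set.ncard_eq_toFinset_card b hbf]
    refine Finset.sum_le_card_nsmul _ _ n ?_
    intro f hf
    rw [Set.Finite.mem_toFinset] at hf
    obtain ⟨g, rfl⟩ := hb1 hf
    refine le_trans ?_ hsupp
    refine Set.ncard_le_ncard_of_injOn (fun x => g * x) (fun x hx => hx)
      (fun x _ y _ h => mul_left_cancel h) (Set.toFinite _)
  have hk : Nat.card (ker a) = 2 ^ Module.finrank (ZMod 2) (ker a) := by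
    rw [Module.natCard_eq_pow_finrank (K := ZMod 2)]
    simp
  rw [hk, ← pow_mul]
  exact Nat.pow_le_pow_right (by norm_num) (hc.trans (Nat.mul_le_mul_right _ hrank))

end abstractPart

end S46
namespace S46

open Equiv

section abstractPart

variable {T : Type} [Group T] {V : Type}

/-- the neighbourhood of a vertex, labelled -/
theorem nbr_equiv {a : Fin 3 → T} (ha : Function.Injective a) (hinv : ∀ j, a j * a j = 1)
    (hne : ∀ j, a j ≠ 1) (e : V ≃ T × ZMod 2) (v : V) :
    ∃ n : Fin 3 × ZMod 2 ≃ (gr a hinv hne e).neighborSet v,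
      ∀ z, e (n z) = ((e v).1 * a z.1, z.2) := by
  let F : Fin 3 × ZMod 2 → (gr a hinv hne e).neighborSet v :=
    fun z => ⟨e.symm ((e v).1 * a z.1, z.2), ⟨z.1, by simp⟩⟩
  have hF : ∀ z, e (F z) = ((e v).1 * a z.1, z.2) := fun z => by simp [F]
  have hb : Function.Bijective F := by
    constructor
    · intro z w h
      have h2 := hF z
      rw [h, hF w] at h2
      rw [Prod.ext_iff] at h2
      exact Prod.ext (ha (mul_left_cancel h2.1)).symm h2.2.symm
    · rintro ⟨u, j, hj⟩
      refine ⟨(j, (e u).2), ?_⟩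
      apply Subtype.ext
      apply e.injective
      rw [hF]
      exact Prod.ext hj.symm rfl
  exact ⟨Equiv.ofBijective F hb, hF⟩

theorem grp_aut {a : Fin 3 → T} (hinv : ∀ j, a j * a j = 1)
    (hne : ∀ j, a j ≠ 1) (e : V ≃ T × ZMod 2) (g : Perm V) (hg : g ∈ grp a e) :
    IsGraphAut (gr a hinv hne e) g := by
  have key : ∀ g ∈ grp a e, ∀ u v, (gr a hinv hne e).Adj u v →
      (gr a hinv hne e).Adj (g u) (g v) := by
    rintro g ⟨A, hA, f, hf, h⟩ u v ⟨j, hj⟩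
    obtain ⟨s, hs⟩ := hA (e u).1
    exact ⟨s j, by rw [h, h, hj, hs]⟩
  intro u v
  refine ⟨fun h => ?_, key g hg u v⟩
  have := key _ (inv_mem hg) _ _ h
  simpa using this

theorem gr_connected {a : Fin 3 → T} (hinv : ∀ j, a j * a j = 1)
    (hne : ∀ j, a j ≠ 1) (e : V ≃ T × ZMod 2)
    (hgen : ∀ P : T → Prop, P 1 → (∀ x j, P x → P (x * a j)) → ∀ x, P x) :
    (gr a hinv hne e).Connected := by
  have hadj : ∀ x s j t, (gr a hinv hne e).Adj (e.symm (x, s)) (e.symm (x * a j, t)) :=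
    fun x s j t => ⟨j, by simp⟩
  have h0 : ∀ s t, (gr a hinv hne e).Reachable (e.symm (1, s)) (e.symm (1, t)) := by
    intro s t
    exact (hadj 1 s 0 0).reachable.trans (hadj 1 t 0 0).reachable.symm
  have h1 : ∀ x s, (gr a hinv hne e).Reachable (e.symm (1, 0)) (e.symm (x, s)) := by
    intro x
    refine hgen (fun x => ∀ s, (gr a hinv hne e).Reachable (e.symm (1, 0)) (e.symm (x, s)))
      (fun s => h0 0 s) ?_ x
    intro x j hx s
    exact (hx 0).trans (hadj x 0 j s).reachable
  have h2 : ∀ v, (gr a hinv hne e).Reachable (e.symm (1, 0)) v := by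
    intro v
    simpa using h1 (e v).1 (e v).2
  haveI : Nonempty V := ⟨e.symm (1, 0)⟩
  exact ⟨fun u v => (h2 u).symm.trans (h2 v)⟩

/-- the automorphism of the Cayley graph fixing `x` and inducing `s` around `x` -/
theorem exists_rot {a : Fin 3 → T}
    (haut : ∀ s : Perm (Fin 3), ∃ φ : Perm T, φ 1 = 1 ∧ ∀ x j, φ (x * a j) = φ x * a (s j))
    (x y : T) (s : Perm (Fin 3)) :
    ∃ A : Perm T, IsCA a A ∧ A x = y ∧ ∀ j, A (x * a j) = y * a (s j) := by
  obtain ⟨φ, h1, h2⟩ := haut s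
  refine ⟨Equiv.mulLeft y * (φ * Equiv.mulLeft x⁻¹),
    (IsCA.left a y).mul ((IsCA.of_uniform h2).mul (IsCA.left a x⁻¹)), by simp [h1], fun j => ?_⟩
  have := h2 1 j
  rw [one_mul, h1, one_mul] at this
  simp [this]

theorem grp_arc {a : Fin 3 → T} (hinv : ∀ j, a j * a j = 1)
    (hne : ∀ j, a j ≠ 1) (e : V ≃ T × ZMod 2)
    (haut : ∀ s : Perm (Fin 3), ∃ φ : Perm T, φ 1 = 1 ∧ ∀ x j, φ (x * a j) = φ x * a (s j))
    (hloc : ∀ (x : T) (δ : Fin 3 → ZMod 2), ∑ j, δ j = 0 →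
      ∃ f ∈ ker a, f x = 0 ∧ ∀ j, f (x * a j) = δ j) :
    ArcTransitiveOn (gr a hinv hne e) (grp a e) := by
  have hδ : ∀ (j : Fin 3) (β : ZMod 2), ∃ δ : Fin 3 → ZMod 2, ∑ j, δ j = 0 ∧ δ j = β := by
    decide +kernel
  have h0 : ∀ (x : T) (j : Fin 3) (β : ZMod 2), ∃ f ∈ ker a, f x = 0 ∧ f (x * a j) = β := by
    intro x j β
    obtain ⟨δ, h1, h2⟩ := hδ j β
    obtain ⟨f, hf, hf1, hf2⟩ := hloc x δ h1
    exact ⟨f, hf, hf1, by rw [hf2, h2]⟩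
  rintro u v u' v' ⟨j, hj⟩ ⟨j', hj'⟩
  obtain ⟨A, hA, hA1, hA2⟩ := exists_rot haut (e u).1 (e u').1 (swap j j')
  obtain ⟨f1, hf1, h11, h12⟩ := h0 (e u).1 j ((e v').2 - (e v).2)
  obtain ⟨f2, hf2, h21, h22⟩ := h0 ((e u).1 * a j) j ((e u').2 - (e u).2)
  rw [mul_assoc, hinv, mul_one] at h22
  obtain ⟨g, hg, h⟩ := exists_elem e hA (Submodule.add_mem _ hf1 hf2)
  refine ⟨g, hg, ?_, ?_⟩
  · apply e.injective
    rw [h, hA1]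
    apply Prod.ext
    · rfl
    · simp [h11, h22]
  · apply e.injective
    rw [h, hj, hA2]
    apply Prod.ext
    · simp [hj']
    · simp [h12, h21]

theorem grp_local {a : Fin 3 → T} (ha : Function.Injective a) (hinv : ∀ j, a j * a j = 1)
    (hne : ∀ j, a j ≠ 1) (e : V ≃ T × ZMod 2)
    (haut : ∀ s : Perm (Fin 3), ∃ φ : Perm T, φ 1 = 1 ∧ ∀ x j, φ (x * a j) = φ x * a (s j))
    (hloc : ∀ (x : T) (δ : Fin 3 → ZMod 2), ∑ j, δ j = 0 →
      ∃ f ∈ ker a, f x = 0 ∧ ∀ j, f (x * a j) = δ j) (v : V) :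
    PermIsomorphic (localActionSet (gr a hinv hne e) (grp a e) v)
        ((S46d : Subgroup _) : Set (Equiv.Perm (Equiv.Perm (Fin 4) ⧸ Hd))) := by
  obtain ⟨n, hn⟩ := nbr_equiv ha hinv hne e v
  refine ⟨n.symm.trans cosetCode.symm, fun q => ?_⟩
  rw [SetLike.mem_coe, mem_S46d]
  constructor
  · rintro ⟨s, ε, hε, hq⟩
    obtain ⟨A, hA, hA1, hA2⟩ := exists_rot haut (e v).1 (e v).1 s
    obtain ⟨f, hf, hf1, hf2⟩ := hloc (e v).1 ε hε
    obtain ⟨g, hg, h⟩ := exists_elem e hA hf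
    let P : Perm (Fin 3 × ZMod 2) :=
      { toFun := fun z => (s z.1, z.2 + ε z.1)
        invFun := fun z => (s.symm z.1, z.2 - ε (s.symm z.1))
        left_inv := fun z => by simp
        right_inv := fun z => by simp }
    refine ⟨n.permCongr P, ⟨g, hg, ?_, ?_⟩, ?_⟩
    · apply e.injective
      rw [h, hA1, hf1, add_zero]
    · intro u
      obtain ⟨z, rfl⟩ := n.surjective u
      apply e.injective
      rw [h, hn]
      simp [Equiv.permCongr_apply, hn, P, hA2, hf2]
    · intro u
      obtain ⟨z, rfl⟩ := n.surjective u
      apply cosetCode.injective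
      rw [hq]
      simp [Equiv.permCongr_apply, P]
  · rintro ⟨p, ⟨g, ⟨A, hA, f, hf, h⟩, hgv, hp⟩, hq⟩
    have hv := h v
    rw [hgv, Prod.ext_iff] at hv
    obtain ⟨hv1, hv2⟩ := hv
    simp only [left_eq_add] at hv1 hv2
    obtain ⟨s, hs⟩ := hA (e v).1
    refine ⟨s, fun j => f ((e v).1 * a j), ?_, ?_⟩
    · simpa [hv2] using hf (e v).1
    · intro x
      obtain ⟨z, rfl⟩ := cosetCode.symm.surjective x
      have hpz : p (n z) = n (s z.1, z.2 + f ((e v).1 * a z.1)) := by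
        apply Subtype.ext
        apply e.injective
        rw [hp, h, hn, hn]
        simp only [hs, ← hv1]
      have := hq (n z)
      rw [hpz] at this
      simp only [Equiv.trans_apply, Equiv.symm_apply_apply] at this
      rw [← this]
      simp

theorem grp_card [Finite T] {a : Fin 3 → T} (ha : Function.Injective a)
    (e : V ≃ T × ZMod 2)
    (haut : ∀ s : Perm (Fin 3), ∃ φ : Perm T, φ 1 = 1 ∧ ∀ x j, φ (x * a j) = φ x * a (s j))
    (hinv : ∀ j, a j * a j = 1)
    (hloc : ∀ (x : T) (δ : Fin 3 → ZMod 2), ∑ j, δ j = 0 →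
      ∃ f ∈ ker a, f x = 0 ∧ ∀ j, f (x * a j) = δ j) (v : V) :
    Nat.card (ker a) ≤ Nat.card ↥(grp a e ⊓ MulAction.stabilizer (Perm V) v) := by
  classical
  haveI : Finite V := Finite.of_equiv _ e.symm
  obtain ⟨A, hA, hA1, hA2⟩ := exists_rot haut (e v).1 (e v).1 (swap 0 1)
  have hAne : A ((e v).1 * a 0) ≠ (e v).1 * a 0 := by
    rw [hA2]
    intro h
    have := ha (mul_left_cancel h)
    simp at this
  obtain ⟨f', hf', hf1, hf2⟩ := hloc ((e v).1 * a 0) (fun j => if j = 2 then 0 else 1)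
    (by decide +kernel)
  have hf3 := hf2 0
  rw [mul_assoc, hinv, mul_one] at hf3
  replace hf3 : f' (e v).1 = 1 := by simpa using hf3
  have key : ∀ f : ker a, ∃ g : ↥(grp a e ⊓ MulAction.stabilizer (Perm V) v),
      ∀ u, e (g.1 u) = (if f.1 (e v).1 = 0 then ((e u).1, (e u).2 + f.1 (e u).1)
        else (A (e u).1, (e u).2 + (f.1 (e u).1 + f' (e u).1))) := by
    intro f
    by_cases h0 : f.1 (e v).1 = 0
    · obtain ⟨g, hg, h⟩ := exists_elem e (IsCA.one a) f.2
      refine ⟨⟨g, hg, ?_⟩, ?_⟩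
      · apply e.injective
        show e (g v) = e v
        rw [h, h0]
        simp
      · simp only [h0, if_true]
        exact h
    · obtain ⟨g, hg, h⟩ := exists_elem e hA (Submodule.add_mem _ f.2 hf')
      refine ⟨⟨g, hg, ?_⟩, ?_⟩
      · apply e.injective
        show e (g v) = e v
        have h1 : f.1 (e v).1 = 1 := (zmod2_cases _).resolve_left h0
        rw [h, hA1, Pi.add_apply, h1, hf3, CharTwo.add_self_eq_zero, add_zero]
      · simp only [h0, if_false]
        exact h
  choose g hg using key
  have hg' : ∀ f x, e ((g f).1 (e.symm (x, 0))) = (if f.1 (e v).1 = 0 then (x, f.1 x)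
        else (A x, (f.1 x + f' x))) := by
    intro f x
    simpa using hg f (e.symm (x, 0))
  refine Nat.card_le_card_of_injective g ?_
  intro f1 f2 h12
  have hx : ∀ x, (if f1.1 (e v).1 = 0 then (x, f1.1 x) else (A x, (f1.1 x + f' x))) =
      (if f2.1 (e v).1 = 0 then (x, f2.1 x) else (A x, (f2.1 x + f' x))) := by
    intro x
    rw [← hg', ← hg', h12]
  apply Subtype.ext
  funext x
  by_cases h1 : f1.1 (e v).1 = 0 <;> by_cases h2 : f2.1 (e v).1 = 0
  · have := hx x
    simp only [h1, h2, if_true] at this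
    exact (Prod.ext_iff.1 this).2
  · have := hx ((e v).1 * a 0)
    simp only [h1, h2, if_true, if_false] at this
    exact absurd (Prod.ext_iff.1 this).1.symm hAne
  · have := hx ((e v).1 * a 0)
    simp only [h1, h2, if_true, if_false] at this
    exact absurd (Prod.ext_iff.1 this).1 hAne
  · have := hx x
    simp only [h1, h2, if_false] at this
    exact add_right_cancel (Prod.ext_iff.1 this).2

theorem abstract_main [Finite T] (a : Fin 3 → T) (ha : Function.Injective a)
    (hinv : ∀ j, a j * a j = 1) (hne : ∀ j, a j ≠ 1)
    (hgen : ∀ P : T → Prop, P 1 → (∀ x j, P x → P (x * a j)) → ∀ x, P x)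
    (haut : ∀ s : Perm (Fin 3), ∃ φ : Perm T, φ 1 = 1 ∧ ∀ x j, φ (x * a j) = φ x * a (s j))
    (f0 : T → ZMod 2) (hf0 : f0 ∈ ker a) (h1 : f0 1 ≠ 0)
    (hsupp : {x | f0 x ≠ 0}.ncard ≤ 72) (hcard : 72 < Nat.card T) :
    ∃ (m : ℕ) (Γ : SimpleGraph (Fin m)) (G : Subgroup (Equiv.Perm (Fin m))),
      Nat.card T ≤ m ∧ Γ.Connected ∧ (∀ v : Fin m, Nat.card (Γ.neighborSet v) = 6) ∧
      (∀ g ∈ G, IsGraphAut Γ g) ∧ ArcTransitiveOn Γ G ∧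
      (∀ v : Fin m, PermIsomorphic (localActionSet Γ G v)
        ((S46d : Subgroup _) : Set (Equiv.Perm (Equiv.Perm (Fin 4) ⧸ Hd)))) ∧
      (∀ v : Fin m,
        2 ^ m ≤ Nat.card ↥(G ⊓ MulAction.stabilizer (Equiv.Perm (Fin m)) v) ^ 144) := by
  classical
  have hz : ∃ z, f0 z = 0 := by
    by_contra hcon
    push Not at hcon
    have : {x | f0 x ≠ 0} = Set.univ := Set.eq_univ_of_forall hcon
    rw [this, Set.ncard_univ] at hsupp
    omega
  obtain ⟨z, hz⟩ := hz
  have hloc := fun x δ hδ => ker_local hgen haut hf0 h1 hz x δ hδ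
  have hm : Nat.card (T × ZMod 2) = Nat.card T * 2 := by simp [Nat.card_prod]
  let e : Fin (Nat.card (T × ZMod 2)) ≃ T × ZMod 2 := (Finite.equivFin _).symm
  refine ⟨_, gr a hinv hne e, grp a e, by omega, gr_connected hinv hne e hgen, fun v => ?_,
    grp_aut hinv hne e, grp_arc hinv hne e haut hloc,
    grp_local ha hinv hne e haut hloc, fun v => ?_⟩
  · obtain ⟨n, -⟩ := nbr_equiv ha hinv hne e v
    rw [← Nat.card_congr n]
    simp [Nat.card_prod]
  · have hk := card_ker hf0 h1 hsupp
    have hc := grp_card ha e haut hinv hloc v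
    calc 2 ^ Nat.card (T × ZMod 2) = (2 ^ Nat.card T) ^ 2 := by rw [hm, pow_mul]
      _ ≤ (Nat.card (ker a) ^ 72) ^ 2 := Nat.pow_le_pow_left hk 2
      _ = Nat.card (ker a) ^ 144 := by rw [← pow_mul]
      _ ≤ _ := Nat.pow_le_pow_left hc 144

end abstractPart

end S46
namespace S46

/-! ## Part B: the reflection group over `ℤ[i]/k` -/

/-- multiplication by `1 + i` on pairs `(p, q) = p + q i` -/
def mulP {A : Type*} [Ring A] (x : A × A) : A × A := (x.1 - x.2, x.1 + x.2)

/-- multiplication by `1 - i` -/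
def mulM {A : Type*} [Ring A] (x : A × A) : A × A := (x.1 + x.2, x.2 - x.1)

/-- a column vector with three Gaussian entries -/
abbrev Col := (ℤ × ℤ) × (ℤ × ℤ) × (ℤ × ℤ)

/-- a `3 × 3` Gaussian matrix, by columns -/
abbrev Mat := Col × Col × Col

def colP (c : Col) : Col := (mulP c.1, mulP c.2.1, mulP c.2.2)
def colM (c : Col) : Col := (mulM c.1, mulM c.2.1, mulM c.2.2)

/-- right multiplication of a matrix by the `j`-th reflection -/
def stepM (M : Mat) : Fin 3 → Mat
  | 0 => (-M.1, M.2.1 + colP M.1, M.2.2 + colM M.1)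
  | 1 => (M.1 + colM M.2.1, -M.2.1, M.2.2 + colP M.2.1)
  | 2 => (M.1 + colP M.2.2, M.2.1 + colM M.2.2, -M.2.2)

def idM : Mat :=
  (((1, 0), (0, 0), (0, 0)), ((0, 0), (1, 0), (0, 0)), ((0, 0), (0, 0), (1, 0)))

def supportWords : List (List (Fin 3)) :=
  [[], [0], [1], [2], [0, 1], [0, 2], [2, 0], [2, 1], [0, 1, 0], [0, 1, 2], [1, 0, 1],
   [1, 2, 1], [2, 1, 0], [2, 1, 2], [0, 1, 2, 0], [0, 1, 2, 1], [0, 2, 0, 2], [0, 2, 1, 2],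
   [1, 0, 1, 2], [1, 2, 1, 0], [2, 0, 1, 0], [2, 1, 0, 1], [2, 1, 0, 2], [0, 1, 0, 2, 0],
   [0, 1, 2, 0, 1], [0, 1, 2, 0, 2], [0, 2, 0, 2, 1], [0, 2, 1, 2, 0], [2, 0, 1, 0, 2],
   [2, 1, 0, 2, 0], [2, 1, 0, 2, 1], [2, 1, 2, 0, 2], [0, 1, 0, 2, 0, 1], [0, 1, 2, 0, 1, 0],
   [0, 1, 2, 0, 1, 2], [0, 1, 2, 1, 0, 1], [1, 0, 1, 2, 0, 1], [1, 0, 1, 2, 1, 0],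
   [1, 2, 1, 0, 1, 2], [1, 2, 1, 0, 2, 1], [2, 1, 0, 1, 2, 1], [2, 1, 0, 2, 1, 2],
   [2, 1, 2, 0, 2, 1], [0, 1, 2, 0, 1, 2, 1], [0, 1, 2, 0, 2, 1, 2], [0, 1, 2, 1, 0, 1, 2],
   [0, 2, 0, 2, 1, 0, 2], [0, 2, 0, 2, 1, 2, 0], [0, 2, 1, 2, 0, 1, 2], [0, 2, 1, 2, 0, 2, 1],
   [1, 0, 1, 2, 0, 1, 0], [1, 0, 1, 2, 1, 0, 1], [1, 2, 1, 0, 1, 2, 1], [1, 2, 1, 0, 2, 1, 2],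
   [2, 0, 1, 0, 2, 0, 1], [2, 0, 1, 0, 2, 1, 0], [2, 1, 0, 1, 2, 1, 0], [2, 1, 0, 2, 0, 1, 0],
   [0, 1, 0, 2, 0, 1, 0, 2], [0, 1, 0, 2, 0, 1, 2, 0], [0, 1, 2, 0, 1, 0, 2, 0],
   [0, 1, 2, 0, 2, 1, 2, 0], [0, 2, 0, 2, 1, 0, 2, 0], [0, 2, 0, 2, 1, 2, 0, 2],
   [0, 2, 1, 2, 0, 1, 2, 1], [0, 2, 1, 2, 0, 2, 1, 2], [1, 2, 1, 0, 1, 2, 0, 1],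
   [2, 0, 1, 0, 2, 1, 0, 1], [2, 1, 0, 2, 0, 1, 0, 2], [0, 1, 0, 2, 0, 1, 2, 0, 2],
   [0, 1, 2, 0, 1, 0, 2, 0, 1], [0, 1, 2, 1, 0, 1, 2, 0, 1]]

/-- the 72 matrices in the support of the basic kernel vector -/
def supp : List Mat := supportWords.map fun w => w.foldl stepM idM

/-- all the closed neighbourhoods -/
def suppN : List Mat :=
  supp.flatMap fun M => [M, stepM M 0, stepM M 1, stepM M 2]

def smallZ (z : ℤ × ℤ) : Bool := decide (-9 < z.1 ∧ z.1 < 9 ∧ -9 < z.2 ∧ z.2 < 9)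
def smallC (c : Col) : Bool := smallZ c.1 && smallZ c.2.1 && smallZ c.2.2
def smallM (M : Mat) : Bool := smallC M.1 && smallC M.2.1 && smallC M.2.2

theorem supp_length : supp.length = 72 := by decide +kernel
theorem supp_small : ∀ M ∈ supp, smallM M = true := by decide +kernel
theorem supp_count : supp.count idM = 1 := by decide +kernel

/-- insert an element in a list, cancelling it against an equal element -/
def toggle (M : Mat) : List Mat → List Mat
  | [] => [M]
  | N :: l => if M = N then l else N :: toggle M l

theorem suppN_even : suppN.foldr toggle [] = [] := by decide +kernel

theorem toggle_sum (g : Mat → ZMod 2) (M : Mat) (l : List Mat) :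
    ((toggle M l).map g).sum = g M + (l.map g).sum := by
  induction l with
  | nil => simp [toggle]
  | cons N l ih =>
    rw [toggle]
    split_ifs with h
    · subst h
      simp only [List.map_cons, List.sum_cons]
      rw [← add_assoc, CharTwo.add_self_eq_zero, zero_add]
    · simp only [List.map_cons, List.sum_cons, ih]
      ring

theorem foldr_toggle_sum (g : Mat → ZMod 2) (l : List Mat) :
    ((l.foldr toggle []).map g).sum = (l.map g).sum := by
  induction l with
  | nil => simp
  | cons N l ih => simp [toggle_sum, ih]

theorem suppN_sum (g : Mat → ZMod 2) : (suppN.map g).sum = 0 := by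
  rw [← foldr_toggle_sum, suppN_even]; simp

theorem supp_sum (g : Mat → ZMod 2) :
    (supp.map g).sum + ((supp.map fun M => g (stepM M 0)).sum +
      ((supp.map fun M => g (stepM M 1)).sum + (supp.map fun M => g (stepM M 2)).sum)) = 0 := by
  rw [← suppN_sum g]
  unfold suppN
  generalize supp = l
  induction l with
  | nil => simp
  | cons N l ih =>
    simp only [List.map_cons, List.sum_cons, List.flatMap_cons, List.map_append, List.sum_append,
      List.map_nil, List.sum_nil, ← ih]
    ring

section concrete

variable (k : ℕ)

abbrev Vk := Fin 3 → ZMod k × ZMod k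

variable {k}

def step (j : Fin 3) (v : Vk k) : Vk k :=
  Function.update v j (-v j + mulP (v (j + 1)) + mulM (v (j + 2)))

theorem step_step (j : Fin 3) : Function.Involutive (step (k := k) j) := by
  intro v
  have h1 : j + 1 ≠ j := by revert j; decide
  have h2 : j + 2 ≠ j := by revert j; decide
  simp [step, h1, h2]
  abel

def refl (j : Fin 3) : Equiv.Perm (Vk k) := (step_step j).toPerm

theorem refl_apply (j : Fin 3) (v : Vk k) : refl j v = step j v := rfl

theorem refl_sq (j : Fin 3) : refl (k := k) j * refl j = 1 := by
  ext1 v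
  exact step_step j v

variable (k) in
def Tk : Subgroup (Equiv.Perm (Vk k)) := Subgroup.closure (Set.range refl)

def gen (j : Fin 3) : Tk k := ⟨refl j, Subgroup.subset_closure ⟨j, rfl⟩⟩

theorem gen_sq (j : Fin 3) : gen (k := k) j * gen j = 1 := Subtype.ext (refl_sq j)

theorem gen_ind (P : Tk k → Prop) (h1 : P 1) (hm : ∀ x j, P x → P (x * gen j)) (x : Tk k) :
    P x := by
  obtain ⟨x, hx⟩ := x
  induction hx using Subgroup.closure_induction_right with
  | one => exact h1
  | mul_right x hx y hy ih =>
    obtain ⟨j, rfl⟩ := hy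
    exact hm ⟨x, hx⟩ j ih
  | mul_inv_cancel x hx y hy ih =>
    obtain ⟨j, rfl⟩ := hy
    have : (refl (k := k) j)⁻¹ = refl j := inv_eq_of_mul_eq_one_left (refl_sq j)
    simp only [this]
    exact hm ⟨x, hx⟩ j ih

theorem refl_moves [Fact (1 < k)] (j : Fin 3) :
    ∃ v : Vk k, v j = 0 ∧ refl j v j ≠ 0 := by
  have h1 : j ≠ j + 1 := by revert j; decide
  have h2 : j + 2 ≠ j + 1 := by revert j; decide
  have h3 : j + 1 ≠ j := by revert j; decide
  refine ⟨Pi.single (j + 1) (1, 0), ?_, ?_⟩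
  · simp [h1]
  · simp [refl_apply, step, h1, h2, mulP, mulM]

theorem refl_fix {i j : Fin 3} (h : j ≠ i) (v : Vk k) : refl i v j = v j := by
  simp [refl_apply, step, h]

theorem gen_ne [Fact (1 < k)] (j : Fin 3) : gen (k := k) j ≠ 1 := by
  intro h
  obtain ⟨v, hv, hv'⟩ := refl_moves (k := k) j
  have := congrArg Subtype.val h
  change refl j = 1 at this
  rw [this] at hv'
  exact hv' hv

theorem gen_inj [Fact (1 < k)] : Function.Injective (gen (k := k)) := by
  intro i j h
  by_contra hij
  obtain ⟨v, hv, hv'⟩ := refl_moves (k := k) j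
  have := congrArg Subtype.val h
  change refl i = refl j at this
  rw [← this, refl_fix (Ne.symm hij)] at hv'
  exact hv' hv

/-! ### diagram automorphisms -/

def IsAut (s : Equiv.Perm (Fin 3)) : Prop :=
  ∃ φ : Equiv.Perm (Tk k), φ 1 = 1 ∧ ∀ x j, φ (x * gen j) = φ x * gen (s j)

theorem isAut_mul {s t : Equiv.Perm (Fin 3)} (hs : IsAut (k := k) s) (ht : IsAut (k := k) t) :
    IsAut (k := k) (s * t) := by
  obtain ⟨φ, h1, h2⟩ := hs
  obtain ⟨ψ, h3, h4⟩ := ht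
  exact ⟨φ * ψ, by simp [h1, h3], fun x j => by simp [h2, h4]⟩

theorem isAut_one : IsAut (k := k) 1 := ⟨1, by simp, by simp⟩

theorem isAut_of_conj [NeZero k] (s : Equiv.Perm (Fin 3)) (u : Equiv.Perm (Vk k))
    (h : ∀ j, u * refl j = refl (s j) * u) : IsAut (k := k) s := by
  have h' : ∀ j, u * refl j * u⁻¹ = refl (s j) := fun j => by rw [h]; group
  have key : ∀ x : Tk k, u * x.1 * u⁻¹ ∈ Tk k := by
    apply gen_ind
    · simpa using (Tk k).one_mem
    · intro x j hx
      have : u * (x * gen j : Tk k).1 * u⁻¹ = (u * x.1 * u⁻¹) * refl (s j) := by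
        rw [← h']; change u * (x.1 * refl j) * u⁻¹ = _; group
      rw [this]
      exact (Tk k).mul_mem hx (gen (s j)).2
  let φ : Tk k → Tk k := fun x => ⟨u * x.1 * u⁻¹, key x⟩
  have hinj : Function.Injective φ := by
    intro x y hxy
    have := congrArg Subtype.val hxy
    change u * x.1 * u⁻¹ = u * y.1 * u⁻¹ at this
    exact Subtype.ext (by simpa using this)
  refine ⟨Equiv.ofBijective φ (Finite.injective_iff_bijective.mp hinj), ?_, ?_⟩
  · apply Subtype.ext
    change u * 1 * u⁻¹ = 1
    group
  · intro x j
    apply Subtype.ext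
    change u * (x.1 * refl j) * u⁻¹ = (u * x.1 * u⁻¹) * refl (s j)
    rw [← h']; group

def rotV : Equiv.Perm (Vk k) where
  toFun v j := v (j - 1)
  invFun v j := v (j + 1)
  left_inv v := by ext1 j; simp
  right_inv v := by ext1 j; simp

def conjP (x : ZMod k × ZMod k) : ZMod k × ZMod k := (x.1, -x.2)

def swapV : Equiv.Perm (Vk k) where
  toFun v j := conjP (v (Equiv.swap 0 1 j))
  invFun v j := conjP (v (Equiv.swap 0 1 j))
  left_inv v := by ext1 j; simp [conjP]
  right_inv v := by ext1 j; simp [conjP]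

theorem rotV_apply (v : Vk k) (j : Fin 3) : rotV v j = v (j - 1) := rfl
theorem swapV_apply (v : Vk k) (j : Fin 3) : swapV v j = conjP (v (Equiv.swap 0 1 j)) := rfl

theorem rotV_conj (j : Fin 3) : rotV (k := k) * refl j = refl (finRotate 3 j) * rotV := by
  ext1 v
  ext1 i
  simp only [Equiv.Perm.mul_apply, rotV_apply, refl_apply, step, finRotate_succ_apply]
  rcases eq_or_ne i (j + 1) with rfl | h
  · simp [rotV_apply, show j + 1 + 1 - 1 = j + 1 by abel, show j + 1 + 2 - 1 = j + 2 by abel]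
  · have h' : i - 1 ≠ j := fun h'' => h (by rw [← h'']; abel)
    simp [h, h', rotV_apply]

theorem swapV_conj (j : Fin 3) :
    swapV (k := k) * refl j = refl (Equiv.swap 0 1 j) * swapV := by
  ext1 v
  ext1 i
  simp only [Equiv.Perm.mul_apply, swapV_apply, refl_apply, step]
  have e0 : Equiv.swap (0 : Fin 3) 1 0 = 1 := by decide
  have e1 : Equiv.swap (0 : Fin 3) 1 1 = 0 := by decide
  have e2 : Equiv.swap (0 : Fin 3) 1 2 = 2 := by decide
  have f1 : (1 : Fin 3) + 1 = 2 := by decide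
  have f2 : (1 : Fin 3) + 2 = 0 := by decide
  have f3 : (2 : Fin 3) + 1 = 0 := by decide
  have f4 : (2 : Fin 3) + 2 = 1 := by decide
  fin_cases j <;> fin_cases i <;>
    simp [e0, e1, e2, f1, f2, f3, f4, swapV_apply, conjP, mulP, mulM, Function.update] <;>
    constructor <;> ring

theorem perm3 : ∀ s : Equiv.Perm (Fin 3), s = 1 ∨ s = finRotate 3 ∨ s = finRotate 3 * finRotate 3 ∨
    s = Equiv.swap 0 1 ∨ s = Equiv.swap 0 1 * finRotate 3 ∨
    s = Equiv.swap 0 1 * (finRotate 3 * finRotate 3) := by decide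

theorem isAut_all [NeZero k] (s : Equiv.Perm (Fin 3)) : IsAut (k := k) s := by
  have hr : IsAut (k := k) (finRotate 3) := isAut_of_conj _ rotV rotV_conj
  have hs : IsAut (k := k) (Equiv.swap 0 1) := isAut_of_conj _ swapV swapV_conj
  rcases perm3 s with rfl | rfl | rfl | rfl | rfl | rfl
  · exact isAut_one
  · exact hr
  · exact isAut_mul hr hr
  · exact hs
  · exact isAut_mul hs hr
  · exact isAut_mul hs (isAut_mul hr hr)

/-! ### the kernel vector -/

/-- Gaussian product of an element of `(ℤ/k)[i]` and an integral one -/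
def gm (x : ZMod k × ZMod k) (z : ℤ × ℤ) : ZMod k × ZMod k :=
  (x.1 * z.1 - x.2 * z.2, x.1 * z.2 + x.2 * z.1)

/-- the action of a matrix on vectors -/
def act (M : Mat) (v : Vk k) : Vk k :=
  ![gm (v 0) M.1.1 + gm (v 1) M.2.1.1 + gm (v 2) M.2.2.1,
    gm (v 0) M.1.2.1 + gm (v 1) M.2.1.2.1 + gm (v 2) M.2.2.2.1,
    gm (v 0) M.1.2.2 + gm (v 1) M.2.1.2.2 + gm (v 2) M.2.2.2.2]

theorem act_stepM (M : Mat) (j : Fin 3) (v : Vk k) : act (stepM M j) v = act M (refl j v) := by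
  have f1 : (1 : Fin 3) + 1 = 2 := by decide
  have f2 : (1 : Fin 3) + 2 = 0 := by decide
  have f3 : (2 : Fin 3) + 1 = 0 := by decide
  have f4 : (2 : Fin 3) + 2 = 1 := by decide
  ext1 i
  fin_cases j <;> fin_cases i <;>
    simp [f1, f2, f3, f4, act, stepM, refl_apply, step, gm, colP, colM, mulP, mulM,
      Function.update] <;>
    constructor <;> ring

theorem act_idM (v : Vk k) : act idM v = v := by
  ext1 i
  fin_cases i <;> simp [act, idM, gm, Prod.ext_iff]

theorem small_cast (hk : 101 ≤ k) {z w : ℤ} (h1 : -9 < z) (h2 : z < 9) (h3 : 0 ≤ w) (h4 : w ≤ 1)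
    (h : (z : ZMod k) = (w : ZMod k)) : z = w := by
  rw [ZMod.intCast_eq_intCast_iff_dvd_sub] at h
  have := Int.eq_zero_of_abs_lt_dvd h (by rw [abs_lt]; constructor <;> omega)
  omega

theorem small_eq (hk : 101 ≤ k) {z w : ℤ × ℤ} (hz : smallZ z = true)
    (hw : 0 ≤ w.1 ∧ w.1 ≤ 1 ∧ 0 ≤ w.2 ∧ w.2 ≤ 1)
    (h : gm (k := k) (1, 0) z = gm (1, 0) w) : z = w := by
  simp only [smallZ, decide_eq_true_eq] at hz
  simp only [gm, one_mul, zero_mul, sub_zero, add_zero, Prod.mk.injEq] at h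
  exact Prod.ext (small_cast hk hz.1 hz.2.1 hw.1 hw.2.1 h.1)
    (small_cast hk hz.2.2.1 hz.2.2.2 hw.2.2.1 hw.2.2.2 h.2)

theorem eq_idM (hk : 101 ≤ k) {M : Mat} (hM : smallM M = true) (h : ∀ v : Vk k, v = act M v) :
    M = idM := by
  have h' : ∀ v : Vk k, act M v = act idM v := fun v => by rw [act_idM, ← h]
  simp only [smallM, smallC, Bool.and_eq_true] at hM
  obtain ⟨⟨⟨⟨a1, a2⟩, a3⟩, ⟨⟨b1, b2⟩, b3⟩⟩, ⟨⟨c1, c2⟩, c3⟩⟩ := hM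
  have g0 : ∀ z, gm (k := k) 0 z = 0 := fun z => by simp [gm]
  have hA := h' (Pi.single 0 (1, 0))
  have hB := h' (Pi.single 1 (1, 0))
  have hC := h' (Pi.single 2 (1, 0))
  simp only [act, Pi.single_eq_same, ne_eq, g0, Pi.single_eq_of_ne, add_zero, zero_add,
    Matrix.vecCons_inj, not_false_eq_true, Fin.reduceEq, and_true] at hA hB hC
  obtain ⟨A1, A2, A3⟩ := hA
  obtain ⟨B1, B2, B3⟩ := hB
  obtain ⟨C1, C2, C3⟩ := hC
  have n : (0 : ℤ) ≤ 0 ∧ (0 : ℤ) ≤ 1 ∧ (0 : ℤ) ≤ 0 ∧ (0 : ℤ) ≤ 1 := by decide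
  have o : (0 : ℤ) ≤ 1 ∧ (1 : ℤ) ≤ 1 ∧ (0 : ℤ) ≤ 0 ∧ (0 : ℤ) ≤ 1 := by decide
  exact Prod.ext
    (Prod.ext (small_eq hk a1 o A1) (Prod.ext (small_eq hk a2 n A2) (small_eq hk a3 n A3)))
    (Prod.ext
      (Prod.ext (small_eq hk b1 n B1) (Prod.ext (small_eq hk b2 o B2) (small_eq hk b3 n B3)))
      (Prod.ext (small_eq hk c1 n C1) (Prod.ext (small_eq hk c2 n C2) (small_eq hk c3 o C3))))

open Classical in
noncomputable def F (M : Mat) (x : Tk k) : ZMod 2 := if ∀ v, x.1 v = act M v then 1 else 0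

noncomputable def f0 (x : Tk k) : ZMod 2 := (supp.map fun M => F M x).sum

theorem F_mul (M : Mat) (x : Tk k) (j : Fin 3) : F M (x * gen j) = F (stepM M j) x := by
  unfold F
  have : (∀ v, (x * gen j).1 v = act M v) ↔ ∀ v, x.1 v = act (stepM M j) v := by
    constructor
    · intro h v
      rw [act_stepM, ← h]
      change _ = x.1 (refl j (refl j v))
      rw [refl_apply, refl_apply, step_step]
    · intro h v
      change x.1 (refl j v) = _
      rw [h, act_stepM, refl_apply, refl_apply, step_step]
  classical exact if_congr this rfl rfl

theorem f0_ker : f0 ∈ ker (gen (k := k)) := by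
  rw [mem_ker]
  intro x
  rw [Fin.sum_univ_three]
  simp only [f0, F_mul]
  have := supp_sum fun M => F M x
  rw [add_assoc]
  exact this

theorem f0_one (hk : 101 ≤ k) : f0 (1 : Tk k) = 1 := by
  have h1 : ∀ M ∈ supp, F M (1 : Tk k) = if M = idM then 1 else 0 := by
    intro M hM
    unfold F
    have : (∀ v, (1 : Tk k).1 v = act M v) ↔ M = idM := by
      constructor
      · exact fun h => eq_idM hk (supp_small M hM) h
      · rintro rfl v
        rw [act_idM]; rfl
    classical exact if_congr this rfl rfl
  unfold f0
  rw [List.map_congr_left h1]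
  have : ∀ l : List Mat, (l.map fun M => if M = idM then (1 : ZMod 2) else 0).sum
      = (l.count idM : ℕ) := by
    intro l
    induction l with
    | nil => simp
    | cons N l ih =>
      simp only [List.map_cons, List.sum_cons, ih, List.count_cons, beq_iff_eq]
      split_ifs <;> push_cast <;> ring
  rw [this, supp_count]
  rfl

theorem f0_supp [NeZero k] : {x : Tk k | f0 x ≠ 0}.ncard ≤ 72 := by
  rw [← supp_length]
  unfold f0
  generalize supp = l
  induction l with
  | nil => simp
  | cons N l ih =>
    have hsub : {x : Tk k | ((N :: l).map fun M => F M x).sum ≠ 0} ⊆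
        {x : Tk k | F N x ≠ 0} ∪ {x : Tk k | (l.map fun M => F M x).sum ≠ 0} := by
      intro x hx
      by_contra hc
      simp only [Set.mem_union, Set.mem_setOf_eq, not_or, not_not] at hc
      apply hx
      simp [hc.1, hc.2]
    have h1 : {x : Tk k | F N x ≠ 0}.ncard ≤ 1 := by
      rw [Set.ncard_le_one (Set.toFinite _)]
      intro x hx y hy
      simp only [Set.mem_setOf_eq, F, ne_eq, ite_eq_right_iff, one_ne_zero, imp_false,
        not_not] at hx hy
      apply Subtype.ext
      ext1 v
      rw [hx, hy]
    have h2 := Set.ncard_le_ncard hsub (Set.toFinite _)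
    have h3 := Set.ncard_union_le {x : Tk k | F N x ≠ 0}
      {x : Tk k | (l.map fun M => F M x).sum ≠ 0}
    simp only [List.length_cons]
    omega

/-! ### the order of the group -/

def tau : Tk k := gen 0 * gen 1 * gen 0 * gen 2 * gen 1 * gen 2

theorem tau_apply (v : Vk k) (i : Fin 3) : (tau (k := k)).1 v i = v i + 2 * (v 0 - v 2) := by
  have f1 : (1 : Fin 3) + 1 = 2 := by decide
  have f2 : (1 : Fin 3) + 2 = 0 := by decide
  have f3 : (2 : Fin 3) + 1 = 0 := by decide
  have f4 : (2 : Fin 3) + 2 = 1 := by decide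
  change refl 0 (refl 1 (refl 0 (refl 2 (refl 1 (refl 2 v))))) i = _
  fin_cases i <;>
    simp [f1, f2, f3, f4, refl_apply, step, mulP, mulM, Function.update, Prod.ext_iff] <;>
    constructor <;> ring

theorem tau_pow (v : Vk k) (n : ℕ) (i : Fin 3) :
    (tau (k := k) ^ n).1 v i = v i + 2 * n * (v 0 - v 2) := by
  induction n generalizing i with
  | zero => simp
  | succ n ih =>
    rw [pow_succ']
    change tau.1 ((tau (k := k) ^ n).1 v) i = _
    rw [tau_apply, ih, ih, ih]
    push_cast
    ring

theorem card_Tk (M : ℕ) (hk : k = 2 * M + 101) : k ≤ Nat.card (Tk k) := by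
  haveI : NeZero k := ⟨by omega⟩
  let g : Tk k → ZMod k := fun x => (x.1 (Pi.single 0 (1, 0)) 1).1
  have hg : Function.Surjective g := by
    intro y
    refine ⟨tau ^ (((M + 51 : ℕ) : ZMod k) * y).val, ?_⟩
    have h2 : (2 : ZMod k) * (M + 51) = 1 := by
      have : ((2 * M + 101 : ℕ) : ZMod k) = 0 := by rw [← hk]; simp
      push_cast at this
      linear_combination this
    change ((tau ^ _ : Tk k).1 (Pi.single 0 (1, 0)) 1).1 = y
    rw [tau_pow]
    simp
    linear_combination y * h2
  have := Nat.card_le_card_of_surjective g hg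
  simpa using this

end concrete

end S46
/-- `S₄(6d)` is of exponential type: there are connected `6`-regular graphs `Γ` of
unboundedly large order together with arc-transitive groups of automorphisms `G` with local
action `S₄(6d)` and with vertex-stabilisers of order at least `2^(|V(Γ)|/144)`. -/
theorem statement1 (M : ℕ) :
    ∃ (m : ℕ) (Γ : SimpleGraph (Fin m)) (G : Subgroup (Equiv.Perm (Fin m))),
      M ≤ m ∧ Γ.Connected ∧ (∀ v : Fin m, Nat.card (Γ.neighborSet v) = 6) ∧
      (∀ g ∈ G, IsGraphAut Γ g) ∧ ArcTransitiveOn Γ G ∧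
      (∀ v : Fin m, PermIsomorphic (localActionSet Γ G v)
        ((S46d : Subgroup _) : Set (Equiv.Perm (Equiv.Perm (Fin 4) ⧸ Hd)))) ∧
      (∀ v : Fin m,
        2 ^ m ≤ Nat.card ↥(G ⊓ MulAction.stabilizer (Equiv.Perm (Fin m)) v) ^ 144) := by
  have hk : ∃ k : ℕ, k = 2 * M + 101 := ⟨_, rfl⟩
  obtain ⟨k, hk⟩ := hk
  haveI : NeZero k := ⟨by omega⟩
  haveI : Fact (1 < k) := ⟨by omega⟩
  have hc := S46.card_Tk M hk
  obtain ⟨m, Γ, G, hm, h⟩ := S46.abstract_main (S46.gen (k := k)) S46.gen_inj S46.gen_sq S46.gen_ne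
    S46.gen_ind S46.isAut_all S46.f0 S46.f0_ker
    (by rw [S46.f0_one (by omega)]; exact one_ne_zero) S46.f0_supp (by omega)
  exact ⟨m, Γ, G, by omega, h⟩
end

section
/- For every natural number M there exist a finite connected 6-regular simple graph Γ with |V(Γ)| ≥ M and a subgroup G ≤ Aut(Γ) acting transitively on the arcs of Γ, such that for every vertex v the local action G_v^{Γ(v)} is permutation isomorphic to S_4(6c) and the vertex-stabiliser satisfies |G_v|^{144} ≥ 2^{|V(Γ)|}. (In particular, the permutation group S_4(6c) is of exponential type.) -/
/-- The 4-cycle `(1 2 3 4)` (0-indexed: `(0 1 2 3)`). -/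
def fourCycle : Equiv.Perm (Fin 4) := Equiv.swap 0 3 * Equiv.swap 0 2 * Equiv.swap 0 1

/-- The subgroup `⟨(1 2 3 4)⟩` of `Sym(4)`. -/
def Hc : Subgroup (Equiv.Perm (Fin 4)) := Subgroup.zpowers fourCycle

/-- `S₄(6c)`: the image of `Sym(4)` in the symmetric group on the 6 left cosets of
`⟨(1 2 3 4)⟩`, under the left multiplication action. -/
def S46c : Subgroup (Equiv.Perm (Equiv.Perm (Fin 4) ⧸ Hc)) :=
  (MulAction.toPermHom (Equiv.Perm (Fin 4)) (Equiv.Perm (Fin 4) ⧸ Hc)).range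


/-! ### The finite part: a signed-permutation model of `S₄(6c)` -/

/-- The orientation-preserving signed permutations of three axes. -/
def modelAct (l : ZMod 3) (t : ZMod 2) (φ : ZMod 3 → ZMod 2) (x : ZMod 3 × ZMod 2) :
    ZMod 3 × ZMod 2 :=
  (if t = 0 then l + x.1 else l - x.1, x.2 + φ x.1)

/-- The axis with orientation attached to a permutation of four points
(via the corresponding conjugate of the 4-cycle). -/
def axisLabel (σ : Equiv.Perm (Fin 4)) : ZMod 3 × ZMod 2 :=
  let κ : Fin 4 → Fin 4 := fun i => σ (fourCycle (σ⁻¹ i))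
  (if κ (κ 0) = 1 then 0 else if κ (κ 0) = 2 then 1 else 2,
    if κ (κ 0) = 1 then (if κ 0 = 2 then 0 else 1)
    else if κ (κ 0) = 2 then (if κ 0 = 1 then 0 else 1) else (if κ 0 = 1 then 0 else 1))

theorem mem_Hc_iff (σ : Equiv.Perm (Fin 4)) : σ ∈ Hc ↔ σ * fourCycle = fourCycle * σ := by
  constructor
  · intro h
    obtain ⟨k, rfl⟩ := Subgroup.mem_zpowers_iff.1 h
    exact ((Commute.refl fourCycle).zpow_left k).eq
  · intro h
    have key : ∀ σ : Equiv.Perm (Fin 4), σ * fourCycle = fourCycle * σ →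
        σ = fourCycle ^ 0 ∨ σ = fourCycle ^ 1 ∨ σ = fourCycle ^ 2 ∨ σ = fourCycle ^ 3 := by
      decide +kernel
    rcases key σ h with h | h | h | h <;> rw [h] <;> exact Subgroup.npow_mem_zpowers _ _

theorem axisLabel_eq_iff (σ τ : Equiv.Perm (Fin 4)) :
    axisLabel σ = axisLabel τ ↔ σ⁻¹ * τ ∈ Hc := by
  rw [mem_Hc_iff]
  revert σ τ
  decide +kernel

theorem axisLabel_surj : ∀ x : ZMod 3 × ZMod 2, ∃ σ, axisLabel σ = x := by
  decide +kernel

theorem axisLabel_mul : ∀ σ : Equiv.Perm (Fin 4), ∃ (l : ZMod 3) (t : ZMod 2)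
    (φ : ZMod 3 → ZMod 2), φ 0 + φ 1 + φ 2 = t ∧
    ∀ τ, axisLabel (σ * τ) = modelAct l t φ (axisLabel τ) := by
  decide +kernel

theorem axisLabel_model : ∀ (l : ZMod 3) (t : ZMod 2) (φ : ZMod 3 → ZMod 2),
    φ 0 + φ 1 + φ 2 = t → ∃ σ : Equiv.Perm (Fin 4),
    ∀ τ, axisLabel (σ * τ) = modelAct l t φ (axisLabel τ) := by
  decide +kernel

/-- The bijection between cosets and oriented axes. -/
noncomputable def axisEquiv : (Equiv.Perm (Fin 4) ⧸ Hc) ≃ ZMod 3 × ZMod 2 :=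
  Equiv.ofBijective
    (Quotient.lift axisLabel (fun σ τ h => (axisLabel_eq_iff σ τ).2 (QuotientGroup.leftRel_apply.1 h)))
    (by
      constructor
      · rintro ⟨σ⟩ ⟨τ⟩ h
        exact QuotientGroup.eq.2 ((axisLabel_eq_iff σ τ).1 h)
      · intro x
        obtain ⟨σ, h⟩ := axisLabel_surj x
        exact ⟨(σ : Equiv.Perm (Fin 4) ⧸ Hc), h⟩)

theorem axisEquiv_mk (σ : Equiv.Perm (Fin 4)) :
    axisEquiv (σ : Equiv.Perm (Fin 4) ⧸ Hc) = axisLabel σ := rfl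

theorem mem_S46c_iff (q : Equiv.Perm (Equiv.Perm (Fin 4) ⧸ Hc)) :
    q ∈ S46c ↔ ∃ (l : ZMod 3) (t : ZMod 2) (φ : ZMod 3 → ZMod 2), φ 0 + φ 1 + φ 2 = t ∧
      ∀ x, axisEquiv (q (axisEquiv.symm x)) = modelAct l t φ x := by
  constructor
  · rintro ⟨σ, rfl⟩
    obtain ⟨l, t, φ, h1, h2⟩ := axisLabel_mul σ
    refine ⟨l, t, φ, h1, fun x => ?_⟩
    obtain ⟨ω, rfl⟩ := axisEquiv.surjective x
    rw [Equiv.symm_apply_apply]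
    obtain ⟨τ, rfl⟩ := QuotientGroup.mk_surjective ω
    exact h2 τ
  · rintro ⟨l, t, φ, h1, h2⟩
    obtain ⟨σ, hσ⟩ := axisLabel_model l t φ h1
    refine ⟨σ, ?_⟩
    ext ω
    obtain ⟨τ, rfl⟩ := QuotientGroup.mk_surjective ω
    apply axisEquiv.injective
    have := h2 (axisLabel τ)
    rw [← axisEquiv_mk, Equiv.symm_apply_apply] at this
    refine Eq.trans ?_ this.symm
    exact hσ τ

/-! ### The ring `R[u] / (u⁴ - 2u³ + u - 1)` -/

/-- Elements `w + x u + y u² + z u³` of `R[u] / (u⁴ - 2u³ + u - 1)`. -/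
@[ext]
structure Zu (R : Type) where
  /-- constant coefficient -/
  w : R
  /-- coefficient of `u` -/
  x : R
  /-- coefficient of `u²` -/
  y : R
  /-- coefficient of `u³` -/
  z : R

namespace Zu

variable {R S : Type} [CommRing R] [CommRing S]

instance instDecEq [DecidableEq R] : DecidableEq (Zu R) := fun p q =>
  decidable_of_iff (p.w = q.w ∧ p.x = q.x ∧ p.y = q.y ∧ p.z = q.z)
    (by rw [Zu.ext_iff])

instance : Zero (Zu R) := ⟨⟨0, 0, 0, 0⟩⟩
instance : One (Zu R) := ⟨⟨1, 0, 0, 0⟩⟩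
instance : Add (Zu R) := ⟨fun p q => ⟨p.w + q.w, p.x + q.x, p.y + q.y, p.z + q.z⟩⟩
instance : Neg (Zu R) := ⟨fun p => ⟨-p.w, -p.x, -p.y, -p.z⟩⟩
/-- coefficient of `u⁶` in a product -/
def c6 (p q : Zu R) : R := p.z * q.z
/-- coefficient of `u⁵` in a product, after reducing `u⁶` -/
def c5 (p q : Zu R) : R := p.y * q.z + p.z * q.y + 2 * c6 p q
/-- coefficient of `u⁴` in a product, after reducing `u⁶` and `u⁵` -/
def c4 (p q : Zu R) : R := p.x * q.z + p.y * q.y + p.z * q.x + 2 * c5 p q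
instance : Mul (Zu R) := ⟨fun p q =>
  ⟨p.w * q.w + c4 p q,
   p.w * q.x + p.x * q.w + c5 p q - c4 p q,
   p.w * q.y + p.x * q.x + p.y * q.w + c6 p q - c5 p q,
   p.w * q.z + p.x * q.y + p.y * q.x + p.z * q.w + 2 * c4 p q - c6 p q⟩⟩

@[simp] theorem zero_w : (0 : Zu R).w = 0 := rfl
@[simp] theorem zero_x : (0 : Zu R).x = 0 := rfl
@[simp] theorem zero_y : (0 : Zu R).y = 0 := rfl
@[simp] theorem zero_z : (0 : Zu R).z = 0 := rfl
@[simp] theorem one_w : (1 : Zu R).w = 1 := rfl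
@[simp] theorem one_x : (1 : Zu R).x = 0 := rfl
@[simp] theorem one_y : (1 : Zu R).y = 0 := rfl
@[simp] theorem one_z : (1 : Zu R).z = 0 := rfl
@[simp] theorem add_w (p q : Zu R) : (p + q).w = p.w + q.w := rfl
@[simp] theorem add_x (p q : Zu R) : (p + q).x = p.x + q.x := rfl
@[simp] theorem add_y (p q : Zu R) : (p + q).y = p.y + q.y := rfl
@[simp] theorem add_z (p q : Zu R) : (p + q).z = p.z + q.z := rfl
@[simp] theorem neg_w (p : Zu R) : (-p).w = -p.w := rfl
@[simp] theorem neg_x (p : Zu R) : (-p).x = -p.x := rfl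
@[simp] theorem neg_y (p : Zu R) : (-p).y = -p.y := rfl
@[simp] theorem neg_z (p : Zu R) : (-p).z = -p.z := rfl
theorem mul_w (p q : Zu R) : (p * q).w = p.w * q.w + c4 p q := rfl
theorem mul_x (p q : Zu R) : (p * q).x = p.w * q.x + p.x * q.w + c5 p q - c4 p q := rfl
theorem mul_y (p q : Zu R) :
    (p * q).y = p.w * q.y + p.x * q.x + p.y * q.w + c6 p q - c5 p q := rfl
theorem mul_z (p q : Zu R) :
    (p * q).z = p.w * q.z + p.x * q.y + p.y * q.x + p.z * q.w + 2 * c4 p q - c6 p q := rfl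

instance : CommRing (Zu R) where
  add_assoc p q r := by ext <;> simp <;> ring
  zero_add p := by ext <;> simp
  add_zero p := by ext <;> simp
  add_comm p q := by ext <;> simp <;> ring
  neg_add_cancel p := by ext <;> simp
  mul_assoc p q r := by ext <;> simp only [mul_w, mul_x, mul_y, mul_z, c4, c5, c6] <;> ring
  one_mul p := by ext <;> simp [mul_w, mul_x, mul_y, mul_z, c4, c5, c6]
  mul_one p := by ext <;> simp [mul_w, mul_x, mul_y, mul_z, c4, c5, c6]
  mul_comm p q := by ext <;> simp only [mul_w, mul_x, mul_y, mul_z, c4, c5, c6] <;> ring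
  left_distrib p q r := by
    ext <;> simp only [mul_w, mul_x, mul_y, mul_z, c4, c5, c6, add_w, add_x, add_y, add_z] <;> ring
  right_distrib p q r := by
    ext <;> simp only [mul_w, mul_x, mul_y, mul_z, c4, c5, c6, add_w, add_x, add_y, add_z] <;> ring
  zero_mul p := by ext <;> simp [mul_w, mul_x, mul_y, mul_z, c4, c5, c6]
  mul_zero p := by ext <;> simp [mul_w, mul_x, mul_y, mul_z, c4, c5, c6]
  nsmul := nsmulRec
  zsmul := zsmulRec

/-- Functoriality in the coefficient ring. -/
def map (f : R →+* S) : Zu R →+* Zu S where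
  toFun p := ⟨f p.w, f p.x, f p.y, f p.z⟩
  map_zero' := by ext <;> simp
  map_one' := by ext <;> simp
  map_add' p q := by ext <;> simp
  map_mul' p q := by
    ext <;> simp only [mul_w, mul_x, mul_y, mul_z, c4, c5, c6, map_add, map_sub, map_mul, map_ofNat]

/-- Evaluation at a root of `u⁴ - 2u³ + u - 1`. -/
def eval (f : R →+* S) (u : S) (hu : u ^ 4 = 2 * u ^ 3 - u + 1) : Zu R →+* S where
  toFun p := f p.w + f p.x * u + f p.y * u ^ 2 + f p.z * u ^ 3
  map_zero' := by simp
  map_one' := by simp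
  map_add' p q := by simp; ring
  map_mul' p q := by
    have h5 : u ^ 5 = 2 * u ^ 4 - u ^ 2 + u := by linear_combination u * hu
    have h6 : u ^ 6 = 2 * u ^ 5 - u ^ 3 + u ^ 2 := by linear_combination u ^ 2 * hu
    simp only [mul_w, mul_x, mul_y, mul_z, c4, c5, c6, map_add, map_sub, map_mul, map_ofNat]
    linear_combination (-(f p.z * f q.z)) * h6
      - (f p.y * f q.z + f p.z * f q.y + 2 * (f p.z * f q.z)) * h5
      - (f p.x * f q.z + f p.y * f q.y + f p.z * f q.x
        + 2 * (f p.y * f q.z + f p.z * f q.y + 2 * (f p.z * f q.z))) * hu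

instance [Finite R] : Finite (Zu R) :=
  Finite.of_injective (fun p : Zu R => (p.w, p.x, p.y, p.z)) (by
    intro p q h
    simp only [Prod.mk.injEq] at h
    exact Zu.ext h.1 h.2.1 h.2.2.1 h.2.2.2)

end Zu

/-! ### The three generating reflections -/

/-- 3×3 matrices over `R[u] / (u⁴ - 2u³ + u - 1)` -/
abbrev Mt (R : Type) := Matrix (Fin 3) (Fin 3) (Zu R)

/-- literal matrix -/
def mA : Mt ℤ := !![-1, 1, ⟨2, -1, 0, 0⟩; 0, 1, 0; 0, 0, 1]
/-- literal matrix -/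
def mB : Mt ℤ := !![1, 0, 0; 1, -1, 0; 0, 0, 1]
/-- literal matrix -/
def mC : Mt ℤ := !![1, 0, 0; 0, 1, 0; 1, 0, -1]
/-- literal matrix -/
def mR : Mt ℤ := !![0, -1, ⟨2, -1, 0, 0⟩; 1, -1, 0; 0, 0, 1]
/-- literal matrix -/
def mS : Mt ℤ := !![⟨1, -1, 0, 0⟩, 1, ⟨-2, 1, 0, 0⟩; 0, 1, 0; ⟨0, -1, 0, 0⟩, 1, ⟨-1, 1, 0, 0⟩]
/-- literal matrix -/
def mY : Mt ℤ := !![⟨0, -2, 1, 0⟩, ⟨1, -1, 0, 0⟩, ⟨-2, 3, -1, 0⟩; ⟨1, -1, 0, 0⟩, 0, ⟨-2, 1, 0, 0⟩; ⟨0, -1, 0, 0⟩, 1, ⟨-1, 1, 0, 0⟩]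
/-- literal matrix -/
def mQ : Mt ℤ := !![⟨2, -1, 0, 0⟩, -1, ⟨-2, 1, 0, 0⟩; ⟨1, -1, 0, 0⟩, 0, ⟨-2, 1, 0, 0⟩; ⟨1, -1, 0, 0⟩, -1, ⟨-1, 1, 0, 0⟩]
/-- literal coset representatives -/
def mT : Fin 12 → Mt ℤ := ![
  !![1, 0, 0; 0, 1, 0; 0, 0, 1],
  !![0, -1, ⟨2, -1, 0, 0⟩; 1, -1, 0; 0, 0, 1],
  !![-1, 1, ⟨2, -1, 0, 0⟩; -1, 0, ⟨2, -1, 0, 0⟩; 0, 0, 1],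
  !![⟨-1, -1, 1, 0⟩, ⟨2, -1, 0, 0⟩, ⟨0, 2, -1, 0⟩; ⟨-1, -1, 1, 0⟩, ⟨1, -1, 0, 0⟩, ⟨0, 2, -1, 0⟩; ⟨0, -1, 0, 0⟩, 1, ⟨-1, 1, 0, 0⟩],
  !![⟨2, -1, 0, 0⟩, ⟨-1, 2, -1, 0⟩, ⟨-2, 1, 2, -1⟩; ⟨1, -1, 0, 0⟩, ⟨0, 2, -1, 0⟩, ⟨-2, 1, 2, -1⟩; 1, ⟨-1, 1, 0, 0⟩, ⟨-1, -1, 1, 0⟩],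
  !![⟨-1, 2, -1, 0⟩, ⟨-1, -1, 1, 0⟩, ⟨2, -3, 3, -1⟩; ⟨0, 2, -1, 0⟩, ⟨-1, -1, 1, 0⟩, ⟨0, -2, 3, -1⟩; ⟨-1, 1, 0, 0⟩, ⟨0, -1, 0, 0⟩, ⟨1, -2, 1, 0⟩],
  !![⟨3, -2, 0, 0⟩, ⟨-1, 2, 1, -1⟩, ⟨-3, 2, -2, 1⟩; ⟨2, -1, 0, 0⟩, ⟨-1, 2, 1, -1⟩, ⟨-1, 1, -2, 1⟩; ⟨1, 0, 1, -1⟩, ⟨-1, 0, 1, 0⟩, ⟨-1, 1, -2, 1⟩],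
  !![0, ⟨0, -2, 3, -1⟩, ⟨-1, 1, -2, 1⟩; ⟨1, 1, -1, 0⟩, ⟨-1, -1, 3, -1⟩, ⟨-1, -1, -1, 1⟩; ⟨-1, 1, 1, -1⟩, ⟨0, -2, 1, 0⟩, ⟨1, 0, -2, 1⟩],
  !![⟨0, -2, 3, -1⟩, ⟨0, 2, -3, 1⟩, ⟨-1, 1, -2, 1⟩; ⟨-1, -1, 3, -1⟩, ⟨0, 0, -2, 1⟩, ⟨1, 0, -4, 2⟩; ⟨0, -2, 1, 0⟩, ⟨1, 1, -2, 1⟩, ⟨0, 2, -1, 0⟩],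
  !![⟨0, -1, 4, -2⟩, ⟨-1, 1, -2, 1⟩, ⟨1, 2, -5, 2⟩; ⟨-2, 0, 4, -2⟩, ⟨0, -1, -3, 2⟩, ⟨2, 1, -3, 1⟩; ⟨0, -2, 1, 0⟩, ⟨1, 1, -2, 1⟩, ⟨0, 2, -1, 0⟩],
  !![⟨-1, 1, -2, 1⟩, ⟨1, 0, -2, 1⟩, ⟨3, -2, 4, -2⟩; ⟨0, -1, -3, 2⟩, ⟨2, 1, -1, 0⟩, ⟨0, 1, 5, -3⟩; ⟨1, 1, -2, 1⟩, ⟨-1, 1, 1, -1⟩, ⟨0, -2, 3, -1⟩],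
  !![⟨1, 0, -2, 1⟩, ⟨0, -1, 4, -2⟩, ⟨0, 2, -1, 0⟩; ⟨2, 1, -1, 0⟩, ⟨-2, 0, 4, -2⟩, ⟨-2, 1, 0, 0⟩; ⟨-1, 1, 1, -1⟩, ⟨0, -2, 1, 0⟩, ⟨1, 0, -2, 1⟩]]

theorem mA_sq : mA * mA = 1 := by decide +kernel
theorem mB_sq : mB * mB = 1 := by decide +kernel
theorem mC_sq : mC * mC = 1 := by decide +kernel
theorem mAB : mA * mB = mR := by decide +kernel
theorem mCAC : mC * (mA * mC) = mS := by decide +kernel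
theorem mBC : mB * mC = mC * mB := by decide +kernel
theorem mRS : mR * mS = mY := by decide +kernel
theorem mBSB : mB * (mS * mB) = mQ := by decide +kernel
theorem mR_cube : mR * (mR * mR) = 1 := by decide +kernel
theorem mY5 : mY * ((mY * mY) * (mY * mY)) = -1 := by decide +kernel
theorem mT0 : mT 0 = 1 := by decide +kernel
theorem mT1 : mT 0 * mR = mT 1 := by decide +kernel
theorem mT2 : mT 1 * mR = mT 2 := by decide +kernel
theorem mT3 : mT 2 * mS = mT 3 := by decide +kernel
theorem mT4 : mT 3 * mR = mT 4 := by decide +kernel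
theorem mT5 : mT 4 * mR = mT 5 := by decide +kernel
theorem mT6 : mT 4 * mS = mT 6 := by decide +kernel
theorem mT7 : mT 5 * mS = mT 7 := by decide +kernel
theorem mT8 : mT 7 * mR = mT 8 := by decide +kernel
theorem mT9 : mT 8 * mS = mT 9 := by decide +kernel
theorem mT10 : mT 9 * mR = mT 10 := by decide +kernel
theorem mT11 : mT 10 * mR = mT 11 := by decide +kernel
theorem mT6R : mT 6 * mR = -(mY * mT 7) := by decide +kernel
theorem mT10S : mT 10 * mS = mY * mT 11 := by decide +kernel
theorem mT_comm : ∀ j, mT j * mQ * mY ≠ mY * (mT j * mQ) := by decide +kernel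

/-! ### The element `AC` has infinite order -/

theorem mAC_eig {K : Type} [Field K] (f : ℤ →+* K) (u l : K) (hu : u ^ 4 = 2 * u ^ 3 - u + 1)
    (hl : l ^ 2 + u * l + 1 = 0) :
    ((Zu.eval f u hu).mapMatrix (mA * mC)).mulVec ![1 + l, 0, 1] = l • ![1 + l, 0, 1] := by
  have h : mA * mC = !![⟨1, -1, 0, 0⟩, 1, ⟨-2, 1, 0, 0⟩; 0, 1, 0; 1, 0, -1] := by decide +kernel
  rw [h]
  ext i
  fin_cases i
  · simp [Matrix.mulVec, dotProduct, Fin.sum_univ_three, Zu.eval]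
    linear_combination (-1 : K) * hl
  · simp [Matrix.mulVec, dotProduct, Fin.sum_univ_three, Zu.eval]
  · simp [Matrix.mulVec, dotProduct, Fin.sum_univ_three, Zu.eval]

theorem mAC_pow_ne (k : ℕ) (hk : 0 < k) : (mA * mC) ^ k ≠ 1 := by
  intro hW
  obtain ⟨h, hh⟩ : ∃ h : ℝ, h ^ 2 = (Real.sqrt 5 - 1) / 2 - 1 / 4 ∧ h ≠ 0 := by
    have h5 : (2 : ℝ) < Real.sqrt 5 := by
      rw [Real.lt_sqrt (by norm_num)]; norm_num
    have hp : (0 : ℝ) < (Real.sqrt 5 - 1) / 2 - 1 / 4 := by linarith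
    exact ⟨Real.sqrt ((Real.sqrt 5 - 1) / 2 - 1 / 4), Real.sq_sqrt hp.le,
      (Real.sqrt_pos.mpr hp).ne'⟩
  obtain ⟨hh, hh0⟩ := hh
  set u : ℂ := 1 / 2 + (h : ℂ) * Complex.I with hudef
  have h5 : ((Real.sqrt 5 : ℝ) : ℂ) ^ 2 = 5 := by
    rw [← Complex.ofReal_pow, Real.sq_sqrt (by norm_num)]; norm_num
  have hhc : (h : ℂ) ^ 2 = ((Real.sqrt 5 : ℝ) - 1) / 2 - 1 / 4 := by
    rw [← Complex.ofReal_pow, hh]; push_cast; ring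
  have hq : u ^ 2 - u = (1 - (Real.sqrt 5 : ℝ)) / 2 := by
    rw [hudef]
    linear_combination (-1 : ℂ) * hhc + (h : ℂ) ^ 2 * Complex.I_sq
  have hu : u ^ 4 = 2 * u ^ 3 - u + 1 := by
    linear_combination (u ^ 2 - u - 1 + (1 - (Real.sqrt 5 : ℝ)) / 2) * hq + (1 / 4 : ℂ) * h5
  obtain ⟨d, hd⟩ := IsAlgClosed.exists_pow_nat_eq (u ^ 2 - 4) (n := 2) (by norm_num)
  set l : ℂ := (-u + d) / 2 with hldef
  have hl : l ^ 2 + u * l + 1 = 0 := by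
    rw [hldef]; linear_combination (1 / 4 : ℂ) * hd
  have hv := mAC_eig (Int.castRingHom ℂ) u l hu hl
  have hpow : ∀ k : ℕ, ((Zu.eval (Int.castRingHom ℂ) u hu).mapMatrix ((mA * mC) ^ k)).mulVec
      ![1 + l, 0, 1] = l ^ k • ![1 + l, 0, 1] := by
    intro k
    induction k with
    | zero => simp
    | succ k ih =>
      rw [pow_succ, map_mul, ← Matrix.mulVec_mulVec, hv, Matrix.mulVec_smul, ih, smul_smul,
        pow_succ, mul_comm]
  have h1 := congrFun (hpow k) 2
  rw [hW] at h1
  have hlk : l ^ k = 1 := by simpa using h1.symm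
  have hn : ‖l‖ = 1 := by
    have := congrArg norm hlk
    rw [norm_pow, norm_one] at this
    exact (pow_eq_one_iff_of_nonneg (norm_nonneg _) hk.ne').mp this
  have hc : (starRingEnd ℂ) l * l = 1 := by
    rw [mul_comm, Complex.mul_conj, Complex.normSq_eq_norm_sq, hn]; norm_num
  have hl0 : l ≠ 0 := by
    intro h0; rw [h0] at hn; simp at hn
  have hu2 : u = -(l + (starRingEnd ℂ) l) := by
    apply mul_right_cancel₀ hl0
    linear_combination hl + hc
  have him := congrArg Complex.im hu2
  rw [hudef] at him
  simp at him
  exact hh0 him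

/-! ### Coset enumeration in `⟨r, s⟩` -/

section Enumeration
variable {H : Type*} [Group H]

/-- Twelve coset representatives as words in `r`, `s`. -/
def tw {H : Type*} [Monoid H] (r s : H) : Fin 12 → H :=
  ![1, r, r * r, r * r * s, r * r * s * r, r * r * s * r * r, r * r * s * r * s,
    r * r * s * r * r * s, r * r * s * r * r * s * r, r * r * s * r * r * s * r * s,
    r * r * s * r * r * s * r * s * r, r * r * s * r * r * s * r * s * r * r]

theorem tw_map {M N : Type*} [Monoid M] [Monoid N] (f : M →* N) (r s : M) (j : Fin 12) :
    f (tw r s j) = tw (f r) (f s) j := by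
  fin_cases j <;> simp [tw]

theorem tw_r (r s : H) (hr : r * (r * r) = 1) (hy : (r * s) ^ 10 = 1)
    (h6 : tw r s 6 * r = (r * s) ^ 6 * tw r s 7) (j : Fin 12) :
    ∃ (e : ℕ) (k : Fin 12), tw r s j * r = (r * s) ^ e * tw r s k := by
  have hcan : ∀ x : H, x * r * r * r = x := fun x => by
    rw [mul_assoc, mul_assoc, hr, mul_one]
  have h8 : tw r s 8 * r = (r * s) ^ 4 * tw r s 6 := by
    have h : tw r s 6 * r * r * r = (r * s) ^ 6 * (tw r s 8 * r) := by
      rw [h6, mul_assoc, mul_assoc]; congr 1; simp [tw, mul_assoc]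
    rw [hcan] at h
    rw [h, ← mul_assoc, ← pow_add, hy, one_mul]
  fin_cases j
  · exact ⟨0, 1, by simp [tw]⟩
  · exact ⟨0, 2, by simp [tw]⟩
  · exact ⟨0, 0, by simp [tw, mul_assoc, hr]⟩
  · exact ⟨0, 4, by simp [tw]⟩
  · exact ⟨0, 5, by simp [tw]⟩
  · exact ⟨0, 3, by simpa [tw] using hcan _⟩
  · exact ⟨6, 7, h6⟩
  · exact ⟨0, 8, by simp [tw]⟩
  · exact ⟨4, 6, h8⟩
  · exact ⟨0, 10, by simp [tw]⟩
  · exact ⟨0, 11, by simp [tw]⟩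
  · exact ⟨0, 9, by simpa [tw] using hcan _⟩

theorem tw_s (r s : H) (hs : s * s = 1) (hy : (r * s) ^ 10 = 1)
    (h10 : tw r s 10 * s = (r * s) * tw r s 11) (j : Fin 12) :
    ∃ (e : ℕ) (k : Fin 12), tw r s j * s = (r * s) ^ e * tw r s k := by
  have hcan : ∀ x : H, x * s * s = x := fun x => by rw [mul_assoc, hs, mul_one]
  have hy' : (r * s) ^ 9 * (r * s) = 1 := by rw [← pow_succ, hy]
  have h11 : tw r s 11 * s = (r * s) ^ 9 * tw r s 10 := by
    have h : tw r s 10 * s * s = (r * s) * (tw r s 11 * s) := by rw [h10, mul_assoc]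
    rw [hcan] at h
    rw [h, ← mul_assoc, hy', one_mul]
  have h0 : s = (r * s) ^ 9 * r := by
    have h : (r * s) ^ 9 * (r * s) * s = s := by rw [hy', one_mul]
    rw [mul_assoc, mul_assoc, hs, mul_one] at h
    exact h.symm
  fin_cases j
  · exact ⟨9, 1, by simpa [tw] using h0⟩
  · exact ⟨1, 0, by simp [tw]⟩
  · exact ⟨0, 3, by simp [tw]⟩
  · exact ⟨0, 2, by simpa [tw] using hcan _⟩
  · exact ⟨0, 6, by simp [tw]⟩
  · exact ⟨0, 7, by simp [tw]⟩
  · exact ⟨0, 4, by simpa [tw] using hcan _⟩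
  · exact ⟨0, 5, by simpa [tw] using hcan _⟩
  · exact ⟨0, 9, by simp [tw]⟩
  · exact ⟨0, 8, by simpa [tw] using hcan _⟩
  · exact ⟨1, 11, by simpa using h10⟩
  · exact ⟨9, 10, h11⟩

theorem closure_form (r s : H) (hr : r * (r * r) = 1) (hs : s * s = 1) (hy : (r * s) ^ 10 = 1)
    (h6 : tw r s 6 * r = (r * s) ^ 6 * tw r s 7)
    (h10 : tw r s 10 * s = (r * s) * tw r s 11) (g : H) (hg : g ∈ Subgroup.closure {r, s}) :
    ∃ p : Fin 10 × Fin 12, g = (r * s) ^ (p.1 : ℕ) * tw r s p.2 := by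
  suffices h : ∃ (e : ℕ) (k : Fin 12), g = (r * s) ^ e * tw r s k by
    obtain ⟨e, k, rfl⟩ := h
    refine ⟨(⟨e % 10, Nat.mod_lt _ (by norm_num)⟩, k), ?_⟩
    simp only
    congr 1
    conv_lhs => rw [← Nat.mod_add_div e 10]
    rw [pow_add, pow_mul, hy, one_pow, mul_one]
  have stepr : ∀ g : H, (∃ (e : ℕ) (k : Fin 12), g = (r * s) ^ e * tw r s k) →
      ∃ (e : ℕ) (k : Fin 12), g * r = (r * s) ^ e * tw r s k := by
    rintro g ⟨e, k, rfl⟩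
    obtain ⟨e', k', h⟩ := tw_r r s hr hy h6 k
    exact ⟨e + e', k', by rw [mul_assoc, h, ← mul_assoc, pow_add]⟩
  have steps : ∀ g : H, (∃ (e : ℕ) (k : Fin 12), g = (r * s) ^ e * tw r s k) →
      ∃ (e : ℕ) (k : Fin 12), g * s = (r * s) ^ e * tw r s k := by
    rintro g ⟨e, k, rfl⟩
    obtain ⟨e', k', h⟩ := tw_s r s hs hy h10 k
    exact ⟨e + e', k', by rw [mul_assoc, h, ← mul_assoc, pow_add]⟩
  have hri : r⁻¹ = r * r := inv_eq_of_mul_eq_one_right hr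
  have hsi : s⁻¹ = s := inv_eq_of_mul_eq_one_right hs
  induction hg using Subgroup.closure_induction_right with
  | one => exact ⟨0, 0, by simp [tw]⟩
  | mul_right x hx y hy ih =>
    rcases hy with rfl | rfl
    · exact stepr _ ih
    · exact steps _ ih
  | mul_inv_cancel x hx y hy ih =>
    rcases hy with rfl | rfl
    · rw [hri, ← mul_assoc]; exact stepr _ (stepr _ ih)
    · rw [hsi]; exact steps _ ih

theorem card_closure_le (r s : H) (hr : r * (r * r) = 1) (hs : s * s = 1)
    (hy : (r * s) ^ 10 = 1) (h6 : tw r s 6 * r = (r * s) ^ 6 * tw r s 7)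
    (h10 : tw r s 10 * s = (r * s) * tw r s 11) :
    Nat.card (Subgroup.closure {r, s}) ≤ 120 := by
  choose p hp using fun g : Subgroup.closure {r, s} =>
    closure_form r s hr hs hy h6 h10 g.1 g.2
  have hinj : Function.Injective p := fun g g' h => by
    apply Subtype.ext; rw [hp g, hp g', h]
  refine (Nat.card_le_card_of_injective p hinj).trans ?_
  simp

theorem not_mem_closure (r s q : H) (hr : r * (r * r) = 1) (hs : s * s = 1)
    (hy : (r * s) ^ 10 = 1) (h6 : tw r s 6 * r = (r * s) ^ 6 * tw r s 7)
    (h10 : tw r s 10 * s = (r * s) * tw r s 11) (hq : q * q = 1)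
    (hc : ∀ j, tw r s j * q * (r * s) ≠ (r * s) * (tw r s j * q)) :
    q ∉ Subgroup.closure {r, s} := by
  intro hm
  obtain ⟨⟨e, j⟩, h⟩ := closure_form r s hr hs hy h6 h10 q hm
  apply hc j
  simp only at h
  have h1 : tw r s j * q = ((r * s) ^ (e : ℕ))⁻¹ := by
    rw [eq_inv_iff_mul_eq_one, ← mul_eq_one_comm.eq, ← mul_assoc, ← h, hq]
  rw [h1]
  exact ((Commute.refl (r * s)).pow_left _).inv_left.eq

end Enumeration

/-! ### The finite groups -/

/-- The finite data from which the graph is built. -/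
structure CData (H : Type) [Group H] where
  /-- first generator -/
  a : H
  /-- second generator -/
  b : H
  /-- third generator -/
  c : H
  haa : a * a = 1
  hbb : b * b = 1
  hcc : c * c = 1
  hab : a * b * (a * b * (a * b)) = 1
  hbc : b * c = c * b
  gen : Subgroup.closure {a, b, c} = ⊤
  /-- the sign of all generators -/
  ε : H →* Multiplicative (ZMod 2)
  /-- the parity of the number of letters `c` -/
  β : H →* Multiplicative (ZMod 2)
  εa : ε a = Multiplicative.ofAdd 1
  εb : ε b = Multiplicative.ofAdd 1
  εc : ε c = Multiplicative.ofAdd 1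
  βa : β a = 1
  βb : β b = 1
  βc : β c = Multiplicative.ofAdd 1
  /-- a small subgroup -/
  L : Subgroup H
  hrL : a * b ∈ L
  hsL : c * (a * c) ∈ L
  hβL : ∀ g ∈ L, β g = 1
  cardL : Nat.card L ≤ 120
  hq : b * (c * (a * c) * b) ∉ L

theorem tw_mT (j : Fin 12) : tw mR mS j = mT j := by
  have h0 : tw mR mS 0 = mT 0 := by rw [mT0]; rfl
  have h1 : tw mR mS 1 = mT 1 := by rw [← mT1, mT0, one_mul]; rfl
  have h2 : tw mR mS 2 = mT 2 := by rw [← mT2, ← h1]; rfl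
  have h3 : tw mR mS 3 = mT 3 := by rw [← mT3, ← h2]; rfl
  have h4 : tw mR mS 4 = mT 4 := by rw [← mT4, ← h3]; rfl
  have h5 : tw mR mS 5 = mT 5 := by rw [← mT5, ← h4]; rfl
  have h6 : tw mR mS 6 = mT 6 := by rw [← mT6, ← h4]; rfl
  have h7 : tw mR mS 7 = mT 7 := by rw [← mT7, ← h5]; rfl
  have h8 : tw mR mS 8 = mT 8 := by rw [← mT8, ← h7]; rfl
  have h9 : tw mR mS 9 = mT 9 := by rw [← mT9, ← h8]; rfl
  have h10 : tw mR mS 10 = mT 10 := by rw [← mT10, ← h9]; rfl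
  have h11 : tw mR mS 11 = mT 11 := by rw [← mT11, ← h10]; rfl
  fin_cases j
  exacts [h0, h1, h2, h3, h4, h5, h6, h7, h8, h9, h10, h11]

/-- Reduction modulo `n`. -/
def red (n : ℕ) : Mt ℤ →+* Mt (ZMod n) := (Zu.map (Int.castRingHom (ZMod n))).mapMatrix

theorem Zu.exists_coord (p : Zu ℤ) (hp : p ≠ 0) : ∃ z : ℤ, z ≠ 0 ∧
    ∀ n : ℕ, Zu.map (Int.castRingHom (ZMod n)) p = 0 → (n : ℤ) ∣ z := by
  by_cases hw : p.w = 0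
  · by_cases hx : p.x = 0
    · by_cases hy : p.y = 0
      · refine ⟨p.z, fun hz => hp (Zu.ext hw hx hy hz), fun n h => ?_⟩
        exact (ZMod.intCast_zmod_eq_zero_iff_dvd _ _).mp (congrArg Zu.z h)
      · exact ⟨p.y, hy, fun n h => (ZMod.intCast_zmod_eq_zero_iff_dvd _ _).mp (congrArg Zu.y h)⟩
    · exact ⟨p.x, hx, fun n h => (ZMod.intCast_zmod_eq_zero_iff_dvd _ _).mp (congrArg Zu.x h)⟩
  · exact ⟨p.w, hw, fun n h => (ZMod.intCast_zmod_eq_zero_iff_dvd _ _).mp (congrArg Zu.w h)⟩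

theorem exists_coord (M : Mt ℤ) (hM : M ≠ 0) : ∃ z : ℤ, z ≠ 0 ∧
    ∀ n : ℕ, red n M = 0 → (n : ℤ) ∣ z := by
  obtain ⟨i, j, hij⟩ : ∃ i j, M i j ≠ 0 := by
    by_contra! h
    exact hM (Matrix.ext h)
  obtain ⟨z, hz, h⟩ := Zu.exists_coord _ hij
  exact ⟨z, hz, fun n hn => h n (congrFun (congrFun hn i) j)⟩

theorem exists_modulus {ι : Type} [Fintype ι] (F : ι → Mt ℤ) (hF : ∀ i, F i ≠ 0) :
    ∃ n : ℕ, 0 < n ∧ ∀ i, red n (F i) ≠ 0 := by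
  choose z hz hd using fun i => exists_coord (F i) (hF i)
  refine ⟨1 + ∑ i, (z i).natAbs, by omega, fun i h => ?_⟩
  have h1 := Nat.le_of_dvd (Int.natAbs_pos.mpr (hz i)) (Int.natCast_dvd.mp (hd i _ h))
  have h2 : (z i).natAbs ≤ ∑ i, (z i).natAbs :=
    Finset.single_le_sum (f := fun i => (z i).natAbs) (fun _ _ => Nat.zero_le _)
      (Finset.mem_univ i)
  omega

/-- The ambient group. -/
abbrev Amb (n : ℕ) := (Mt (ZMod n))ˣ × Multiplicative (ZMod 2) × Multiplicative (ZMod 2)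

/-- A generator of the group. -/
def mkGen (n : ℕ) (M : Mt ℤ) (h : M * M = 1) (t : ZMod 2) : Amb n :=
  (⟨red n M, red n M, by rw [← map_mul, h, map_one], by rw [← map_mul, h, map_one]⟩,
    Multiplicative.ofAdd 1, Multiplicative.ofAdd t)

/-- first generator -/
def gA (n : ℕ) : Amb n := mkGen n mA mA_sq 0
/-- second generator -/
def gB (n : ℕ) : Amb n := mkGen n mB mB_sq 0
/-- third generator -/
def gC (n : ℕ) : Amb n := mkGen n mC mC_sq 1

/-- The finite group generated by the reflections. -/
abbrev Hn (n : ℕ) : Subgroup (Amb n) := Subgroup.closure {gA n, gB n, gC n}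

/-- matrix part -/
def pr (n : ℕ) : Hn n →* Mt (ZMod n) :=
  ((Units.coeHom _).comp (MonoidHom.fst _ _)).comp (Hn n).subtype
/-- signs -/
def sg (n : ℕ) : Hn n →* Multiplicative (ZMod 2) × Multiplicative (ZMod 2) :=
  (MonoidHom.snd _ _).comp (Hn n).subtype

theorem Hn_ext {n : ℕ} {x y : Hn n} (h1 : pr n x = pr n y) (h2 : sg n x = sg n y) : x = y :=
  Subtype.ext (Prod.ext (Units.ext h1) h2)

/-- first generator -/
def hA (n : ℕ) : Hn n := ⟨gA n, Subgroup.subset_closure (by simp)⟩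
/-- second generator -/
def hB (n : ℕ) : Hn n := ⟨gB n, Subgroup.subset_closure (by simp)⟩
/-- third generator -/
def hC (n : ℕ) : Hn n := ⟨gC n, Subgroup.subset_closure (by simp)⟩

theorem pr_A (n : ℕ) : pr n (hA n) = red n mA := rfl
theorem pr_B (n : ℕ) : pr n (hB n) = red n mB := rfl
theorem pr_C (n : ℕ) : pr n (hC n) = red n mC := rfl
theorem sg_A (n : ℕ) : sg n (hA n) = (Multiplicative.ofAdd 1, Multiplicative.ofAdd 0) := rfl
theorem sg_B (n : ℕ) : sg n (hB n) = (Multiplicative.ofAdd 1, Multiplicative.ofAdd 0) := rfl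
theorem sg_C (n : ℕ) : sg n (hC n) = (Multiplicative.ofAdd 1, Multiplicative.ofAdd 1) := rfl

/-- the rotation `ab` -/
def hR (n : ℕ) : Hn n := hA n * hB n
/-- the conjugate `cac` -/
def hS (n : ℕ) : Hn n := hC n * (hA n * hC n)
theorem pr_R (n : ℕ) : pr n (hR n) = red n mR := by
  rw [hR, map_mul, pr_A, pr_B, ← map_mul, mAB]
theorem pr_S (n : ℕ) : pr n (hS n) = red n mS := by
  rw [hS, map_mul, map_mul, pr_A, pr_C, ← map_mul, ← map_mul, mCAC]
theorem sg_R (n : ℕ) : sg n (hR n) = 1 := by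
  rw [hR, map_mul, sg_A, sg_B]; decide
theorem sg_S (n : ℕ) : sg n (hS n) = (Multiplicative.ofAdd 1, Multiplicative.ofAdd 0) := by
  rw [hS, map_mul, map_mul, sg_A, sg_C]; decide
theorem pr_RS (n : ℕ) : pr n (hR n * hS n) = red n mY := by
  rw [map_mul, pr_R, pr_S, ← map_mul, mRS]
theorem sg_RS (n : ℕ) : sg n (hR n * hS n) = (Multiplicative.ofAdd 1, Multiplicative.ofAdd 0) := by
  rw [map_mul, sg_R, sg_S, one_mul]
theorem pr_tw (n : ℕ) (j : Fin 12) : pr n (tw (hR n) (hS n) j) = red n (mT j) := by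
  rw [tw_map, pr_R, pr_S, ← tw_mT]
  exact (tw_map (red n : Mt ℤ →* Mt (ZMod n)) mR mS j).symm
theorem sg_tw (n : ℕ) (j : Fin 12) : sg n (tw (hR n) (hS n) j) =
    tw 1 (Multiplicative.ofAdd 1, Multiplicative.ofAdd 0) j := by
  rw [tw_map, sg_R, sg_S]

theorem hR_cube (n : ℕ) : hR n * (hR n * hR n) = 1 := by
  apply Hn_ext
  · rw [map_mul, map_mul, pr_R, map_one, ← map_mul, ← map_mul, mR_cube, map_one]
  · rw [map_mul, map_mul, sg_R, map_one]; rfl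

theorem hA_sq (n : ℕ) : hA n * hA n = 1 := by
  apply Hn_ext
  · rw [map_mul, pr_A, ← map_mul, mA_sq, map_one, map_one]
  · rw [map_mul, sg_A, map_one (sg n)]; decide
theorem hB_sq (n : ℕ) : hB n * hB n = 1 := by
  apply Hn_ext
  · rw [map_mul, pr_B, ← map_mul, mB_sq, map_one, map_one]
  · rw [map_mul, sg_B, map_one (sg n)]; decide
theorem hC_sq (n : ℕ) : hC n * hC n = 1 := by
  apply Hn_ext
  · rw [map_mul, pr_C, ← map_mul, mC_sq, map_one, map_one]
  · rw [map_mul, sg_C, map_one (sg n)]; decide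
theorem hBC (n : ℕ) : hB n * hC n = hC n * hB n := by
  apply Hn_ext
  · rw [map_mul, map_mul, pr_C, pr_B, ← map_mul, mBC, map_mul]
  · rw [map_mul, map_mul, mul_comm]
theorem hS_sq (n : ℕ) : hS n * hS n = 1 := by
  rw [hS]
  calc hC n * (hA n * hC n) * (hC n * (hA n * hC n))
      = hC n * (hA n * (hC n * hC n) * hA n) * hC n := by simp only [mul_assoc]
    _ = 1 := by rw [hC_sq, mul_one, hA_sq, mul_one, hC_sq]

theorem mY_pow5 : mY ^ 5 = -1 := by
  rw [← mY5]; noncomm_ring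

theorem hY10 (n : ℕ) : (hR n * hS n) ^ 10 = 1 := by
  apply Hn_ext
  · rw [map_pow, pr_RS, map_one, ← map_pow, show 10 = 5 * 2 from rfl, pow_mul, mY_pow5]
    simp
  · rw [map_pow, sg_RS, map_one (sg n)]; decide

theorem hT6 (n : ℕ) : tw (hR n) (hS n) 6 * hR n = (hR n * hS n) ^ 6 * tw (hR n) (hS n) 7 := by
  apply Hn_ext
  · rw [map_mul, map_mul, map_pow, pr_tw, pr_tw, pr_RS, pr_R, ← map_mul, mT6R, ← map_pow,
      ← map_mul, pow_succ, mY_pow5]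
    simp
  · rw [map_mul, map_mul, map_pow, sg_tw, sg_tw, sg_RS, sg_R]; decide

theorem hT10 (n : ℕ) : tw (hR n) (hS n) 10 * hS n = (hR n * hS n) * tw (hR n) (hS n) 11 := by
  apply Hn_ext
  · rw [map_mul, map_mul, pr_tw, pr_tw, pr_RS, pr_S, ← map_mul, mT10S, ← map_mul]
  · rw [map_mul, map_mul, sg_tw, sg_tw, sg_RS, sg_S]; decide

theorem hQ_not_mem (n : ℕ) (hn : ∀ j, red n (mT j * mQ * mY - mY * (mT j * mQ)) ≠ 0) :
    hB n * (hS n * hB n) ∉ Subgroup.closure {hR n, hS n} := by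
  apply not_mem_closure _ _ _ (hR_cube n) (hS_sq n) (hY10 n) (hT6 n) (hT10 n)
  · calc hB n * (hS n * hB n) * (hB n * (hS n * hB n))
      = hB n * (hS n * (hB n * hB n) * hS n) * hB n := by simp only [mul_assoc]
    _ = 1 := by rw [hB_sq, mul_one, hS_sq, mul_one, hB_sq]
  · intro j h
    apply hn j
    have h1 := congrArg (pr n) h
    have h2 : pr n (hB n * (hS n * hB n)) = red n mQ := by
      rw [map_mul, map_mul, pr_B, pr_S, ← map_mul, ← map_mul, mBSB]
    rw [map_mul, map_mul, map_mul (pr n) (hR n * hS n), map_mul (pr n) (tw _ _ _), pr_tw, h2,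
      pr_RS] at h1
    rw [map_sub, map_mul, map_mul, map_mul, map_mul, h1, sub_self]

/-- The data provided by a suitable modulus. -/
def theData (n : ℕ) (hn : ∀ j, red n (mT j * mQ * mY - mY * (mT j * mQ)) ≠ 0) :
    CData (Hn n) where
  a := hA n
  b := hB n
  c := hC n
  haa := hA_sq n
  hbb := hB_sq n
  hcc := hC_sq n
  hab := hR_cube n
  hbc := hBC n
  gen := by
    have h := Subgroup.closure_closure_coe_preimage (k := ({gA n, gB n, gC n} : Set (Amb n)))
    rw [← h]
    congr 1
    ext x
    simp only [Set.mem_insert_iff, Set.mem_singleton_iff, Set.mem_preimage, Subtype.ext_iff]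
    rfl
  ε := (MonoidHom.fst _ _).comp (sg n)
  β := (MonoidHom.snd _ _).comp (sg n)
  εa := rfl
  εb := rfl
  εc := rfl
  βa := rfl
  βb := rfl
  βc := rfl
  L := Subgroup.closure {hR n, hS n}
  hrL := Subgroup.subset_closure (Or.inl rfl)
  hsL := Subgroup.subset_closure (Or.inr rfl)
  hβL := by
    intro g hg
    have h : Subgroup.closure {hR n, hS n} ≤ ((MonoidHom.snd _ _).comp (sg n)).ker := by
      rw [Subgroup.closure_le]
      rintro x (rfl | rfl)
      · simp [MonoidHom.mem_ker, sg_R]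
      · simp [MonoidHom.mem_ker, sg_S]
    exact h hg
  cardL := card_closure_le _ _ (hR_cube n) (hS_sq n) (hY10 n) (hT6 n) (hT10 n)
  hq := hQ_not_mem n hn

theorem exists_data (K : ℕ) : ∃ (H : Type) (_ : Group H) (_ : Finite H) (_ : CData H),
    K < Nat.card H := by
  obtain ⟨n, hn, hF⟩ := exists_modulus (ι := Fin 12 ⊕ Fin K)
    (Sum.elim (fun j => mT j * mQ * mY - mY * (mT j * mQ)) (fun k => (mA * mC) ^ (k.1 + 1) - 1)) (by
      rintro (j | k)
      · exact sub_ne_zero.mpr (mT_comm j)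
      · exact sub_ne_zero.mpr (mAC_pow_ne _ (Nat.succ_pos _)))
  have : NeZero n := ⟨hn.ne'⟩
  have : Finite (Mt (ZMod n)) := inferInstanceAs (Finite (Fin 3 → Fin 3 → Zu (ZMod n)))
  have : Finite (Multiplicative (ZMod 2)) := inferInstanceAs (Finite (ZMod 2))
  have : Finite (Amb n) := inferInstance
  refine ⟨Hn n, inferInstance, inferInstance, theData n fun j => hF (Sum.inl j), ?_⟩
  by_contra! hK
  have hpos : 0 < Nat.card (Hn n) := Nat.card_pos
  have h1 := hF (Sum.inr ⟨Nat.card (Hn n) - 1, by omega⟩)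
  apply h1
  have h2 := congrArg (pr n) (pow_card_eq_one' (x := hA n * hC n))
  rw [map_pow, map_mul, pr_A, pr_C, map_one] at h2
  simp only [Sum.elim_inr]
  rw [Nat.sub_add_cancel hpos, map_sub, map_pow, map_mul, h2, map_one, sub_self]

/-! ### Algebra inside the finite group -/

namespace CData
variable {H : Type} [Group H] (D : CData H)

/-- the rotation `ab` -/
def r : H := D.a * D.b

theorem r_cube : D.r * (D.r * D.r) = 1 := D.hab
theorem r_cube' (x : H) : D.r * (D.r * (D.r * x)) = x := by
  rw [← mul_assoc D.r D.r, ← mul_assoc, mul_assoc D.r D.r D.r, r_cube, one_mul]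
theorem bb' (x : H) : D.b * (D.b * x) = x := by rw [← mul_assoc, D.hbb, one_mul]
theorem cc' (x : H) : D.c * (D.c * x) = x := by rw [← mul_assoc, D.hcc, one_mul]
theorem binv : D.b⁻¹ = D.b := inv_eq_of_mul_eq_one_right D.hbb
theorem ainv : D.a⁻¹ = D.a := inv_eq_of_mul_eq_one_right D.haa
theorem cinv : D.c⁻¹ = D.c := inv_eq_of_mul_eq_one_right D.hcc
theorem rinv : D.r⁻¹ = D.r * D.r := inv_eq_of_mul_eq_one_right D.r_cube
theorem a_eq : D.a = D.r * D.b := by rw [r, mul_assoc, D.hbb, mul_one]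
theorem r_sq : D.r * D.r = D.b * D.a := by
  rw [← rinv, r, mul_inv_rev, binv, ainv]
theorem b_r : D.b * D.r = D.r * (D.r * D.b) := by
  rw [← mul_assoc, r_sq, r, mul_assoc]
theorem b_r' (x : H) : D.b * (D.r * x) = D.r * (D.r * (D.b * x)) := by
  rw [← mul_assoc, b_r]; simp only [mul_assoc]

/-- powers of the rotation -/
def rot (k : ZMod 3) : H := D.r ^ k.val

@[simp] theorem rot_zero : D.rot 0 = 1 := by simp [rot]
@[simp] theorem rot_one : D.rot 1 = D.r := pow_one _
@[simp] theorem rot_two : D.rot 2 = D.r * D.r := pow_two _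

theorem zmod3_cases (k : ZMod 3) : k = 0 ∨ k = 1 ∨ k = 2 := by
  revert k; decide
theorem z2a (e p : ZMod 2) : e + (p + e) = p := by revert e p; decide
theorem z2b (x y z : ZMod 2) : x + y + z + (x + (x + y + z)) + (z + (x + y + z)) = y := by
  revert x y z; decide
theorem z2c (t : ZMod 2) (h : (1 : ZMod 2) + (1 + 1) = t + 1) : t = 0 := by
  revert h; revert t; decide
theorem z2d (e : ZMod 2) : e + e + e = e := by revert e; decide
theorem zmod2_cases (k : ZMod 2) : k = 0 ∨ k = 1 := by
  revert k; decide

theorem rot_add (k l : ZMod 3) : D.rot (k + l) = D.rot k * D.rot l := by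
  have h12 : (1 + 2 : ZMod 3) = 0 := by decide
  have h21 : (2 + 1 : ZMod 3) = 0 := by decide
  have h22 : (2 + 2 : ZMod 3) = 1 := by decide
  have h11 : (1 + 1 : ZMod 3) = 2 := by decide
  rcases zmod3_cases k with rfl | rfl | rfl <;> rcases zmod3_cases l with rfl | rfl | rfl <;>
    simp [h12, h21, h22, h11, mul_assoc, D.r_cube, D.r_cube']

theorem b_rot (k : ZMod 3) : D.b * D.rot k = D.rot (-k) * D.b := by
  have h1 : (-1 : ZMod 3) = 2 := by decide
  have h2 : (-2 : ZMod 3) = 1 := by decide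
  rcases zmod3_cases k with rfl | rfl | rfl <;>
    simp [h1, h2, mul_assoc, D.r_cube', D.b_r, D.b_r']

/-- the flip -/
def bt (t : ZMod 2) : H := if t = 0 then 1 else D.b
@[simp] theorem bt_zero : D.bt 0 = 1 := rfl
@[simp] theorem bt_one : D.bt 1 = D.b := rfl
theorem bt_add (t u : ZMod 2) : D.bt (t + u) = D.bt t * D.bt u := by
  have h11 : (1 + 1 : ZMod 2) = 0 := by decide
  rcases zmod2_cases t with rfl | rfl <;> rcases zmod2_cases u with rfl | rfl <;>
    simp [h11, D.hbb]
theorem bt_c (t : ZMod 2) : D.bt t * D.c = D.c * D.bt t := by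
  rcases zmod2_cases t with rfl | rfl <;> simp [D.hbc]
theorem bt_rot (t : ZMod 2) (k : ZMod 3) :
    D.bt t * D.rot k = D.rot (if t = 0 then k else -k) * D.bt t := by
  rcases zmod2_cases t with rfl | rfl <;> simp [D.b_rot]

/-- elements of the dihedral group -/
def dih (p : ZMod 3 × ZMod 2) : H := D.rot p.1 * D.bt p.2

theorem dih_mul (p q : ZMod 3 × ZMod 2) :
    D.dih p * D.dih q = D.dih (p.1 + (if p.2 = 0 then q.1 else -q.1), p.2 + q.2) := by
  simp only [dih, rot_add, bt_add, mul_assoc]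
  rw [← mul_assoc (D.bt p.2), bt_rot, mul_assoc]

/-- the dihedral group of order 6 -/
def Dih : Subgroup H where
  carrier := Set.range D.dih
  one_mem' := ⟨(0, 0), by simp [dih]⟩
  mul_mem' := by
    rintro _ _ ⟨p, rfl⟩ ⟨q, rfl⟩
    exact ⟨_, (D.dih_mul p q).symm⟩
  inv_mem' := by
    rintro _ ⟨p, rfl⟩
    refine ⟨(if p.2 = 0 then -p.1 else p.1, p.2), ?_⟩
    apply eq_inv_of_mul_eq_one_left
    rw [dih_mul]
    obtain ⟨k, t⟩ := p
    rcases zmod2_cases t with rfl | rfl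
    · simp [dih]
    · have h11 : (1 + 1 : ZMod 2) = 0 := by decide
      simp [dih, h11]

theorem mem_Dih {g : H} : g ∈ D.Dih ↔ ∃ p, D.dih p = g := Iff.rfl
theorem b_mem : D.b ∈ D.Dih := ⟨(0, 1), by simp [dih]⟩
theorem r_mem : D.r ∈ D.Dih := ⟨(1, 0), by simp [dih]⟩
theorem a_mem : D.a ∈ D.Dih := by rw [a_eq]; exact mul_mem D.r_mem D.b_mem
theorem rot_mem (k : ZMod 3) : D.rot k ∈ D.Dih := ⟨(k, 0), by simp [dih]⟩
theorem bt_mem (k : ZMod 2) : D.bt k ∈ D.Dih := ⟨(0, k), by simp [dih]⟩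

/-- additive sign -/
def eps (g : H) : ZMod 2 := Multiplicative.toAdd (D.ε g)
/-- additive `c`-parity -/
def bet (g : H) : ZMod 2 := Multiplicative.toAdd (D.β g)
theorem eps_mul (g h : H) : D.eps (g * h) = D.eps g + D.eps h := by simp [eps]
theorem bet_mul (g h : H) : D.bet (g * h) = D.bet g + D.bet h := by simp [bet]
@[simp] theorem eps_one : D.eps 1 = 0 := by simp [eps]
@[simp] theorem bet_one : D.bet 1 = 0 := by simp [bet]
theorem eps_inv (g : H) : D.eps g⁻¹ = D.eps g := by
  simp [eps, CharTwo.neg_eq]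
theorem bet_inv (g : H) : D.bet g⁻¹ = D.bet g := by
  simp [bet, CharTwo.neg_eq]
@[simp] theorem eps_a : D.eps D.a = 1 := by simp [eps, D.εa]
@[simp] theorem eps_b : D.eps D.b = 1 := by simp [eps, D.εb]
@[simp] theorem eps_c : D.eps D.c = 1 := by simp [eps, D.εc]
@[simp] theorem bet_a : D.bet D.a = 0 := by simp [bet, D.βa]
@[simp] theorem bet_b : D.bet D.b = 0 := by simp [bet, D.βb]
@[simp] theorem bet_c : D.bet D.c = 1 := by simp [bet, D.βc]
@[simp] theorem eps_r : D.eps D.r = 0 := by rw [r, eps_mul]; simp; decide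
@[simp] theorem bet_r : D.bet D.r = 0 := by rw [r, bet_mul]; simp
@[simp] theorem eps_rot (k : ZMod 3) : D.eps (D.rot k) = 0 := by
  rcases zmod3_cases k with rfl | rfl | rfl <;> simp [eps_mul]
@[simp] theorem bet_rot (k : ZMod 3) : D.bet (D.rot k) = 0 := by
  rcases zmod3_cases k with rfl | rfl | rfl <;> simp [bet_mul]
@[simp] theorem eps_bt (k : ZMod 2) : D.eps (D.bt k) = k := by
  rcases zmod2_cases k with rfl | rfl <;> simp
@[simp] theorem bet_bt (k : ZMod 2) : D.bet (D.bt k) = 0 := by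
  rcases zmod2_cases k with rfl | rfl <;> simp
theorem eps_dih (p : ZMod 3 × ZMod 2) : D.eps (D.dih p) = p.2 := by simp [dih, eps_mul]
theorem bet_Dih {g : H} (hg : g ∈ D.Dih) : D.bet g = 0 := by
  obtain ⟨p, rfl⟩ := hg; simp [dih, bet_mul]
theorem c_not_mem : D.c ∉ D.Dih := fun h => by
  have := D.bet_Dih h; simp at this

/-- the conjugate `cac` -/
def s : H := D.c * (D.a * D.c)
theorem s_mem : D.s ∈ D.L := D.hsL
theorem r_mem_L : D.r ∈ D.L := D.hrL
theorem rot_mem_L (k : ZMod 3) : D.rot k ∈ D.L := pow_mem D.r_mem_L _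
theorem b_not_mem : D.b ∉ D.L := fun h => D.hq (mul_mem h (mul_mem D.hsL h))
theorem s_eq : D.s = D.c * (D.r * (D.c * D.b)) := by
  rw [s, a_eq, mul_assoc, D.hbc]
theorem s_sq : D.s * D.s = 1 := by
  rw [s]; simp only [mul_assoc, D.cc']
  rw [← mul_assoc D.a D.a, D.haa, one_mul, D.hcc]
theorem sinv : D.s⁻¹ = D.s := inv_eq_of_mul_eq_one_right D.s_sq
/-- `c r² c = b s` -/
theorem crrc : D.c * (D.r * (D.r * D.c)) = D.b * D.s := by
  rw [← mul_assoc D.r D.r, r_sq, s]; simp only [← mul_assoc]; rw [D.hbc]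

theorem crc_not_mem : D.c * (D.r * D.c) ∉ D.Dih := by
  rintro ⟨⟨k, t⟩, hp⟩
  have hs : D.s = D.dih (k, t) * D.b := by rw [hp, s_eq]; simp only [mul_assoc]
  have he := congrArg D.eps hs
  rw [eps_mul, eps_dih, s, eps_mul, eps_mul] at he
  have ht : t = 0 := by
    simp only [eps_a, eps_b, eps_c] at he
    exact z2c t he
  subst ht
  apply D.b_not_mem
  have h1 : D.b = (D.rot k)⁻¹ * D.s := by rw [hs]; simp [dih]
  rw [h1]
  exact mul_mem (inv_mem (D.rot_mem_L k)) D.s_mem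

theorem r_ne_one : D.r ≠ 1 := fun h => D.crc_not_mem (by
  rw [h, one_mul, D.hcc]; exact one_mem _)

theorem crotc_mem {k : ZMod 3} (h : D.c * (D.rot k * D.c) ∈ D.Dih) : k = 0 := by
  rcases zmod3_cases k with rfl | rfl | rfl
  · rfl
  · rw [rot_one] at h; exact absurd h D.crc_not_mem
  · exfalso
    apply D.crc_not_mem
    have := inv_mem h
    rw [mul_inv_rev, mul_inv_rev, cinv, rot_two, ← rinv, inv_inv, mul_assoc] at this
    exact this

theorem dih_injective : Function.Injective D.dih := by
  rintro ⟨k, t⟩ ⟨l, u⟩ h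
  have h2 : t = u := by simpa [eps_dih] using congrArg D.eps h
  subst h2
  simp only [dih, mul_left_inj] at h
  have h3 : D.rot (k - l) = 1 := by
    have h4 : D.rot (k - l) * D.rot l = D.rot l := by rw [← rot_add, sub_add_cancel, h]
    simpa using h4
  have h5 : k - l = 0 := by
    apply D.crotc_mem
    rw [h3, one_mul, D.hcc]; exact one_mem _
  rw [sub_eq_zero.mp h5]

theorem card_Dih : Nat.card D.Dih = 6 := by
  have h : Nat.card (ZMod 3 × ZMod 2) = Nat.card D.Dih :=
    Nat.card_congr (Equiv.ofInjective _ D.dih_injective)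
  rw [← h]
  simp

/-! ### The space of functions -/

/-- Functions on right `D`-cosets with prescribed sums over neighbourhoods. -/
def IsF (e : ZMod 2) (f : H → ZMod 2) : Prop :=
  (∀ g, f (g * D.a) = f g) ∧ (∀ g, f (g * D.b) = f g) ∧
    ∀ g, f (g * D.c) + f (g * (D.r * D.c)) + f (g * (D.r * (D.r * D.c))) = e

variable {D}
theorem IsF.add {e e' : ZMod 2} {f f' : H → ZMod 2} (h : D.IsF e f) (h' : D.IsF e' f') :
    D.IsF (e + e') (fun g => f g + f' g) :=
  ⟨fun g => by simp only [h.1, h'.1], fun g => by simp only [h.2.1, h'.2.1], fun g => by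
    simp only
    rw [← h.2.2 g, ← h'.2.2 g]; ring⟩
theorem IsF.smul {e : ZMod 2} {f : H → ZMod 2} (h : D.IsF e f) (t : ZMod 2) :
    D.IsF (t * e) (fun g => t * f g) :=
  ⟨fun g => by simp only [h.1], fun g => by simp only [h.2.1], fun g => by
    simp only
    rw [← h.2.2 g]; ring⟩
theorem IsF.left {e : ZMod 2} {f : H → ZMod 2} (h : D.IsF e f) (k : H) :
    D.IsF e (fun g => f (k * g)) :=
  ⟨fun g => by simp only [← mul_assoc k, h.1], fun g => by simp only [← mul_assoc k, h.2.1],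
    fun g => by simp only [← mul_assoc k, h.2.2]⟩
theorem isF_const (e : ZMod 2) : D.IsF e (fun _ => e) :=
  ⟨fun _ => rfl, fun _ => rfl, fun _ => z2d e⟩
theorem IsF.r {e : ZMod 2} {f : H → ZMod 2} (h : D.IsF e f) (g : H) : f (g * D.r) = f g := by
  rw [CData.r, ← mul_assoc, h.2.1, h.1]
theorem IsF.dih {e : ZMod 2} {f : H → ZMod 2} (h : D.IsF e f) (g : H) {d : H} (hd : d ∈ D.Dih) :
    f (g * d) = f g := by
  obtain ⟨⟨k, t⟩, rfl⟩ := hd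
  have hb : ∀ g, f (g * D.bt t) = f g := by
    intro g
    rcases zmod2_cases t with rfl | rfl <;> simp [h.2.1]
  rw [CData.dih, ← mul_assoc, hb]
  rcases zmod3_cases k with rfl | rfl | rfl
  · simp
  · simp [h.r]
  · simp [← mul_assoc, h.r]
variable (D)

open Classical in
/-- The basic finitely supported function. -/
noncomputable def X (g : H) : ZMod 2 := if g ∈ D.L ∨ g * D.b ∈ D.L then 1 else 0

theorem X_eq_one {g : H} (h : g ∈ D.L ∨ g * D.b ∈ D.L) : D.X g = 1 := if_pos h
theorem X_ne {g : H} (h : D.X g ≠ 0) : g ∈ D.L ∨ g * D.b ∈ D.L := by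
  by_contra h'; exact h (if_neg h')
theorem X_one : D.X 1 = 1 := D.X_eq_one (Or.inl (one_mem _))
theorem X_bet {g : H} (h : D.bet g ≠ 0) : D.X g = 0 := by
  by_contra h'
  apply h
  rcases D.X_ne h' with hL | hL
  · rw [bet, D.hβL _ hL]; rfl
  · have h1 : D.bet (g * D.b) = 0 := by rw [bet, D.hβL _ hL]; rfl
    simpa [bet_mul] using h1

/-- membership predicate at a neighbour -/
def Qp (g : H) : Prop := g * D.c ∈ D.L ∨ g * D.c * D.b ∈ D.L

theorem Qp_b (g : H) : D.Qp (g * D.b) ↔ D.Qp g := by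
  have h : g * D.b * D.c = g * D.c * D.b := by rw [mul_assoc, D.hbc, mul_assoc]
  rw [Qp, Qp, h, mul_assoc _ D.b D.b, D.hbb, mul_one]
  exact or_comm

theorem Qp_key1 (g : H) (h : g * D.c ∈ D.L) :
    D.Qp (g * D.r) ∧ ¬ D.Qp (g * (D.r * D.r)) := by
  constructor
  · right
    have : g * D.r * D.c * D.b = g * D.c * D.s := by
      rw [s_eq]; simp only [mul_assoc, D.cc']
    rw [this]; exact mul_mem h D.s_mem
  · have e1 : g * (D.r * D.r) * D.c = g * D.c * (D.b * D.s) := by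
      rw [← crrc]; simp only [mul_assoc, D.cc']
    rintro (h' | h')
    · rw [e1, Subgroup.mul_mem_cancel_left _ h, Subgroup.mul_mem_cancel_right _ D.s_mem] at h'
      exact D.b_not_mem h'
    · rw [e1, mul_assoc, Subgroup.mul_mem_cancel_left _ h, mul_assoc] at h'
      exact D.hq h'

theorem Qp_key (g : H) (h : D.Qp g) :
    (D.Qp (g * D.r) ∧ ¬ D.Qp (g * (D.r * D.r))) ∨
      (¬ D.Qp (g * D.r) ∧ D.Qp (g * (D.r * D.r))) := by
  rcases h with h | h
  · exact Or.inl (D.Qp_key1 g h)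
  · right
    have h' : g * D.b * D.c ∈ D.L := by rw [mul_assoc, D.hbc, ← mul_assoc]; exact h
    obtain ⟨h1, h2⟩ := D.Qp_key1 _ h'
    have e1 : g * D.b * D.r = g * (D.r * D.r) * D.b := by
      rw [mul_assoc, b_r]; simp only [mul_assoc]
    have e2 : g * D.b * (D.r * D.r) = g * D.r * D.b := by
      simp only [mul_assoc, b_r, b_r', r_cube']
    rw [e1, Qp_b] at h1
    rw [e2, Qp_b] at h2
    exact ⟨h2, h1⟩

open Classical in
theorem X_Qp (g : H) : D.X (g * D.c) = if D.Qp g then 1 else 0 := by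
  unfold X Qp; congr

theorem X_isF : D.IsF 0 D.X := by
  refine ⟨fun g => ?_, fun g => ?_, fun g => ?_⟩
  · have h1 : g * D.a * D.b ∈ D.L ↔ g ∈ D.L := by
      rw [mul_assoc]; exact Subgroup.mul_mem_cancel_right _ D.hrL
    have h2 : g * D.a ∈ D.L ↔ g * D.b ∈ D.L := by
      rw [← Subgroup.mul_mem_cancel_right _ D.hrL, ← mul_assoc, mul_assoc g, D.haa, mul_one]
    unfold X
    congr 1
    rw [h1, h2, or_comm]
  · unfold X
    congr 1
    rw [mul_assoc, D.hbb, mul_one, or_comm]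
  · have e1 : g * (D.r * D.c) = g * D.r * D.c := by rw [mul_assoc]
    have e2 : g * (D.r * (D.r * D.c)) = g * (D.r * D.r) * D.c := by simp only [mul_assoc]
    rw [e1, e2, X_Qp, X_Qp, X_Qp]
    have k0 := D.Qp_key g
    have k1 := D.Qp_key (g * D.r)
    have k2 := D.Qp_key (g * (D.r * D.r))
    simp only [mul_assoc, r_cube', r_cube, mul_one] at k0 k1 k2
    by_cases h0 : D.Qp g <;> by_cases h1 : D.Qp (g * D.r) <;>
      by_cases h2 : D.Qp (g * (D.r * D.r)) <;> simp [h0, h1, h2] at k0 k1 k2 ⊢ <;> decide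

theorem X_crc : D.X (D.c * (D.r * D.c)) = 1 := D.X_eq_one (Or.inr (by
  have h := D.s_mem
  rw [s_eq] at h
  simpa only [mul_assoc] using h))

theorem X_crrc : D.X (D.c * (D.r * (D.r * D.c))) = 0 := by
  have h := D.X_isF.2.2 D.c
  rw [X_crc, D.hcc, X_one] at h
  generalize D.X (D.c * (D.r * (D.r * D.c))) = z at h ⊢
  revert h; revert z; decide

/-- Prescribing the values of a function around a vertex. -/
theorem exists_isF (g : H) (e p φ0 φ1 φ2 : ZMod 2) (h : φ0 + φ1 + φ2 = e) :
    ∃ f, D.IsF e f ∧ f g = p ∧ f (g * D.c) = φ0 ∧ f (g * (D.r * D.c)) = φ1 ∧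
      f (g * (D.r * (D.r * D.c))) = φ2 := by
  have hF := (((isF_const (D := D) e).add ((D.X_isF.left g⁻¹).smul (p + e))).add
    ((D.X_isF.left (g * D.c)⁻¹).smul (φ0 + e))).add
    ((D.X_isF.left (g * (D.r * D.c))⁻¹).smul (φ2 + e))
  refine ⟨_, by simpa only [mul_zero, add_zero] using hF, ?_, ?_, ?_, ?_⟩
  · have h1 : D.X ((g * D.c)⁻¹ * g) = 0 := D.X_bet (by simp [bet_mul, bet_inv])
    have h2 : D.X ((g * (D.r * D.c))⁻¹ * g) = 0 := D.X_bet (by simp [bet_mul, bet_inv])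
    simp only [h1, h2, inv_mul_cancel, X_one]
    simp only [mul_one, mul_zero, add_zero, z2a]
  · have h1 : D.X (g⁻¹ * (g * D.c)) = 0 := D.X_bet (by simp [bet_mul, bet_inv])
    have h2 : (g * (D.r * D.c))⁻¹ * (g * D.c) = D.c * (D.r * (D.r * D.c)) := by
      simp only [mul_inv_rev, cinv, rinv, mul_assoc, inv_mul_cancel_left]
    simp only [h1, h2, inv_mul_cancel, X_one, X_crrc]
    simp only [mul_one, mul_zero, add_zero, z2a]
  · have h1 : D.X (g⁻¹ * (g * (D.r * D.c))) = 0 := D.X_bet (by simp [bet_mul, bet_inv])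
    have h2 : (g * D.c)⁻¹ * (g * (D.r * D.c)) = D.c * (D.r * D.c) := by
      simp only [mul_inv_rev, cinv, mul_assoc, inv_mul_cancel_left]
    simp only [h1, h2, inv_mul_cancel, X_one, X_crc]
    subst h; simp only [mul_one, mul_zero, add_zero, z2b]
  · have h1 : D.X (g⁻¹ * (g * (D.r * (D.r * D.c)))) = 0 :=
      D.X_bet (by simp [bet_mul, bet_inv])
    have h2 : (g * D.c)⁻¹ * (g * (D.r * (D.r * D.c))) = D.c * (D.r * (D.r * D.c)) := by
      simp only [mul_inv_rev, cinv, mul_assoc, inv_mul_cancel_left]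
    have h3 : (g * (D.r * D.c))⁻¹ * (g * (D.r * (D.r * D.c))) = D.c * (D.r * D.c) := by
      simp only [mul_inv_rev, cinv, mul_assoc, inv_mul_cancel_left]
    simp only [h1, h2, h3, X_crc, X_crrc]
    simp only [mul_one, mul_zero, add_zero, z2a]

end CData

/-! ### The graph -/

namespace CData
variable {H : Type} [Group H] (D : CData H) {V : Type} (E : V ≃ (H ⧸ D.Dih) × ZMod 2)

/-- The vertex with label `(g D, i)`. -/
def pt (g : H) (i : ZMod 2) : V := E.symm (QuotientGroup.mk g, i)

theorem pt_eq {g g' : H} {i i' : ZMod 2} :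
    D.pt E g i = D.pt E g' i' ↔ g⁻¹ * g' ∈ D.Dih ∧ i = i' := by
  rw [pt, pt, E.symm.injective.eq_iff, Prod.mk.injEq, QuotientGroup.eq]

theorem pt_surj (v : V) : ∃ g i, v = D.pt E g i := by
  obtain ⟨g, hg⟩ := QuotientGroup.mk_surjective (E v).1
  refine ⟨g, (E v).2, ?_⟩
  rw [pt, hg, Prod.mk.eta, Equiv.symm_apply_apply]

theorem pt_mul {d : H} (hd : d ∈ D.Dih) (g : H) (i : ZMod 2) :
    D.pt E (g * d) i = D.pt E g i := by
  rw [pt_eq]; refine ⟨?_, rfl⟩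
  rw [mul_inv_rev, mul_assoc, inv_mul_cancel, mul_one]; exact inv_mem hd

/-- The graph. -/
def Gr : SimpleGraph V where
  Adj u v := ∃ g i j, u = D.pt E g i ∧ v = D.pt E (g * D.c) j
  symm := ⟨by
    rintro u v ⟨g, i, j, rfl, rfl⟩
    exact ⟨g * D.c, j, i, rfl, by rw [mul_assoc, D.hcc, mul_one]⟩⟩
  loopless := ⟨by
    rintro u ⟨g, i, j, h1, h2⟩
    rw [h1, pt_eq, inv_mul_cancel_left] at h2
    exact D.c_not_mem h2.1⟩

theorem adj_iff (g : H) (i : ZMod 2) (v : V) : (D.Gr E).Adj (D.pt E g i) v ↔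
    ∃ k j, v = D.pt E (g * (D.rot k * D.c)) j := by
  constructor
  · rintro ⟨g', i', j, h, rfl⟩
    rw [pt_eq] at h
    obtain ⟨⟨⟨k, t⟩, hd⟩, -⟩ := h
    refine ⟨k, j, ?_⟩
    have e : g' = g * D.dih (k, t) := by rw [hd, mul_inv_cancel_left]
    have e2 : g' * D.c = g * (D.rot k * D.c) * D.bt t := by
      rw [e, dih]; simp only [mul_assoc]; rw [bt_c]
    rw [e2, D.pt_mul E (D.bt_mem t)]
  · rintro ⟨k, j, rfl⟩
    exact ⟨g * D.rot k, i, j, (D.pt_mul E (D.rot_mem k) g i).symm, by rw [mul_assoc]⟩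

/-- `σ` acts as the pair `(h, f)`. -/
def Acts (σ : Equiv.Perm V) (h : H) (f : H → ZMod 2) : Prop :=
  D.IsF (D.eps h) f ∧ ∀ g i, σ (D.pt E g i) = D.pt E (h * g) (i + f g)

/-- The group. -/
def Gp : Subgroup (Equiv.Perm V) where
  carrier := {σ | ∃ h f, D.Acts E σ h f}
  one_mem' := ⟨1, fun _ => 0, by rw [eps_one]; exact isF_const 0, fun g i => by simp⟩
  mul_mem' := by
    rintro σ τ ⟨h, f, hf, hσ⟩ ⟨h', f', hf', hτ⟩
    refine ⟨h * h', _, by rw [eps_mul, add_comm]; exact hf'.add (hf.left h'), fun g i => ?_⟩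
    rw [Equiv.Perm.mul_apply, hτ, hσ, mul_assoc, add_assoc]
  inv_mem' := by
    rintro σ ⟨h, f, hf, hσ⟩
    refine ⟨h⁻¹, _, by rw [eps_inv]; exact hf.left h⁻¹, fun g i => ?_⟩
    rw [Equiv.Perm.inv_eq_iff_eq, hσ, mul_inv_cancel_left, add_assoc, CharTwo.add_self_eq_zero,
      add_zero]

theorem mem_Gp {σ : Equiv.Perm V} : σ ∈ D.Gp E ↔ ∃ h f, D.Acts E σ h f := Iff.rfl

theorem exists_acts [Finite V] (h : H) (f : H → ZMod 2) (hf : D.IsF (D.eps h) f) :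
    ∃ σ, D.Acts E σ h f := by
  choose γ ι hγ using D.pt_surj E
  set F : V → V := fun v => D.pt E (h * γ v) (ι v + f (γ v)) with hF
  have hFp : ∀ g i, F (D.pt E g i) = D.pt E (h * g) (i + f g) := by
    intro g i
    have h1 := hγ (D.pt E g i)
    rw [pt_eq] at h1
    obtain ⟨h1, h2⟩ := h1
    have h3 : γ (D.pt E g i) = g * (g⁻¹ * γ (D.pt E g i)) := by rw [mul_inv_cancel_left]
    simp only [hF]
    rw [← h2, h3, hf.dih g h1, ← mul_assoc, D.pt_mul E h1]
  have hinj : Function.Injective F := by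
    intro u v huv
    obtain ⟨g, i, rfl⟩ := D.pt_surj E u
    obtain ⟨g', i', rfl⟩ := D.pt_surj E v
    rw [hFp, hFp, pt_eq] at huv
    obtain ⟨h1, h2⟩ := huv
    have h3 : (h * g)⁻¹ * (h * g') = g⁻¹ * g' := by group
    rw [h3] at h1
    have h4 : f g' = f g := by
      have := hf.dih g h1
      rwa [mul_inv_cancel_left] at this
    rw [pt_eq]
    refine ⟨h1, ?_⟩
    rw [h4] at h2
    exact add_right_cancel h2
  exact ⟨Equiv.ofBijective F (Finite.injective_iff_bijective.mp hinj), hf, hFp⟩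

theorem Gp_adj {σ : Equiv.Perm V} (hσ : σ ∈ D.Gp E) {u v : V} (h : (D.Gr E).Adj u v) :
    (D.Gr E).Adj (σ u) (σ v) := by
  obtain ⟨k, f, hf, hσ⟩ := hσ
  obtain ⟨g, i, j, rfl, rfl⟩ := h
  exact ⟨k * g, i + f g, j + f (g * D.c), hσ _ _, by rw [hσ, mul_assoc]⟩

theorem Gp_aut {σ : Equiv.Perm V} (hσ : σ ∈ D.Gp E) : IsGraphAut (D.Gr E) σ := by
  intro u v
  refine ⟨fun h => ?_, D.Gp_adj E hσ⟩
  simpa using D.Gp_adj E (inv_mem hσ) h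

theorem arcTrans [Finite V] : ArcTransitiveOn (D.Gr E) (D.Gp E) := by
  rintro u v u' v' ⟨g, i, j, rfl, rfl⟩ ⟨g', i', j', rfl, rfl⟩
  obtain ⟨f, hf, h1, h2, -⟩ := D.exists_isF g (D.eps (g' * g⁻¹)) (i' - i) (j' - j)
    (D.eps (g' * g⁻¹) - (j' - j)) 0 (by ring)
  obtain ⟨σ, hσ⟩ := D.exists_acts E _ f hf
  refine ⟨σ, ⟨_, _, hσ⟩, ?_, ?_⟩
  · rw [hσ.2, h1, inv_mul_cancel_right, add_sub_cancel]
  · rw [hσ.2, h2, ← mul_assoc, inv_mul_cancel_right, add_sub_cancel]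

theorem reach_c (g : H) (i j : ZMod 2) :
    (D.Gr E).Reachable (D.pt E g i) (D.pt E (g * D.c) j) :=
  SimpleGraph.Adj.reachable ⟨g, i, j, rfl, rfl⟩

theorem reach_same (g : H) (i j : ZMod 2) :
    (D.Gr E).Reachable (D.pt E g i) (D.pt E g j) :=
  (D.reach_c E g i 0).trans (D.reach_c E g j 0).symm

theorem reach (g : H) : (D.Gr E).Reachable (D.pt E 1 0) (D.pt E g 0) := by
  have hg : g ∈ Subgroup.closure {D.a, D.b, D.c} := by rw [D.gen]; trivial
  have key : ∀ x y : H, y ∈ ({D.a, D.b, D.c} : Set H) →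
      (D.Gr E).Reachable (D.pt E 1 0) (D.pt E x 0) →
      (D.Gr E).Reachable (D.pt E 1 0) (D.pt E (x * y) 0) := by
    rintro x y (rfl | rfl | rfl) h
    · rw [D.pt_mul E D.a_mem]; exact h
    · rw [D.pt_mul E D.b_mem]; exact h
    · exact h.trans (D.reach_c E x 0 0)
  induction hg using Subgroup.closure_induction_right with
  | one => exact SimpleGraph.Reachable.refl _
  | mul_right x hx y hy ih => exact key x y hy ih
  | mul_inv_cancel x hx y hy ih =>
    have : y⁻¹ = y := by
      rcases hy with rfl | rfl | rfl
      exacts [D.ainv, D.binv, D.cinv]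
    rw [this]; exact key x y hy ih

theorem Gr_connected : (D.Gr E).Connected := by
  have : Nonempty V := ⟨D.pt E 1 0⟩
  refine ⟨fun u v => ?_⟩
  have h : ∀ w, (D.Gr E).Reachable (D.pt E 1 0) w := by
    intro w
    obtain ⟨g, i, rfl⟩ := D.pt_surj E w
    exact (D.reach E g).trans (D.reach_same E g 0 i)
  exact (h u).symm.trans (h v)

/-- Neighbours of a vertex. -/
noncomputable def nb (g : H) (i : ZMod 2) :
    ZMod 3 × ZMod 2 ≃ (D.Gr E).neighborSet (D.pt E g i) :=
  Equiv.ofBijective (fun p => ⟨D.pt E (g * (D.rot p.1 * D.c)) p.2,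
      (D.adj_iff E g i _).mpr ⟨p.1, p.2, rfl⟩⟩) (by
    constructor
    · rintro ⟨k, j⟩ ⟨k', j'⟩ h
      have h' := congrArg Subtype.val h
      simp only at h'
      rw [pt_eq] at h'
      obtain ⟨h1, h2⟩ := h'
      have e : (g * (D.rot k * D.c))⁻¹ * (g * (D.rot k' * D.c)) =
          D.c * (D.rot (-k + k') * D.c) := by
        have e1 : (D.rot k)⁻¹ = D.rot (-k) := by
          apply inv_eq_of_mul_eq_one_right
          rw [← rot_add, add_neg_cancel, rot_zero]
        rw [rot_add]
        simp only [mul_inv_rev, cinv, e1, mul_assoc, inv_mul_cancel_left]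
      rw [e] at h1
      have h3 := D.crotc_mem h1
      rw [neg_add_eq_zero.mp h3, h2]
    · rintro ⟨v, hv⟩
      obtain ⟨k, j, rfl⟩ := (D.adj_iff E g i v).mp hv
      exact ⟨(k, j), rfl⟩)

theorem nb_val (g : H) (i : ZMod 2) (p : ZMod 3 × ZMod 2) :
    (D.nb E g i p : V) = D.pt E (g * (D.rot p.1 * D.c)) p.2 := rfl

theorem card_nbr (v : V) : Nat.card ((D.Gr E).neighborSet v) = 6 := by
  obtain ⟨g, i, rfl⟩ := D.pt_surj E v
  rw [← Nat.card_congr (D.nb E g i)]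
  simp

/-- How an element acts on the neighbours. -/
theorem acts_nb {σ : Equiv.Perm V} {h : H} {f : H → ZMod 2} (hσ : D.Acts E σ h f) (g : H)
    (i : ZMod 2) (l : ZMod 3) (t : ZMod 2) (hh : h * g = g * D.dih (l, t))
    (p : ZMod 3 × ZMod 2) :
    σ (D.nb E g i p) = D.nb E g i (modelAct l t (fun k => f (g * (D.rot k * D.c))) p) := by
  obtain ⟨k, j⟩ := p
  rw [nb_val, nb_val, hσ.2, ← mul_assoc, hh]
  have e : g * D.dih (l, t) * (D.rot k * D.c) =
      g * (D.rot (if t = 0 then l + k else l - k) * D.c) * D.bt t := by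
    simp only [mul_assoc, dih]
    rw [← bt_c, ← mul_assoc (D.bt t), bt_rot, ← mul_assoc (D.rot l), ← mul_assoc (D.rot l),
      ← rot_add, mul_assoc]
    congr 2
    split_ifs <;> simp [sub_eq_add_neg]
  rw [e, D.pt_mul E (D.bt_mem t)]
  rfl

theorem local_iff [Finite V] (g : H) (i : ZMod 2)
    (p : Equiv.Perm ((D.Gr E).neighborSet (D.pt E g i))) :
    p ∈ localActionSet (D.Gr E) (D.Gp E) (D.pt E g i) ↔ ∃ l t φ, φ 0 + φ 1 + φ 2 = t ∧
      ∀ x, p (D.nb E g i x) = D.nb E g i (modelAct l t φ x) := by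
  constructor
  · rintro ⟨σ, ⟨h, f, hσ⟩, hfix, hp⟩
    have h1 := hσ.2 g i
    rw [hfix, pt_eq] at h1
    obtain ⟨⟨⟨l, t⟩, hd⟩, -⟩ := h1
    have hh : h * g = g * D.dih (l, t) := by rw [hd, mul_inv_cancel_left]
    refine ⟨l, t, fun k => f (g * (D.rot k * D.c)), ?_, fun x => ?_⟩
    · have h2 := hσ.1.2.2 g
      have h3 : D.eps h = t := by
        have h4 := congrArg D.eps hh
        rw [eps_mul, eps_mul, eps_dih, add_comm] at h4
        exact add_left_cancel h4
      rw [h3] at h2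
      simpa only [rot_zero, rot_one, rot_two, one_mul, mul_assoc] using h2
    · apply Subtype.ext
      rw [hp]
      exact D.acts_nb E hσ g i l t hh x
  · rintro ⟨l, t, φ, hφ, hp⟩
    obtain ⟨f, hf, h0, h1, h2, h3⟩ := D.exists_isF g t 0 (φ 0) (φ 1) (φ 2) hφ
    have he : D.eps (g * D.dih (l, t) * g⁻¹) = t := by
      rw [eps_mul, eps_mul, eps_inv, eps_dih, add_comm, ← add_assoc, CharTwo.add_self_eq_zero,
        zero_add]
    obtain ⟨σ, hσ⟩ := D.exists_acts E (g * D.dih (l, t) * g⁻¹) f (by rw [he]; exact hf)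
    have hφf : (fun k => f (g * (D.rot k * D.c))) = φ := by
      funext k
      rcases zmod3_cases k with rfl | rfl | rfl
      · simpa using h1
      · simpa using h2
      · simpa [mul_assoc] using h3
    refine ⟨σ, ⟨_, _, hσ⟩, ?_, fun u => ?_⟩
    · rw [hσ.2, h0, inv_mul_cancel_right, add_zero, D.pt_mul E ⟨_, rfl⟩]
    · obtain ⟨x, rfl⟩ := (D.nb E g i).surjective u
      rw [hp, D.acts_nb E hσ g i l t (by rw [inv_mul_cancel_right]) x, hφf]

theorem local_iso [Finite V] (v : V) : PermIsomorphic (localActionSet (D.Gr E) (D.Gp E) v)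
    ((S46c : Subgroup _) : Set (Equiv.Perm (Equiv.Perm (Fin 4) ⧸ Hc))) := by
  obtain ⟨g, i, rfl⟩ := D.pt_surj E v
  refine ⟨(D.nb E g i).symm.trans axisEquiv.symm, fun q => ?_⟩
  rw [SetLike.mem_coe, mem_S46c_iff]
  constructor
  · rintro ⟨l, t, φ, hφ, hq⟩
    refine ⟨((D.nb E g i).symm.trans axisEquiv.symm).permCongr.symm q, ?_, fun ω => ?_⟩
    · rw [local_iff]
      refine ⟨l, t, φ, hφ, fun x => ?_⟩
      simp only [Equiv.permCongr_symm, Equiv.permCongr_apply, Equiv.symm_symm, Equiv.trans_apply,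
        Equiv.symm_apply_apply, Equiv.symm_trans_apply]
      rw [hq]
    · simp [Equiv.permCongr_symm, Equiv.permCongr_apply]
  · rintro ⟨p, hp, h⟩
    rw [local_iff] at hp
    obtain ⟨l, t, φ, hφ, hp⟩ := hp
    refine ⟨l, t, φ, hφ, fun x => ?_⟩
    have h1 := h (D.nb E g i x)
    rw [hp] at h1
    simp only [Equiv.trans_apply, Equiv.symm_apply_apply] at h1
    rw [← h1, Equiv.apply_symm_apply]

end CData

/-! ### Size of the vertex-stabilisers -/

namespace CData
variable {H : Type} [Group H] (D : CData H) {V : Type} (E : V ≃ (H ⧸ D.Dih) × ZMod 2)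

/-- The space of functions with vanishing neighbourhood sums. -/
def Nsp : Submodule (ZMod 2) (H → ZMod 2) where
  carrier := {f | D.IsF 0 f}
  zero_mem' := isF_const (D := D) 0
  add_mem' := by
    intro f f' h h'
    have := IsF.add h h'
    rwa [add_zero] at this
  smul_mem' := by
    intro t f h
    have := IsF.smul h t
    rwa [mul_zero] at this

/-- translates of the basic function -/
noncomputable def Xt (k : H) : H → ZMod 2 := fun g => D.X (k * g)

theorem support_card [Finite H] (k : H) : {g | D.Xt k g ≠ 0}.ncard ≤ 240 := by
  have hsub : {g | D.Xt k g ≠ 0} ⊆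
      (fun l => k⁻¹ * l) '' (D.L : Set H) ∪ (fun l => k⁻¹ * l * D.b) '' (D.L : Set H) := by
    intro g hg
    rcases D.X_ne hg with h | h
    · exact Or.inl ⟨_, h, by simp⟩
    · exact Or.inr ⟨_, h, by simp [mul_assoc, D.hbb]⟩
  have hL : (D.L : Set H).ncard ≤ 120 := D.cardL
  calc {g | D.Xt k g ≠ 0}.ncard ≤ _ := Set.ncard_le_ncard hsub (Set.toFinite _)
    _ ≤ _ := Set.ncard_union_le _ _
    _ ≤ (D.L : Set H).ncard + (D.L : Set H).ncard :=
        add_le_add (Set.ncard_image_le (Set.toFinite _)) (Set.ncard_image_le (Set.toFinite _))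
    _ ≤ 240 := by omega

theorem exists_dim [Finite H] : ∃ d : ℕ, Nat.card H ≤ 240 * d ∧ 2 ^ d ≤ Nat.card D.Nsp := by
  classical
  obtain ⟨B, hBS, hspan, hli⟩ := exists_linearIndependent (ZMod 2) (Set.range D.Xt)
  have : Fintype H := Fintype.ofFinite H
  have hBfin : B.Finite := Set.toFinite B
  have : Fintype B := hBfin.fintype
  refine ⟨hBfin.toFinset.card, ?_, ?_⟩
  · have hcov : (Finset.univ : Finset H) ⊆
        hBfin.toFinset.biUnion (fun f => Finset.univ.filter (fun g => f g ≠ 0)) := by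
      intro g _
      by_contra hg
      simp only [Finset.mem_biUnion, Set.Finite.mem_toFinset, Finset.mem_filter, Finset.mem_univ,
        true_and, not_exists, not_and, not_not] at hg
      have h1 : D.Xt g⁻¹ ∈ Submodule.span (ZMod 2) B := by
        rw [hspan]; exact Submodule.subset_span ⟨_, rfl⟩
      have h2 : Submodule.span (ZMod 2) B ≤
          LinearMap.ker (LinearMap.proj (R := ZMod 2) (φ := fun _ : H => ZMod 2) g) := by
        rw [Submodule.span_le]
        intro f hf
        exact hg f hf
      have h3 : D.Xt g⁻¹ g = 0 := h2 h1
      rw [Xt, inv_mul_cancel, X_one] at h3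
      exact one_ne_zero h3
    have h4 := Finset.card_le_card hcov
    rw [Finset.card_univ, ← Nat.card_eq_fintype_card] at h4
    refine h4.trans ?_
    rw [mul_comm]
    apply Finset.card_biUnion_le_card_mul
    intro f hf
    rw [Set.Finite.mem_toFinset] at hf
    obtain ⟨k, rfl⟩ := hBS hf
    have h5 := D.support_card k
    rw [← Set.ncard_coe_finset]
    simpa using h5
  · have h1 : Submodule.span (ZMod 2) B ≤ D.Nsp := by
      rw [Submodule.span_le]
      intro f hf
      obtain ⟨k, rfl⟩ := hBS hf
      exact D.X_isF.left k
    have h2 : Nat.card (Submodule.span (ZMod 2) B) = 2 ^ hBfin.toFinset.card := by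
      have h3 := Module.natCard_eq_pow_finrank (K := ZMod 2) (V := Submodule.span (ZMod 2) B)
      rw [h3, Nat.card_zmod, finrank_span_set_eq_card hli]
      congr 2
      ext; simp
    rw [← h2]
    exact Nat.card_le_card_of_injective _ (Submodule.inclusion_injective h1)

theorem card_Nsp_le [Finite H] [Finite V] (v : V) :
    Nat.card D.Nsp ≤ Nat.card ↥(D.Gp E ⊓ MulAction.stabilizer (Equiv.Perm V) v) * 2 := by
  obtain ⟨g, i, rfl⟩ := D.pt_surj E v
  have hex : ∀ f : D.Nsp, ∃ σ, D.Acts E σ 1 (fun x => f.1 x + f.1 g * D.Xt g⁻¹ x) := by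
    intro f
    apply D.exists_acts
    have := IsF.add (D := D) (show D.IsF 0 f.1 from f.2) ((D.X_isF.left g⁻¹).smul (f.1 g))
    rwa [mul_zero, add_zero, ← D.eps_one] at this
  choose σ hσ using hex
  have hX : D.Xt g⁻¹ g = 1 := by rw [Xt, inv_mul_cancel, X_one]
  have hmem : ∀ f, σ f ∈ D.Gp E ⊓ MulAction.stabilizer (Equiv.Perm V) (D.pt E g i) := by
    intro f
    refine ⟨⟨_, _, hσ f⟩, ?_⟩
    change σ f (D.pt E g i) = D.pt E g i
    rw [(hσ f).2]
    simp only [hX, mul_one, CharTwo.add_self_eq_zero, add_zero, one_mul]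
  have hinj : Function.Injective (fun f : D.Nsp =>
      ((⟨σ f, hmem f⟩, f.1 g) :
        ↥(D.Gp E ⊓ MulAction.stabilizer (Equiv.Perm V) (D.pt E g i)) × ZMod 2)) := by
    intro f f' h
    simp only [Prod.mk.injEq, Subtype.mk.injEq] at h
    obtain ⟨h1, h2⟩ := h
    apply Subtype.ext
    funext x
    have h3 := (hσ f).2 x 0
    rw [h1, (hσ f').2, pt_eq] at h3
    have h4 := h3.2
    simp only [zero_add] at h4
    rw [h2] at h4
    exact (add_right_cancel h4).symm
  have := Nat.card_le_card_of_injective _ hinj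
  rwa [Nat.card_prod, Nat.card_zmod] at this

theorem stab_bound [Finite H] [Finite V] (hH : 480 < Nat.card H) (v : V) (m : ℕ)
    (hm : 3 * m = Nat.card H) :
    2 ^ m ≤ Nat.card ↥(D.Gp E ⊓ MulAction.stabilizer (Equiv.Perm V) v) ^ 144 := by
  obtain ⟨d, hd, hN⟩ := D.exists_dim
  have h1 := hN.trans (D.card_Nsp_le E v)
  obtain ⟨e, rfl⟩ : ∃ e, d = e + 1 := ⟨d - 1, by omega⟩
  have h2 : 2 ^ e ≤ Nat.card ↥(D.Gp E ⊓ MulAction.stabilizer (Equiv.Perm V) v) := by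
    rw [pow_succ] at h1
    exact Nat.le_of_mul_le_mul_right h1 (by norm_num)
  calc 2 ^ m ≤ 2 ^ (e * 144) := Nat.pow_le_pow_right (by norm_num) (by omega)
    _ = (2 ^ e) ^ 144 := pow_mul _ _ _
    _ ≤ _ := Nat.pow_le_pow_left h2 144

end CData

/-- `S₄(6c)` is of exponential type: there are connected `6`-regular graphs `Γ` of
unboundedly large order together with arc-transitive groups of automorphisms `G` with local
action `S₄(6c)` and with vertex-stabilisers of order at least `2^(|V(Γ)|/144)`. -/
theorem statement2 (M : ℕ) :
    ∃ (m : ℕ) (Γ : SimpleGraph (Fin m)) (G : Subgroup (Equiv.Perm (Fin m))),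
      M ≤ m ∧ Γ.Connected ∧ (∀ v : Fin m, Nat.card (Γ.neighborSet v) = 6) ∧
      (∀ g ∈ G, IsGraphAut Γ g) ∧ ArcTransitiveOn Γ G ∧
      (∀ v : Fin m, PermIsomorphic (localActionSet Γ G v)
        ((S46c : Subgroup _) : Set (Equiv.Perm (Equiv.Perm (Fin 4) ⧸ Hc)))) ∧
      (∀ v : Fin m,
        2 ^ m ≤ Nat.card ↥(G ⊓ MulAction.stabilizer (Equiv.Perm (Fin m)) v) ^ 144) := by
  obtain ⟨H, _, _, D, hK⟩ := exists_data (3 * M + 480)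
  set m := Nat.card ((H ⧸ D.Dih) × ZMod 2) with hmdef
  have hm : 3 * m = Nat.card H := by
    rw [hmdef, Nat.card_prod, Nat.card_zmod, Subgroup.card_eq_card_quotient_mul_card_subgroup D.Dih,
      D.card_Dih]
    ring
  have : Finite ((H ⧸ D.Dih) × ZMod 2) := inferInstance
  let E : Fin m ≃ (H ⧸ D.Dih) × ZMod 2 := (Finite.equivFin _).symm
  refine ⟨m, D.Gr E, D.Gp E, by omega, D.Gr_connected E, D.card_nbr E,
    fun g hg => D.Gp_aut E hg, D.arcTrans E, D.local_iso E, fun v => ?_⟩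
  exact D.stab_bound E (by omega) v m hm
end
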